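/- Gradient growth bound for the logarithmic Schrödinger equation: in the same setting (U twice differentiable, φ solving i∂_t φ = −Lφ + λφ log(|φ|^2/μ|φ|^2) with initial data f ∈ H^1(μ)), one has μ|∇φ(·,t)|^2 ≤ e^{2|λ|t}·μ|∇f|^2 for all t ≥ 0. -/

import Mathlib

open MeasureTheory Real

noncomputable section

/-- `j`-th partial derivative of a complex-valued function on `ℝⁿ`. -/
def pdC (n : ℕ) (f : EuclideanSpace ℝ (Fin n) → ℂ) (j : Fin n)
    (x : EuclideanSpace ℝ (Fin n)) : ℂ :=
  fderiv ℝ f x (EuclideanSpace.single j 1)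

/-- `j`-th partial derivative of a real-valued function on `ℝⁿ`. -/
def pdR (n : ℕ) (f : EuclideanSpace ℝ (Fin n) → ℝ) (j : Fin n)
    (x : EuclideanSpace ℝ (Fin n)) : ℝ :=
  fderiv ℝ f x (EuclideanSpace.single j 1)

/-- The drift operator `L f = Δf − ∇U·∇f` acting on complex-valued functions. -/
def LopC (n : ℕ) (U : EuclideanSpace ℝ (Fin n) → ℝ) (f : EuclideanSpace ℝ (Fin n) → ℂ)
    (x : EuclideanSpace ℝ (Fin n)) : ℂ :=
  (∑ j : Fin n, pdC n (fun y => pdC n f j y) j x) -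
    ∑ j : Fin n, (pdR n U j x : ℂ) * pdC n f j x

/-- Squared length of the gradient of a complex-valued function: `∑ⱼ |∂ⱼ f|²`. -/
def gradSqC (n : ℕ) (f : EuclideanSpace ℝ (Fin n) → ℂ) (x : EuclideanSpace ℝ (Fin n)) : ℝ :=
  ∑ j : Fin n, ‖pdC n f j x‖ ^ 2

section LogSchrodinger

open scoped ComplexConjugate

/-- Euclidean space of dimension `n`. -/
abbrev Eu (n : ℕ) := EuclideanSpace ℝ (Fin n)

/-- Smooth complex valued functions. -/
abbrev Smth {n : ℕ} (f : Eu n → ℂ) : Prop := ContDiff ℝ (⊤ : ℕ∞) f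

/-- Smooth compactly supported complex valued functions. -/
def IsTest {n : ℕ} (f : Eu n → ℂ) : Prop := Smth f ∧ HasCompactSupport f

section Calculus

variable {n : ℕ} {U : Eu n → ℝ} {f g : Eu n → ℂ}

lemma Smth.differentiable (hf : Smth f) : Differentiable ℝ f :=
  ContDiff.differentiable hf (by simp)

lemma Smth.cont (hf : Smth f) : Continuous f := ContDiff.continuous hf

lemma Smth.pdC (hf : Smth f) (j : Fin n) : Smth (pdC n f j) := by
  have : ContDiff ℝ (⊤ : ℕ∞) (fderiv ℝ f) := hf.fderiv_right (by simp)
  exact this.clm_apply contDiff_const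

lemma contDiff_pdR (hU : ContDiff ℝ (⊤ : ℕ∞) U) (j : Fin n) :
    ContDiff ℝ (⊤ : ℕ∞) (pdR n U j) := by
  have : ContDiff ℝ (⊤ : ℕ∞) (fderiv ℝ U) := hU.fderiv_right (by simp)
  exact this.clm_apply contDiff_const

lemma Smth.ofReal {u : Eu n → ℝ} (hu : ContDiff ℝ (⊤ : ℕ∞) u) : Smth (fun x => (u x : ℂ)) :=
  Complex.ofRealCLM.contDiff.comp hu

lemma Smth.conj (hf : Smth f) : Smth (fun x => conj (f x)) :=
  Complex.conjCLE.contDiff.comp hf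

lemma pdC_sub (hf : Smth f) (hg : Smth g) (j : Fin n) (x : Eu n) :
    pdC n (fun y => f y - g y) j x = pdC n f j x - pdC n g j x := by
  unfold pdC
  rw [fderiv_fun_sub (hf.differentiable x) (hg.differentiable x)]; rfl

lemma pdC_mul (hf : Smth f) (hg : Smth g) (j : Fin n) (x : Eu n) :
    pdC n (fun y => f y * g y) j x = f x * pdC n g j x + pdC n f j x * g x := by
  unfold pdC
  rw [fderiv_fun_mul (hf.differentiable x) (hg.differentiable x)]
  simp [mul_comm]

lemma pdC_const_mul (c : ℂ) (hf : Smth f) (j : Fin n) (x : Eu n) :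
    pdC n (fun y => c * f y) j x = c * pdC n f j x := by
  unfold pdC
  rw [fderiv_const_mul (hf.differentiable x)]; rfl

lemma pdC_conj (f : Eu n → ℂ) (j : Fin n) (x : Eu n) :
    pdC n (fun y => conj (f y)) j x = conj (pdC n f j x) := by
  unfold pdC
  have : (fun y => conj (f y)) = Complex.conjCLE ∘ f := rfl
  rw [this, ContinuousLinearEquiv.comp_fderiv]; rfl

lemma pdC_ofReal {u : Eu n → ℝ} (hu : ContDiff ℝ (⊤ : ℕ∞) u) (j : Fin n) (x : Eu n) :
    pdC n (fun y => (u y : ℂ)) j x = (pdR n u j x : ℂ) := by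
  unfold pdC pdR
  have h1 : DifferentiableAt ℝ u x := (hu.differentiable (by simp)) x
  have := (Complex.ofRealCLM.hasFDerivAt.comp x h1.hasFDerivAt).fderiv
  have h2 : (fun y => (u y : ℂ)) = Complex.ofRealCLM ∘ u := rfl
  rw [h2, this]; rfl

lemma Smth.LopC (hU : ContDiff ℝ (⊤ : ℕ∞) U) (hf : Smth f) : Smth (LopC n U f) := by
  refine ContDiff.sub (ContDiff.sum fun j _ => (hf.pdC j).pdC j) (ContDiff.sum fun j _ => ?_)
  exact (Smth.ofReal (contDiff_pdR hU j)).mul (hf.pdC j)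

lemma LopC_sub (hf : Smth f) (hg : Smth g) (x : Eu n) :
    LopC n U (fun y => f y - g y) x = LopC n U f x - LopC n U g x := by
  unfold LopC
  simp only [pdC_sub hf hg]
  simp only [pdC_sub (hf.pdC _) (hg.pdC _), mul_sub, Finset.sum_sub_distrib]
  ring

lemma LopC_conj (f : Eu n → ℂ) (x : Eu n) :
    LopC n U (fun y => conj (f y)) x = conj (LopC n U f x) := by
  unfold LopC
  simp only [pdC_conj]
  simp [map_sub, map_sum]

lemma IsTest.smth (hf : IsTest f) : Smth f := hf.1
lemma IsTest.cont (hf : IsTest f) : Continuous f := hf.1.cont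

lemma hcs_of_zero {α β : Type*} [Zero α] [Zero β] {f : Eu n → α} {g : Eu n → β}
    (hf : HasCompactSupport f) (h : ∀ x, f x = 0 → g x = 0) : HasCompactSupport g :=
  hf.mono fun x hx hfx => hx (h x hfx)

lemma IsTest.mul_left (hf : IsTest f) (hg : Smth g) : IsTest (fun x => g x * f x) :=
  ⟨hg.mul hf.1, hcs_of_zero hf.2 fun x hx => by simp [hx]⟩

lemma IsTest.mul_right (hf : IsTest f) (hg : Smth g) : IsTest (fun x => f x * g x) :=
  ⟨hf.1.mul hg, hcs_of_zero hf.2 fun x hx => by simp [hx]⟩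

lemma IsTest.sub (hf : IsTest f) (hg : IsTest g) : IsTest (fun x => f x - g x) :=
  ⟨hf.1.sub hg.1, hf.2.sub hg.2⟩

lemma IsTest.conj (hf : IsTest f) : IsTest (fun x => conj (f x)) :=
  ⟨hf.1.conj, hcs_of_zero hf.2 fun x hx => by simp [hx]⟩

lemma IsTest.pdC (hf : IsTest f) (j : Fin n) : IsTest (pdC n f j) :=
  ⟨hf.1.pdC j, hf.2.fderiv_apply (𝕜 := ℝ) _⟩

lemma HasCompactSupport.finsum {ι : Type*} (s : Finset ι) {F : ι → Eu n → ℂ}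
    (h : ∀ i, HasCompactSupport (F i)) : HasCompactSupport (fun x => ∑ i ∈ s, F i x) := by
  classical
  induction s using Finset.induction_on with
  | empty => simp only [Finset.sum_empty]; exact HasCompactSupport.zero
  | insert a s ha ih => simp only [Finset.sum_insert ha]; exact (h a).add ih

lemma IsTest.LopC (hU : ContDiff ℝ (⊤ : ℕ∞) U) (hf : IsTest f) : IsTest (LopC n U f) := by
  refine ⟨hf.1.LopC hU, ?_⟩
  refine HasCompactSupport.sub
    (HasCompactSupport.finsum _ fun j => ((hf.pdC j).pdC j).2)
    (HasCompactSupport.finsum _ fun j => ?_)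
  exact ((hf.pdC j).mul_left (Smth.ofReal (contDiff_pdR hU j))).2

end Calculus

section Gibbs

/-- A measure with density proportional to `exp (-U)` with `U` smooth, of total mass one. -/
structure Gibbs {n : ℕ} (U : Eu n → ℝ) (μ : Measure (Eu n)) : Prop where
  smooth : ContDiff ℝ (⊤ : ℕ∞) U
  prob : IsProbabilityMeasure μ
  eq : ∃ c : ENNReal, c ≠ 0 ∧ c ≠ ⊤ ∧
    μ = c • volume.withDensity (fun x => ENNReal.ofReal (Real.exp (-U x)))

variable {n : ℕ} {U : Eu n → ℝ} {μ : Measure (Eu n)}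

lemma Gibbs.integral_eq (h : Gibbs U μ) : ∃ c : ℝ, 0 < c ∧ ∀ F : Eu n → ℂ,
    ∫ x, F x ∂μ = c * ∫ x, (Real.exp (-U x) : ℂ) * F x := by
  obtain ⟨c, hc0, hct, rfl⟩ := h.eq
  refine ⟨c.toReal, ENNReal.toReal_pos hc0 hct, fun F => ?_⟩
  rw [integral_smul_measure, integral_withDensity_eq_integral_toReal_smul]
  · simp only [Complex.real_smul]
    congr 1
    refine integral_congr_ae (Filter.Eventually.of_forall fun x => ?_)
    simp [ENNReal.toReal_ofReal (Real.exp_pos _).le]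
  · exact (h.smooth.continuous.neg.rexp).measurable.ennreal_ofReal
  · simp

lemma Gibbs.isOpenPos (h : Gibbs U μ) : μ.IsOpenPosMeasure := by
  obtain ⟨c, hc0, hct, rfl⟩ := h.eq
  refine ⟨fun V hV hne h0 => ?_⟩
  simp only [Measure.smul_apply, smul_eq_mul, mul_eq_zero, hc0, false_or] at h0
  have hm : Measurable (fun x => ENNReal.ofReal (Real.exp (-U x))) :=
    (h.smooth.continuous.neg.rexp).measurable.ennreal_ofReal
  rw [withDensity_apply_eq_zero hm] at h0
  have : {x | ENNReal.ofReal (Real.exp (-U x)) ≠ 0} ∩ V = V := by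
    ext x; simp [Real.exp_pos]
  rw [this] at h0
  exact (hV.measure_pos volume hne).ne' h0

/-- The measure dominates a multiple of Lebesgue measure on compact sets. -/
lemma Gibbs.lintegral_le (h : Gibbs U μ) {K : Set (Eu n)} (hK : IsCompact K) :
    ∃ C : ENNReal, C ≠ ⊤ ∧ ∀ F : Eu n → ENNReal, (∀ x, x ∉ K → F x = 0) → Measurable F →
      ∫⁻ x, F x ≤ C * ∫⁻ x, F x ∂μ ∧ ∫⁻ x, F x ∂μ ≤ C * ∫⁻ x, F x := by
  obtain ⟨c, hc0, hct, rfl⟩ := h.eq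
  have hm : Measurable (fun x => ENNReal.ofReal (Real.exp (-U x))) :=
    (h.smooth.continuous.neg.rexp).measurable.ennreal_ofReal
  obtain ⟨A, hA⟩ := hK.exists_bound_of_continuousOn (h.smooth.continuous.continuousOn)
  set D : ENNReal := ENNReal.ofReal (Real.exp A) with hD
  have hD0 : D ≠ 0 := by simp [hD, Real.exp_pos]
  have hDt : D ≠ ⊤ := by simp [hD]
  refine ⟨max (D * c⁻¹) (c * D), ?_, fun F hF hFm => ?_⟩
  · simp [ENNReal.mul_eq_top, hc0, hct, hD0, hDt]
  · have e1 : ∫⁻ x, F x ∂(c • volume.withDensity (fun x => ENNReal.ofReal (Real.exp (-U x))))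
        = c * ∫⁻ x, ENNReal.ofReal (Real.exp (-U x)) * F x := by
      rw [lintegral_smul_measure, lintegral_withDensity_eq_lintegral_mul _ hm hFm]; rfl
    rw [e1]
    constructor
    · have : ∫⁻ x, F x ≤ D * ∫⁻ x, ENNReal.ofReal (Real.exp (-U x)) * F x := by
        rw [← lintegral_const_mul' _ _ hDt]
        refine lintegral_mono fun x => ?_
        by_cases hx : x ∈ K
        · have h1 := (abs_le.1 (hA x hx)).2
          rw [← mul_assoc, hD, ← ENNReal.ofReal_mul (Real.exp_pos _).le, ← Real.exp_add]
          have : (1 : ENNReal) ≤ ENNReal.ofReal (Real.exp (A + -U x)) := by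
            rw [ENNReal.one_le_ofReal]; exact Real.one_le_exp (by linarith)
          calc F x = 1 * F x := (one_mul _).symm
            _ ≤ _ := by gcongr
        · simp [hF x hx]
      calc ∫⁻ x, F x ≤ D * ∫⁻ x, ENNReal.ofReal (Real.exp (-U x)) * F x := this
        _ = D * c⁻¹ * (c * ∫⁻ x, ENNReal.ofReal (Real.exp (-U x)) * F x) := by
          rw [mul_assoc, ← mul_assoc c⁻¹, ENNReal.inv_mul_cancel hc0 hct, one_mul]
        _ ≤ _ := by gcongr; exact le_max_left _ _
    · have : ∫⁻ x, ENNReal.ofReal (Real.exp (-U x)) * F x ≤ D * ∫⁻ x, F x := by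
        rw [← lintegral_const_mul' _ _ hDt]
        refine lintegral_mono fun x => ?_
        by_cases hx : x ∈ K
        · have h1 := (abs_le.1 (hA x hx)).1
          dsimp only
          gcongr
          exact ENNReal.ofReal_le_ofReal (Real.exp_le_exp.2 (by linarith))
        · simp [hF x hx]
      calc c * ∫⁻ x, ENNReal.ofReal (Real.exp (-U x)) * F x ≤ c * (D * ∫⁻ x, F x) := by gcongr
        _ = c * D * ∫⁻ x, F x := by rw [mul_assoc]
        _ ≤ _ := by gcongr; exact le_max_right _ _

lemma Gibbs.integrable_hcs (h : Gibbs U μ) {F : Eu n → ℂ} (hF : Continuous F)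
    (hc : HasCompactSupport F) : Integrable F μ :=
  have := h.prob
  hF.integrable_of_hasCompactSupport hc

lemma Gibbs.integrable_hcsR (h : Gibbs U μ) {F : Eu n → ℝ} (hF : Continuous F)
    (hc : HasCompactSupport F) : Integrable F μ :=
  have := h.prob
  hF.integrable_of_hasCompactSupport hc

lemma Gibbs.integrable_mul (h : Gibbs U μ) {u η : Eu n → ℂ} (hu : Continuous u) (hη : IsTest η) :
    Integrable (fun x => u x * η x) μ :=
  h.integrable_hcs (hu.mul hη.cont) (hcs_of_zero hη.2 fun x hx => by simp [hx])

/-- Integration by parts. -/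
lemma Gibbs.ibp (h : Gibbs U μ) {u η : Eu n → ℂ} (hu : Smth u) (hη : IsTest η) (j : Fin n) :
    ∫ x, pdC n u j x * η x ∂μ
      = - ∫ x, u x * (pdC n η j x - (pdR n U j x : ℂ) * η x) ∂μ := by
  obtain ⟨c, -, hc⟩ := h.integral_eq
  rw [hc, hc]
  have hρ : ContDiff ℝ (⊤ : ℕ∞) (fun x => Real.exp (-U x)) := h.smooth.neg.exp
  have hw : IsTest (fun x => (Real.exp (-U x) : ℂ) * η x) := hη.mul_left (Smth.ofReal hρ)
  have hpd : ∀ x, pdC n (fun x => (Real.exp (-U x) : ℂ) * η x) j x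
      = (Real.exp (-U x) : ℂ) * (pdC n η j x - (pdR n U j x : ℂ) * η x) := by
    intro x
    rw [pdC_mul (Smth.ofReal hρ) hη.1, pdC_ofReal hρ]
    have : pdR n (fun x => Real.exp (-U x)) j x = Real.exp (-U x) * (- pdR n U j x) := by
      unfold pdR
      have h1 : DifferentiableAt ℝ U x := (h.smooth.differentiable (by simp)) x
      have h2 : HasFDerivAt (fun x => Real.exp (-U x)) (Real.exp (-U x) • -fderiv ℝ U x) x :=
        h1.hasFDerivAt.neg.exp
      rw [h2.fderiv]
      simp
    rw [this]; push_cast; ring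
  have key := integral_mul_fderiv_eq_neg_fderiv_mul_of_integrable
    (μ := (volume : Measure (Eu n))) (f := u)
    (g := fun x => (Real.exp (-U x) : ℂ) * η x) (v := EuclideanSpace.single j 1) ?_ ?_ ?_
    (fun x _ => hu.differentiable x) (fun x _ => hw.1.differentiable x)
  · have e1 : ∀ x, fderiv ℝ (fun x => (Real.exp (-U x) : ℂ) * η x) x (EuclideanSpace.single j 1)
      = (Real.exp (-U x) : ℂ) * (pdC n η j x - (pdR n U j x : ℂ) * η x) := hpd
    simp only [e1] at key
    have e2 : ∫ x, (Real.exp (-U x) : ℂ) * (pdC n u j x * η x) =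
      ∫ x, fderiv ℝ u x (EuclideanSpace.single j 1) * ((Real.exp (-U x) : ℂ) * η x) :=
      integral_congr_ae (Filter.Eventually.of_forall fun x => by simp only [pdC]; ring)
    have e3 : ∫ x, (Real.exp (-U x) : ℂ) * (u x * (pdC n η j x - (pdR n U j x : ℂ) * η x)) =
      ∫ x, u x * ((Real.exp (-U x) : ℂ) * (pdC n η j x - (pdR n U j x : ℂ) * η x)) :=
      integral_congr_ae (Filter.Eventually.of_forall fun x => by ring)
    rw [e2, e3, key]; ring
  · exact ((hu.pdC j).cont.mul hw.cont).integrable_of_hasCompactSupport (hw.mul_left (hu.pdC j)).2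
  · exact (hu.cont.mul (hw.pdC j).cont).integrable_of_hasCompactSupport ((hw.pdC j).mul_left hu).2
  · exact (hu.cont.mul hw.cont).integrable_of_hasCompactSupport (hw.mul_left hu).2

/-- Green formula. -/
lemma Gibbs.green (h : Gibbs U μ) {u η : Eu n → ℂ} (hu : Smth u) (hη : IsTest η) :
    ∫ x, LopC n U u x * η x ∂μ = - ∑ j, ∫ x, pdC n u j x * pdC n η j x ∂μ := by
  have hj : ∀ j, ∫ x, (pdC n (pdC n u j) j x - (pdR n U j x : ℂ) * pdC n u j x) * η x ∂μ
      = - ∫ x, pdC n u j x * pdC n η j x ∂μ := by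
    intro j
    have h1 := h.ibp (hu.pdC j) hη j
    have i1 : Integrable (fun x => pdC n (pdC n u j) j x * η x) μ :=
      h.integrable_mul ((hu.pdC j).pdC j).cont hη
    have hUη : IsTest (fun x => (pdR n U j x : ℂ) * η x) :=
      hη.mul_left (Smth.ofReal (contDiff_pdR h.smooth j))
    have i2 : Integrable (fun x => pdC n u j x * ((pdR n U j x : ℂ) * η x)) μ :=
      h.integrable_mul (hu.pdC j).cont hUη
    have i3 : Integrable (fun x => pdC n u j x * pdC n η j x) μ :=
      h.integrable_mul (hu.pdC j).cont (hη.pdC j)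
    have e : ∫ x, (pdC n (pdC n u j) j x - (pdR n U j x : ℂ) * pdC n u j x) * η x ∂μ
        = ∫ x, pdC n (pdC n u j) j x * η x ∂μ
          - ∫ x, pdC n u j x * ((pdR n U j x : ℂ) * η x) ∂μ := by
      rw [← integral_sub i1 i2]
      exact integral_congr_ae (Filter.Eventually.of_forall fun x => by ring)
    rw [e, h1]
    simp only [mul_sub]
    rw [integral_sub i3 i2]; ring
  rw [← Finset.sum_neg_distrib, ← Finset.sum_congr rfl fun j _ => hj j, ← integral_finsetSum]
  · refine integral_congr_ae (Filter.Eventually.of_forall fun x => ?_)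
    simp only [LopC, ← Finset.sum_mul, Finset.sum_sub_distrib]
  · intro j _
    exact h.integrable_mul ((((hu.pdC j).pdC j).sub
      ((Smth.ofReal (contDiff_pdR h.smooth j)).mul (hu.pdC j))).continuous) hη

lemma Gibbs.symm (h : Gibbs U μ) {u η : Eu n → ℂ} (hu : Smth u) (hη : IsTest η) :
    ∫ x, LopC n U u x * η x ∂μ = ∫ x, u x * LopC n U η x ∂μ := by
  rw [h.green hu hη]
  have hj : ∀ j, ∫ x, u x * (pdC n (pdC n η j) j x - (pdR n U j x : ℂ) * pdC n η j x) ∂μ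
      = - ∫ x, pdC n u j x * pdC n η j x ∂μ := by
    intro j
    rw [h.ibp hu (hη.pdC j) j]; simp
  rw [← Finset.sum_neg_distrib, ← Finset.sum_congr rfl fun j _ => hj j, ← integral_finsetSum]
  · refine integral_congr_ae (Filter.Eventually.of_forall fun x => ?_)
    simp only [LopC, ← Finset.mul_sum, Finset.sum_sub_distrib]
  · intro j _
    exact h.integrable_mul hu.cont (((hη.pdC j).pdC j).sub
      ((hη.pdC j).mul_left (Smth.ofReal (contDiff_pdR h.smooth j))))

end Gibbs

open Filter Topology

section Hilbert

variable {X : Type*} [MeasurableSpace X] {μ : Measure X}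

/-- Cauchy-Schwarz for nonnegative real functions. -/
lemma integral_mul_le_sqrt {f g : X → ℝ} (hf0 : ∀ x, 0 ≤ f x) (hg0 : ∀ x, 0 ≤ g x)
    (hfm : AEStronglyMeasurable f μ) (hgm : AEStronglyMeasurable g μ)
    (hf : Integrable (fun x => f x ^ 2) μ) (hg : Integrable (fun x => g x ^ 2) μ) :
    ∫ x, f x * g x ∂μ ≤ √(∫ x, f x ^ 2 ∂μ) * √(∫ x, g x ^ 2 ∂μ) := by
  have h2 : ENNReal.ofReal 2 = 2 := by norm_num
  have := integral_mul_le_Lp_mul_Lq_of_nonneg (μ := μ) (p := 2) (q := 2) (f := f) (g := g)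
    (by rw [Real.holderConjugate_iff]; norm_num) (Eventually.of_forall hf0)
    (Eventually.of_forall hg0)
    (by rw [h2]; exact (memLp_two_iff_integrable_sq hfm).2 hf)
    (by rw [h2]; exact (memLp_two_iff_integrable_sq hgm).2 hg)
  simpa [Real.sqrt_eq_rpow] using this

/-- Cauchy-Schwarz for complex functions. -/
lemma norm_integral_mul_le_sqrt {f g : X → ℂ}
    (hfm : AEStronglyMeasurable f μ) (hgm : AEStronglyMeasurable g μ)
    (hf : Integrable (fun x => ‖f x‖ ^ 2) μ) (hg : Integrable (fun x => ‖g x‖ ^ 2) μ) :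
    ‖∫ x, f x * g x ∂μ‖ ≤ √(∫ x, ‖f x‖ ^ 2 ∂μ) * √(∫ x, ‖g x‖ ^ 2 ∂μ) := by
  refine (norm_integral_le_integral_norm _).trans ?_
  simp only [norm_mul]
  exact integral_mul_le_sqrt (fun x => norm_nonneg _) (fun x => norm_nonneg _) hfm.norm hgm.norm
    hf hg

lemma integrable_mul_of_sq {f g : X → ℂ}
    (hfm : AEStronglyMeasurable f μ) (hgm : AEStronglyMeasurable g μ)
    (hf : Integrable (fun x => ‖f x‖ ^ 2) μ) (hg : Integrable (fun x => ‖g x‖ ^ 2) μ) :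
    Integrable (fun x => f x * g x) μ := by
  refine Integrable.mono' (hf.add hg) (hfm.mul hgm) (Eventually.of_forall fun x => ?_)
  simp only [norm_mul, Pi.add_apply]
  nlinarith [sq_nonneg (‖f x‖ - ‖g x‖), norm_nonneg (f x), norm_nonneg (g x)]

lemma norm_sub_sq_le (a b : ℂ) : ‖a - b‖ ^ 2 ≤ 2 * ‖a‖ ^ 2 + 2 * ‖b‖ ^ 2 := by
  have := norm_sub_le a b
  nlinarith [sq_nonneg (‖a‖ - ‖b‖), norm_nonneg (a - b), norm_nonneg a, norm_nonneg b]

lemma norm_add_sq_le (a b : ℂ) : ‖a + b‖ ^ 2 ≤ 2 * ‖a‖ ^ 2 + 2 * ‖b‖ ^ 2 := by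
  have := norm_add_le a b
  nlinarith [sq_nonneg (‖a‖ - ‖b‖), norm_nonneg (a + b), norm_nonneg a, norm_nonneg b]

lemma integrable_sub_sq {f g : X → ℂ}
    (hfm : AEStronglyMeasurable f μ) (hgm : AEStronglyMeasurable g μ)
    (hf : Integrable (fun x => ‖f x‖ ^ 2) μ) (hg : Integrable (fun x => ‖g x‖ ^ 2) μ) :
    Integrable (fun x => ‖f x - g x‖ ^ 2) μ := by
  refine Integrable.mono' ((hf.const_mul 2).add (hg.const_mul 2))
    ((hfm.sub hgm).norm.pow 2) (Eventually.of_forall fun x => ?_)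
  rw [Real.norm_of_nonneg (by positivity)]
  exact norm_sub_sq_le _ _

lemma integral_sub_sq_le {f g : X → ℂ}
    (hfm : AEStronglyMeasurable f μ) (hgm : AEStronglyMeasurable g μ)
    (hf : Integrable (fun x => ‖f x‖ ^ 2) μ) (hg : Integrable (fun x => ‖g x‖ ^ 2) μ) :
    ∫ x, ‖f x - g x‖ ^ 2 ∂μ ≤ 2 * ∫ x, ‖f x‖ ^ 2 ∂μ + 2 * ∫ x, ‖g x‖ ^ 2 ∂μ := by
  rw [← integral_const_mul, ← integral_const_mul, ← integral_add (hf.const_mul 2) (hg.const_mul 2)]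
  exact integral_mono (integrable_sub_sq hfm hgm hf hg) ((hf.const_mul 2).add (hg.const_mul 2))
    fun x => norm_sub_sq_le _ _

lemma integrable_norm_of_sq [IsFiniteMeasure μ] {f : X → ℂ}
    (hfm : AEStronglyMeasurable f μ) (hf : Integrable (fun x => ‖f x‖ ^ 2) μ) :
    Integrable f μ := by
  refine Integrable.mono' (hf.add (integrable_const 1)) hfm (Eventually.of_forall fun x => ?_)
  simp only [Pi.add_apply]
  nlinarith [sq_nonneg (‖f x‖ - 1)]

/-- Pointwise convergence with an `L²` bound implies `L¹` convergence. -/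
lemma tendsto_integral_norm_sub [IsFiniteMeasure μ] {ι : Type*} {l : Filter ι}
    [l.IsCountablyGenerated] {F : ι → X → ℂ} {f : X → ℂ} {C : ℝ}
    (hFm : ∀ i, AEStronglyMeasurable (F i) μ) (hfm : AEStronglyMeasurable f μ)
    (hF : ∀ i, Integrable (fun x => ‖F i x‖ ^ 2) μ) (hf : Integrable (fun x => ‖f x‖ ^ 2) μ)
    (hC : ∀ᶠ i in l, ∫ x, ‖F i x‖ ^ 2 ∂μ ≤ C)
    (hlim : ∀ x, Tendsto (fun i => F i x) l (𝓝 (f x))) :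
    Tendsto (fun i => ∫ x, ‖F i x - f x‖ ∂μ) l (𝓝 0) := by
  rw [Metric.tendsto_nhds]
  intro ε hε
  set A : ℝ := 2 * |C| + 2 * ∫ x, ‖f x‖ ^ 2 ∂μ + 1 with hA
  have hf0 : 0 ≤ ∫ x, ‖f x‖ ^ 2 ∂μ := integral_nonneg fun x => by positivity
  have hA0 : 0 < A := by have := abs_nonneg C; linarith
  set Λ : ℝ := 2 * A / ε with hΛ
  have hΛ0 : 0 < Λ := by positivity
  have hmin : Tendsto (fun i => ∫ x, min ‖F i x - f x‖ Λ ∂μ) l (𝓝 (∫ _, (0 : ℝ) ∂μ)) := by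
    refine tendsto_integral_filter_of_dominated_convergence (fun _ => Λ) ?_ ?_ ?_ ?_
    · exact Eventually.of_forall fun i =>
        ((hFm i).sub hfm).norm.inf aestronglyMeasurable_const
    · refine Eventually.of_forall fun i => Eventually.of_forall fun x => ?_
      rw [Real.norm_of_nonneg (le_min (norm_nonneg _) hΛ0.le)]
      exact min_le_right _ _
    · exact integrable_const _
    · refine Eventually.of_forall fun x => ?_
      have h1 : Tendsto (fun i => ‖F i x - f x‖) l (𝓝 0) := by
        simpa using ((hlim x).sub_const (f x)).norm
      have := h1.min (tendsto_const_nhds (x := Λ))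
      rwa [min_eq_left hΛ0.le] at this
  simp only [integral_zero] at hmin
  filter_upwards [hC, (Metric.tendsto_nhds.1 hmin) (ε / 2) (by positivity)] with i hi hi2
  rw [Real.dist_eq, sub_zero] at hi2 ⊢
  rw [abs_of_nonneg (integral_nonneg fun x => norm_nonneg _)]
  have hi3 : ∫ x, min ‖F i x - f x‖ Λ ∂μ < ε / 2 := lt_of_abs_lt hi2
  have i1 : Integrable (fun x => ‖F i x - f x‖ ^ 2) μ := integrable_sub_sq (hFm i) hfm (hF i) hf
  have i0 : Integrable (fun x => ‖F i x - f x‖) μ :=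
    (integrable_norm_of_sq ((hFm i).sub hfm) i1).norm
  have i2 : Integrable (fun x => min ‖F i x - f x‖ Λ) μ := i0.inf (integrable_const Λ)
  have h4 := integral_sub_sq_le (hFm i) hfm (hF i) hf
  have h5 : ∫ x, ‖F i x - f x‖ ^ 2 ∂μ < A := by
    have := le_abs_self C; linarith
  calc ∫ x, ‖F i x - f x‖ ∂μ
      ≤ ∫ x, (min ‖F i x - f x‖ Λ + ‖F i x - f x‖ ^ 2 / Λ) ∂μ := by
        refine integral_mono i0 (i2.add (i1.div_const _)) fun x => ?_
        rcases le_total ‖F i x - f x‖ Λ with h | h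
        · simp only [min_eq_left h]
          have : 0 ≤ ‖F i x - f x‖ ^ 2 / Λ := by positivity
          linarith
        · simp only [min_eq_right h]
          have : ‖F i x - f x‖ ≤ ‖F i x - f x‖ ^ 2 / Λ := by
            rw [le_div_iff₀ hΛ0]; nlinarith [norm_nonneg (F i x - f x)]
          linarith
    _ = ∫ x, min ‖F i x - f x‖ Λ ∂μ + (∫ x, ‖F i x - f x‖ ^ 2 ∂μ) / Λ := by
        rw [integral_add i2 (i1.div_const _), integral_div]
    _ < ε / 2 + A / Λ := by
        gcongr
    _ = ε := by rw [hΛ]; field_simp; norm_num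

lemma tendsto_integral_mul [IsFiniteMeasure μ] {ι : Type*} {l : Filter ι}
    [l.IsCountablyGenerated] {F : ι → X → ℂ} {f η : X → ℂ} {C B : ℝ}
    (hFm : ∀ i, AEStronglyMeasurable (F i) μ) (hfm : AEStronglyMeasurable f μ)
    (hF : ∀ i, Integrable (fun x => ‖F i x‖ ^ 2) μ) (hf : Integrable (fun x => ‖f x‖ ^ 2) μ)
    (hC : ∀ᶠ i in l, ∫ x, ‖F i x‖ ^ 2 ∂μ ≤ C)
    (hlim : ∀ x, Tendsto (fun i => F i x) l (𝓝 (f x)))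
    (hη : AEStronglyMeasurable η μ) (hB : ∀ x, ‖η x‖ ≤ B) :
    Tendsto (fun i => ∫ x, F i x * η x ∂μ) l (𝓝 (∫ x, f x * η x ∂μ)) := by
  have h0 := tendsto_integral_norm_sub hFm hfm hF hf hC hlim
  rw [tendsto_iff_norm_sub_tendsto_zero]
  have h1 : Tendsto (fun i => (∫ x, ‖F i x - f x‖ ∂μ) * B) l (𝓝 0) := by
    simpa using h0.mul_const B
  refine squeeze_zero (fun i => norm_nonneg _) (fun i => ?_) h1
  have iF : Integrable (fun x => F i x * η x) μ :=
    (integrable_norm_of_sq (hFm i) (hF i)).mul_bdd hη (Eventually.of_forall hB)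
  have jf : Integrable (fun x => f x * η x) μ :=
    (integrable_norm_of_sq hfm hf).mul_bdd hη (Eventually.of_forall hB)
  rw [← integral_sub iF jf, ← integral_mul_const]
  refine norm_integral_le_of_norm_le ?_ (Eventually.of_forall fun x => ?_)
  · exact ((integrable_norm_of_sq ((hFm i).sub hfm)
      (integrable_sub_sq (hFm i) hfm (hF i) hf)).norm).mul_const _
  · rw [← sub_mul, norm_mul]
    exact mul_le_mul_of_nonneg_left (hB x) (norm_nonneg _)

end Hilbert

/-- Smooth compactly supported functions with values in `[0, 1]`. -/
structure IsCut {n : ℕ} (χ : Eu n → ℝ) : Prop where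
  smooth : ContDiff ℝ (⊤ : ℕ∞) χ
  hcs : HasCompactSupport χ
  nonneg : ∀ x, 0 ≤ χ x
  le_one : ∀ x, χ x ≤ 1

section Cut
variable {n : ℕ}

lemma IsCut.smth {χ : Eu n → ℝ} (h : IsCut χ) : Smth (fun x => (χ x : ℂ)) := Smth.ofReal h.smooth

lemma IsCut.test {χ : Eu n → ℝ} (h : IsCut χ) : IsTest (fun x => (χ x : ℂ)) :=
  ⟨h.smth, hcs_of_zero h.hcs fun x hx => by simp [hx]⟩

lemma IsCut.sq_le_one {χ : Eu n → ℝ} (h : IsCut χ) (x : Eu n) : χ x ^ 2 ≤ 1 :=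
  pow_le_one₀ (h.nonneg x) (h.le_one x)

lemma exists_cut_ball (n : ℕ) : ∃ C0 : ℝ, 0 < C0 ∧ ∀ R : ℝ, 1 ≤ R → ∃ χ : Eu n → ℝ, IsCut χ ∧
    (∀ x, ‖x‖ ≤ R → χ x = 1) ∧ ∀ x, ∑ j, pdR n χ j x ^ 2 ≤ (C0 / R) ^ 2 := by
  let b : ContDiffBump (0 : Eu n) := ⟨1, 2, by norm_num, by norm_num⟩
  have hbs : ContDiff ℝ (⊤ : ℕ∞) b := b.contDiff
  have hbc : HasCompactSupport b := b.hasCompactSupport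
  have hfc : Continuous (fderiv ℝ b) := hbs.continuous_fderiv (by simp)
  obtain ⟨A, hA⟩ := hfc.bounded_above_of_compact_support (hbc.fderiv (𝕜 := ℝ))
  refine ⟨(√n + 1) * (|A| + 1), by positivity, fun R hR => ?_⟩
  have hR0 : 0 < R := by linarith
  have hsm : ContDiff ℝ (⊤ : ℕ∞) (fun x : Eu n => b (R⁻¹ • x)) :=
    hbs.comp (contDiff_id.const_smul R⁻¹)
  refine ⟨fun x => b (R⁻¹ • x), ⟨hsm, ?_, fun x => b.nonneg, fun x => b.le_one⟩, ?_, ?_⟩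
  · exact hbc.comp_smul (by positivity)
  · intro x hx
    apply b.one_of_mem_closedBall
    rw [mem_closedBall_zero_iff, norm_smul, norm_inv, Real.norm_of_nonneg hR0.le]
    show R⁻¹ * ‖x‖ ≤ 1
    rw [inv_mul_le_iff₀ hR0]; linarith
  · intro x
    have h1 : ∀ j, pdR n (fun x : Eu n => b (R⁻¹ • x)) j x ^ 2 ≤ ((|A| + 1) / R) ^ 2 := by
      intro j
      unfold pdR
      have hd : HasFDerivAt (fun x : Eu n => b (R⁻¹ • x))
          ((fderiv ℝ b (R⁻¹ • x)).comp (R⁻¹ • ContinuousLinearMap.id ℝ (Eu n))) x := by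
        have h2 : HasFDerivAt (fun x : Eu n => R⁻¹ • x) (R⁻¹ • ContinuousLinearMap.id ℝ (Eu n)) x :=
          (hasFDerivAt_id x).const_smul R⁻¹
        have h3 : HasFDerivAt b (fderiv ℝ b (R⁻¹ • x)) (R⁻¹ • x) :=
          ((hbs.differentiable (by simp)) _).hasFDerivAt
        exact h3.comp x h2
      rw [hd.fderiv]
      refine sq_le_sq' ?_ ?_ <;>
      · have h4 : ‖fderiv ℝ b (R⁻¹ • x) (EuclideanSpace.single j 1)‖ ≤ |A| + 1 := by
          refine (ContinuousLinearMap.le_opNorm _ _).trans ?_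
          have := hA (R⁻¹ • x)
          have h5 := le_abs_self A
          simp only [PiLp.norm_single, norm_one, mul_one]
          linarith
        have h6 := abs_le.1 h4
        simp only [ContinuousLinearMap.comp_apply, _root_.smul_apply,
          ContinuousLinearMap.id_apply, map_smul, smul_eq_mul]
        rw [inv_mul_eq_div]
        first
          | (rw [← neg_div]; gcongr; exact h6.1)
          | (gcongr; exact h6.2)
    calc ∑ j, pdR n (fun x : Eu n => b (R⁻¹ • x)) j x ^ 2
        ≤ ∑ _j : Fin n, ((|A| + 1) / R) ^ 2 := Finset.sum_le_sum fun j _ => h1 j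
      _ = n * ((|A| + 1) / R) ^ 2 := by simp
      _ = (√n * (|A| + 1) / R) ^ 2 := by
        rw [div_pow, div_pow, mul_pow, Real.sq_sqrt (by positivity)]; ring
      _ ≤ _ := by gcongr; linarith

lemma exists_cut_compact {K : Set (Eu n)} (hK : IsCompact K) :
    ∃ χ : Eu n → ℝ, IsCut χ ∧ ∀ x ∈ K, χ x = 1 := by
  obtain ⟨C0, _, h⟩ := exists_cut_ball n
  obtain ⟨R, hR⟩ := hK.isBounded.exists_norm_le
  obtain ⟨χ, h1, h2, _⟩ := h (max R 1) (le_max_right _ _)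
  exact ⟨χ, h1, fun x hx => h2 x ((hR x hx).trans (le_max_left _ _))⟩

end Cut

section Sobolev

/-- A Sobolev inequality with the full `W^{1,1}` norm, valid in every dimension. -/
lemma exists_sobolev (n : ℕ) : ∃ (p : ℝ) (C : ENNReal), 1 < p ∧ C ≠ ⊤ ∧ ∀ v : Eu n → ℂ, Smth v →
    HasCompactSupport v →
    ∫⁻ x, ‖v x‖ₑ ^ p ≤ C * (∫⁻ x, (‖v x‖ₑ + ‖fderiv ℝ v x‖ₑ)) ^ p := by
  have hH : (volume : Measure (ℝ × ℝ)).IsAddHaarMeasure :=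
    Measure.prod.instIsAddHaarMeasure (volume : Measure ℝ) (volume : Measure ℝ)
  let ν : Measure (Eu n × (ℝ × ℝ)) := (volume : Measure (Eu n)).prod (volume : Measure (ℝ × ℝ))
  have hν : ν.IsAddHaarMeasure := Measure.prod.instIsAddHaarMeasure _ _
  have hfr : Module.finrank ℝ (Eu n × (ℝ × ℝ)) = n + 2 := by simp
  set p : NNReal := (n + 2) / (n + 1) with hp
  have hpR : (p : ℝ) = (n + 2) / (n + 1) := by simp [hp]
  have hconj : ((Module.finrank ℝ (Eu n × (ℝ × ℝ)) : NNReal)).HolderConjugate p := by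
    rw [hfr, NNReal.holderConjugate_iff]
    refine ⟨by push_cast; exact lt_of_lt_of_le (by norm_num : (1 : NNReal) < 2) (by simp), ?_⟩
    rw [hp]; push_cast
    rw [inv_div]
    field_simp
    ring
  have hp1 : 1 < (p : ℝ) := by
    rw [hpR, one_lt_div (by positivity)]; linarith
  let b : ContDiffBump (0 : ℝ × ℝ) := ⟨1, 2, by norm_num, by norm_num⟩
  have hbs : ContDiff ℝ (⊤ : ℕ∞) b := b.contDiff
  let β : ℝ × ℝ → ℂ := fun y => (b y : ℂ)
  have hβs : ContDiff ℝ (⊤ : ℕ∞) β := Complex.ofRealCLM.contDiff.comp hbs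
  have hβc : HasCompactSupport β := b.hasCompactSupport.mono fun y hy hb => hy (by simp [β, hb])
  have hβd : Continuous (fderiv ℝ β) := hβs.continuous_fderiv (by simp)
  set I0 := ∫⁻ y, ‖β y‖ₑ ^ (p : ℝ) with hI0
  set I1 := ∫⁻ y, ‖β y‖ₑ with hI1
  set I2 := ∫⁻ y, ‖fderiv ℝ β y‖ₑ with hI2
  have hI0' : I0 ≠ 0 := by
    intro h
    have hm : Measurable (fun y => ‖β y‖ₑ ^ (p : ℝ)) :=
      ((ENNReal.continuous_rpow_const).comp hβs.continuous.enorm).measurable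
    rw [hI0, lintegral_eq_zero_iff hm] at h
    have h2 : (fun y => ‖β y‖ₑ ^ (p : ℝ)) = 0 := by
      refine Continuous.ae_eq_iff_eq volume ?_ continuous_const |>.1 h
      exact (ENNReal.continuous_rpow_const).comp hβs.continuous.enorm
    have h3 := congrFun h2 0
    have h4 : b 0 = 1 := b.one_of_mem_closedBall (by simp [b])
    simp [β, h4] at h3
  have hI1t : I1 ≠ ⊤ :=
    ((hβs.continuous.integrable_of_hasCompactSupport hβc).2).ne
  have hI2t : I2 ≠ ⊤ :=
    ((hβd.integrable_of_hasCompactSupport (hβc.fderiv (𝕜 := ℝ))).2).ne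
  set c := (eLpNormLESNormFDerivOneConst ν p : ENNReal) with hc
  have hct : c ≠ ⊤ := ENNReal.coe_ne_top
  have hp0 : 0 < (p : ℝ) := by linarith
  refine ⟨p, I0⁻¹ * (c * (I1 + I2)) ^ (p : ℝ), hp1, ?_, fun v hv hvc => ?_⟩
  · refine ENNReal.mul_ne_top (ENNReal.inv_ne_top.2 hI0') ?_
    exact ENNReal.rpow_ne_top_of_nonneg hp0.le
      (ENNReal.mul_ne_top hct (ENNReal.add_ne_top.2 ⟨hI1t, hI2t⟩))
  · let W : (Eu n × (ℝ × ℝ)) → ℂ := fun z => v z.1 * β z.2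
    have hWs : ContDiff ℝ (⊤ : ℕ∞) W := (hv.comp contDiff_fst).mul (hβs.comp contDiff_snd)
    have hWc : HasCompactSupport W := by
      refine HasCompactSupport.intro (hvc.isCompact.prod hβc.isCompact) fun z hz => ?_
      by_cases h1 : z.1 ∈ tsupport v
      · have : z.2 ∉ tsupport β := fun h2 => hz ⟨h1, h2⟩
        simp [W, image_eq_zero_of_notMem_tsupport this]
      · simp [W, image_eq_zero_of_notMem_tsupport h1]
    have key := eLpNorm_le_eLpNorm_fderiv_one ν (hWs.of_le (by simp)) hWc hconj
    have hvd : Continuous (fderiv ℝ v) := hv.continuous_fderiv (by simp)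
    have e1 : eLpNorm W p ν ^ (p : ℝ) = (∫⁻ x, ‖v x‖ₑ ^ (p : ℝ)) * I0 := by
      rw [eLpNorm_eq_lintegral_rpow_enorm_toReal (by simpa using fun h => by simp [h] at hp0)
        (by simp)]
      simp only [ENNReal.coe_toReal]
      rw [← ENNReal.rpow_mul, one_div, inv_mul_cancel₀ hp0.ne', ENNReal.rpow_one]
      have : ∀ z : (Eu n × (ℝ × ℝ)), ‖W z‖ₑ ^ (p : ℝ) = ‖v z.1‖ₑ ^ (p : ℝ) * ‖β z.2‖ₑ ^ (p : ℝ) := by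
        intro z
        rw [← ENNReal.mul_rpow_of_nonneg _ _ hp0.le, ← enorm_mul]
      simp only [this]
      refine lintegral_prod_mul (μ := (volume : Measure (Eu n)))
        (ν := (volume : Measure (ℝ × ℝ))) (f := fun x => ‖v x‖ₑ ^ (p : ℝ))
        (g := fun y => ‖β y‖ₑ ^ (p : ℝ)) ?_ ?_
      · exact ((ENNReal.continuous_rpow_const).comp hv.continuous.enorm).aemeasurable
      · exact ((ENNReal.continuous_rpow_const).comp hβs.continuous.enorm).aemeasurable
    have e2 : eLpNorm (fderiv ℝ W) 1 ν
        ≤ (I1 + I2) * ∫⁻ x, (‖v x‖ₑ + ‖fderiv ℝ v x‖ₑ) := by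
      rw [eLpNorm_one_eq_lintegral_enorm]
      have hb : ∀ z : (Eu n × (ℝ × ℝ)), ‖fderiv ℝ W z‖ₑ ≤ ‖fderiv ℝ v z.1‖ₑ * ‖β z.2‖ₑ
          + ‖v z.1‖ₑ * ‖fderiv ℝ β z.2‖ₑ := by
        intro z
        have d1 : HasFDerivAt (fun z : (Eu n × (ℝ × ℝ)) => v z.1)
            ((fderiv ℝ v z.1).comp (ContinuousLinearMap.fst ℝ _ _)) z :=
          (hv.differentiable z.1).hasFDerivAt.comp z hasFDerivAt_fst
        have d2 : HasFDerivAt (fun z : (Eu n × (ℝ × ℝ)) => β z.2)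
            ((fderiv ℝ β z.2).comp (ContinuousLinearMap.snd ℝ _ _)) z :=
          ((hβs.differentiable (by simp)) z.2).hasFDerivAt.comp z hasFDerivAt_snd
        have d3 := d1.mul d2
        have d4 : fderiv ℝ W z = _ := d3.fderiv
        rw [d4, ← enorm_norm (fderiv ℝ v z.1), ← enorm_norm (β z.2), ← enorm_norm (v z.1),
          ← enorm_norm (fderiv ℝ β z.2), ← enorm_mul, ← enorm_mul,
          ← enorm_norm (_ + _ : (Eu n × (ℝ × ℝ)) →L[ℝ] ℂ)]
        rw [← ofReal_norm, ← ofReal_norm, ← ofReal_norm,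
          ← ENNReal.ofReal_add (norm_nonneg _) (norm_nonneg _)]
        apply ENNReal.ofReal_le_ofReal
        simp only [norm_mul, norm_norm]
        refine (norm_add_le _ _).trans ?_
        rw [add_comm]
        gcongr
        · rw [norm_smul, mul_comm]
          gcongr
          exact (ContinuousLinearMap.opNorm_comp_le _ _).trans
            (mul_le_of_le_one_right (norm_nonneg _) (ContinuousLinearMap.norm_fst_le ..))
        · rw [norm_smul]
          gcongr
          exact (ContinuousLinearMap.opNorm_comp_le _ _).trans
            (mul_le_of_le_one_right (norm_nonneg _) (ContinuousLinearMap.norm_snd_le ..))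
      refine (lintegral_mono hb).trans ?_
      have hm1 : Measurable (fun z : Eu n × (ℝ × ℝ) => ‖fderiv ℝ v z.1‖ₑ * ‖β z.2‖ₑ) :=
        (hvd.comp continuous_fst).enorm.measurable.mul
          (hβs.continuous.comp continuous_snd).enorm.measurable
      simp only [ν]
      rw [lintegral_add_left hm1, lintegral_prod_mul
        (hvd.enorm.aemeasurable) (hβs.continuous.enorm.aemeasurable), lintegral_prod_mul
        (hv.continuous.enorm.aemeasurable) (hβd.enorm.aemeasurable),
        lintegral_add_left (by have := hv.continuous; fun_prop), ← hI1, ← hI2]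
      ring_nf
      gcongr ?_ + ?_
      · exact le_add_of_le_of_nonneg le_self_add (by simp)
      · simp
    have h3 : (∫⁻ x, ‖v x‖ₑ ^ (p : ℝ)) * I0
        ≤ (c * (I1 + I2)) ^ (p : ℝ) * (∫⁻ x, (‖v x‖ₑ + ‖fderiv ℝ v x‖ₑ)) ^ (p : ℝ) := by
      rw [← e1, ← ENNReal.mul_rpow_of_nonneg _ _ hp0.le]
      gcongr
      refine key.trans ?_
      rw [mul_assoc]
      gcongr
    have hI0t : I0 ≠ ⊤ := by
      have hcont : Continuous (fun y => ‖β y‖ ^ (p : ℝ)) :=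
        hβs.continuous.norm.rpow_const fun _ => Or.inr hp0.le
      have := (hcont.integrable_of_hasCompactSupport (μ := volume) (hβc.mono fun y hy hb =>
        hy (by simp [hb, hp0.ne']))).2.ne
      convert this using 2
      ext y
      rw [← ofReal_norm, ENNReal.ofReal_rpow_of_nonneg (norm_nonneg _) hp0.le,
        ← ofReal_norm, Real.norm_of_nonneg (by positivity)]
    calc ∫⁻ x, ‖v x‖ₑ ^ (p : ℝ) = I0⁻¹ * ((∫⁻ x, ‖v x‖ₑ ^ (p : ℝ)) * I0) := by
          rw [mul_comm _ I0, ← mul_assoc, ENNReal.inv_mul_cancel hI0' hI0t, one_mul]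
      _ ≤ _ := by rw [mul_assoc]; gcongr

end Sobolev

/-- The logarithmic nonlinearity. -/
def nl (z : ℂ) : ℂ := z * (Real.log (‖z‖ ^ 2) : ℂ)

lemma norm_nl (z : ℂ) : ‖nl z‖ = 2 * |‖z‖ * Real.log ‖z‖| := by
  unfold nl
  rw [norm_mul, Complex.norm_real, Real.log_pow, Real.norm_eq_abs, abs_mul, abs_mul,
    abs_of_nonneg (norm_nonneg z)]
  simp; ring

lemma continuous_nl : Continuous nl := by
  rw [continuous_iff_continuousAt]
  intro z
  by_cases hz : z = 0
  · subst hz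
    have h0 : nl 0 = 0 := by simp [nl]
    unfold ContinuousAt
    rw [h0, tendsto_zero_iff_norm_tendsto_zero]
    simp only [norm_nl]
    have h1 : Continuous (fun z : ℂ => 2 * |‖z‖ * Real.log ‖z‖|) :=
      continuous_const.mul (Real.continuous_mul_log.comp continuous_norm).abs
    have := h1.tendsto 0
    simpa using this
  · unfold nl
    refine continuousAt_id.mul ?_
    refine Complex.continuous_ofReal.continuousAt.comp ?_
    exact (continuous_norm.pow 2).continuousAt.log (by simpa using hz)

lemma mul_log_sq_le {p : ℝ} (hp : 1 < p) {r : ℝ} (hr : 0 ≤ r) :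
    r * Real.log r ^ 2 ≤ 4 + ((p - 1) / 2)⁻¹ ^ 2 * r ^ p := by
  set s := (p - 1) / 2 with hs
  have hs0 : 0 < s := by linarith
  rcases le_total r 1 with h | h
  · have h1 : r * Real.log r ^ 2 ≤ 4 := by
      rcases hr.eq_or_lt with h0 | h0
      · rw [← h0]; simp
      · have h2 : |Real.log √r * √r| < 1 :=
          Real.abs_log_mul_self_lt _ (Real.sqrt_pos.2 h0) (Real.sqrt_le_one.2 h)
        rw [Real.log_sqrt hr] at h2
        have h3 : (Real.log r / 2 * √r) ^ 2 ≤ 1 := by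
          rw [← sq_abs]; exact pow_le_one₀ (abs_nonneg _) h2.le
        rw [mul_pow, Real.sq_sqrt hr] at h3
        nlinarith
    have : 0 ≤ s⁻¹ ^ 2 * r ^ p := by positivity
    linarith
  · have h0 : 0 < r := by linarith
    have h1 : Real.log r ≤ r ^ s / s := Real.log_le_rpow_div hr hs0
    have h2 : 0 ≤ Real.log r := Real.log_nonneg h
    have h3 : Real.log r ^ 2 ≤ (r ^ s / s) ^ 2 := by gcongr
    have h4 : r * (r ^ s / s) ^ 2 = s⁻¹ ^ 2 * r ^ p := by
      have : r ^ p = r * (r ^ s) ^ 2 := by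
        rw [← Real.rpow_natCast, ← Real.rpow_mul hr, ← Real.rpow_one_add' hr]
        · congr 1; rw [hs]; push_cast; ring
        · rw [hs]; push_cast; intro h; linarith
      rw [this]; field_simp
    nlinarith

section
variable {n : ℕ} {U : Eu n → ℝ} {μ : Measure (Eu n)}

lemma enorm_fderiv_le (v : Eu n → ℂ) (x : Eu n) : ‖fderiv ℝ v x‖ ≤ ∑ j, ‖pdC n v j x‖ := by
  refine ContinuousLinearMap.opNorm_le_bound _ (by positivity) fun y => ?_
  have hy : y = ∑ j, y j • EuclideanSpace.single j (1 : ℝ) := by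
    have := (EuclideanSpace.basisFun (Fin n) ℝ).sum_repr y
    simpa using this.symm
  calc ‖fderiv ℝ v x y‖ = ‖∑ j, y j • pdC n v j x‖ := by
        conv_lhs => rw [hy]
        simp [map_sum, pdC]
    _ ≤ ∑ j, ‖y j • pdC n v j x‖ := norm_sum_le _ _
    _ ≤ ∑ j, ‖pdC n v j x‖ * ‖y‖ := by
        refine Finset.sum_le_sum fun j _ => ?_
        rw [norm_smul, mul_comm]
        gcongr
        exact PiLp.norm_apply_le y j
    _ = _ := by rw [Finset.sum_mul]

lemma gradSqC_nonneg (f : Eu n → ℂ) (x : Eu n) : 0 ≤ gradSqC n f x :=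
  Finset.sum_nonneg fun _ _ => by positivity

lemma Smth.continuous_gradSq {f : Eu n → ℂ} (hf : Smth f) : Continuous (gradSqC n f) :=
  continuous_finsetSum _ fun j _ => ((hf.pdC j).cont.norm.pow 2)

lemma norm_pdC_sq_le (f : Eu n → ℂ) (j : Fin n) (x : Eu n) : ‖pdC n f j x‖ ^ 2 ≤ gradSqC n f x :=
  Finset.single_le_sum (f := fun j => ‖pdC n f j x‖ ^ 2) (fun _ _ => by positivity)
    (Finset.mem_univ j)

/-- Local higher integrability of functions in the energy space. -/
lemma Gibbs.exists_local_log (h : Gibbs U μ) {K : Set (Eu n)} (hK : IsCompact K) (C : ℝ) :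
    ∃ C' : ℝ, 0 ≤ C' ∧ ∀ u : Eu n → ℂ, Smth u → Integrable (fun x => ‖u x‖ ^ 2) μ →
      Integrable (gradSqC n u) μ → ∫ x, ‖u x‖ ^ 2 ∂μ ≤ C → ∫ x, gradSqC n u x ∂μ ≤ C →
      ∫ x in K, ‖nl (u x)‖ ^ 2 ∂μ ≤ C' := by
  have := h.prob
  obtain ⟨p, S, hp, hS, hsob⟩ := exists_sobolev n
  obtain ⟨χ, hχ, hχK⟩ := exists_cut_compact hK
  obtain ⟨D, hD, hcomp⟩ := h.lintegral_le hχ.hcs.isCompact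
  have hdc : Continuous (fderiv ℝ (fun x => (χ x : ℂ))) := hχ.smth.continuous_fderiv (by simp)
  obtain ⟨A, hA⟩ := hdc.bounded_above_of_compact_support (hχ.test.2.fderiv (𝕜 := ℝ))
  have hA' : ∀ j x, ‖pdC n (fun x => (χ x : ℂ)) j x‖ ≤ |A| := by
    intro j x
    refine (ContinuousLinearMap.le_opNorm _ _).trans ?_
    simp only [PiLp.norm_single, norm_one, mul_one]
    exact (hA x).trans (le_abs_self A)
  have hp0 : 0 < p := by linarith
  set B : ℝ := 1 + n * (2 * |A| + 1) with hB
  have hB0 : 0 ≤ B := by positivity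
  set s := ((p - 1) / 2)⁻¹ ^ 2 with hs
  have hs0 : 0 ≤ s := by positivity
  set T : ENNReal := 4 + ENNReal.ofReal s *
    (D * (S * (D * ENNReal.ofReal (B * (|C| + |C|))) ^ p)) with hT
  have hTt : T ≠ ⊤ := by
    rw [hT]
    refine ENNReal.add_ne_top.2 ⟨by simp, ENNReal.mul_ne_top (by simp) (ENNReal.mul_ne_top hD
      (ENNReal.mul_ne_top hS (ENNReal.rpow_ne_top_of_nonneg hp0.le
        (ENNReal.mul_ne_top hD (by simp)))))⟩
  refine ⟨T.toReal, ENNReal.toReal_nonneg, fun u hu hm hg hmC hgC => ?_⟩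
  have hnlc : Continuous (fun x => ‖nl (u x)‖ ^ 2) := (continuous_nl.comp hu.cont).norm.pow 2
  rw [integral_eq_lintegral_of_nonneg_ae (Eventually.of_forall fun x => by positivity)
    hnlc.aestronglyMeasurable]
  refine ENNReal.toReal_mono hTt ?_
  let v : Eu n → ℂ := fun x => ((χ x : ℂ) * (χ x : ℂ)) * (u x * conj (u x))
  have hχχ : IsTest (fun x => (χ x : ℂ) * (χ x : ℂ)) := hχ.test.mul_left hχ.smth
  have huu : Smth (fun x => u x * conj (u x)) := hu.mul hu.conj
  have hv : IsTest v := hχχ.mul_right huu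
  have hvn : ∀ x, ‖v x‖ = χ x ^ 2 * ‖u x‖ ^ 2 := by
    intro x
    simp only [v, norm_mul, Complex.norm_real, Real.norm_of_nonneg (hχ.nonneg x), RCLike.norm_conj]
    ring
  have hvz : ∀ x, x ∉ tsupport χ → v x = 0 := by
    intro x hx
    simp [v, image_eq_zero_of_notMem_tsupport hx]
  have hdvz : ∀ x, x ∉ tsupport χ → fderiv ℝ v x = 0 := by
    intro x hx
    have : v =ᶠ[𝓝 x] fun _ => 0 := by
      have hx' := (isClosed_tsupport χ).isOpen_compl.mem_nhds hx
      filter_upwards [hx'] with y hy using hvz y hy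
    rw [this.fderiv_eq]; simp
  have hvd : Continuous (fderiv ℝ v) := hv.1.continuous_fderiv (by simp)
  have hpt : ∀ x, ‖v x‖ + ‖fderiv ℝ v x‖ ≤ B * (‖u x‖ ^ 2 + gradSqC n u x) := by
    intro x
    have hg0 := gradSqC_nonneg u x
    have h1 : ‖v x‖ ≤ ‖u x‖ ^ 2 + gradSqC n u x := by
      rw [hvn]
      have := mul_le_of_le_one_left (sq_nonneg ‖u x‖) (hχ.sq_le_one x)
      linarith
    have h2 : ∀ j, ‖pdC n v j x‖ ≤ (2 * |A| + 1) * (‖u x‖ ^ 2 + gradSqC n u x) := by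
      intro j
      have e : pdC n v j x = ((χ x : ℂ) * (χ x : ℂ)) *
          (u x * conj (pdC n u j x) + pdC n u j x * conj (u x)) +
          ((χ x : ℂ) * pdC n (fun x => (χ x : ℂ)) j x + pdC n (fun x => (χ x : ℂ)) j x * (χ x : ℂ))
            * (u x * conj (u x)) := by
        rw [← pdC_mul hχ.smth hχ.smth, ← pdC_conj, ← pdC_mul hu hu.conj, ← pdC_mul hχχ.1 huu]
      have hc1 := hχ.le_one x
      have hc0 := hχ.nonneg x
      rw [e]
      have n1 : ‖((χ x : ℂ) * (χ x : ℂ)) * (u x * conj (pdC n u j x) + pdC n u j x * conj (u x))‖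
          ≤ ‖u x‖ ^ 2 + ‖pdC n u j x‖ ^ 2 := by
        rw [norm_mul]
        have a1 : ‖(χ x : ℂ) * (χ x : ℂ)‖ ≤ 1 := by
          simp only [norm_mul, Complex.norm_real, Real.norm_of_nonneg hc0]; nlinarith
        have a2 : ‖u x * conj (pdC n u j x) + pdC n u j x * conj (u x)‖
            ≤ ‖u x‖ ^ 2 + ‖pdC n u j x‖ ^ 2 := by
          refine (norm_add_le _ _).trans ?_
          simp only [norm_mul, RCLike.norm_conj]
          nlinarith [sq_nonneg (‖u x‖ - ‖pdC n u j x‖)]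
        calc _ ≤ 1 * (‖u x‖ ^ 2 + ‖pdC n u j x‖ ^ 2) := by gcongr
          _ = _ := one_mul _
      have n2 : ‖((χ x : ℂ) * pdC n (fun x => (χ x : ℂ)) j x
          + pdC n (fun x => (χ x : ℂ)) j x * (χ x : ℂ)) * (u x * conj (u x))‖
          ≤ 2 * |A| * ‖u x‖ ^ 2 := by
        rw [norm_mul]
        have a1 : ‖(χ x : ℂ) * pdC n (fun x => (χ x : ℂ)) j x
          + pdC n (fun x => (χ x : ℂ)) j x * (χ x : ℂ)‖ ≤ 2 * |A| := by
          refine (norm_add_le _ _).trans ?_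
          simp only [norm_mul, Complex.norm_real, Real.norm_of_nonneg hc0]
          have := hA' j x
          nlinarith [norm_nonneg (pdC n (fun x => (χ x : ℂ)) j x)]
        have a2 : ‖u x * conj (u x)‖ = ‖u x‖ ^ 2 := by
          simp only [norm_mul, RCLike.norm_conj]; ring
        rw [a2]
        gcongr
      refine (norm_add_le _ _).trans ?_
      have := norm_pdC_sq_le u j x
      nlinarith [abs_nonneg A, sq_nonneg ‖u x‖, mul_nonneg (abs_nonneg A) hg0]
    have h3 := (enorm_fderiv_le v x).trans (Finset.sum_le_sum fun j _ => h2 j)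
    simp only [Finset.sum_const, Finset.card_univ, Fintype.card_fin, nsmul_eq_mul] at h3
    rw [hB]; nlinarith
  have hL1 : ∫⁻ x, (‖v x‖ₑ + ‖fderiv ℝ v x‖ₑ) ≤ D * ENNReal.ofReal (B * (|C| + |C|)) := by
    refine (hcomp (fun x => ‖v x‖ₑ + ‖fderiv ℝ v x‖ₑ) (fun x hx => by
      rw [hvz x hx, enorm_zero, ← ofReal_norm, hdvz x hx, norm_zero, ENNReal.ofReal_zero,
        add_zero]) (hv.cont.enorm.add hvd.enorm).measurable).1.trans ?_
    gcongr
    calc ∫⁻ x, (‖v x‖ₑ + ‖fderiv ℝ v x‖ₑ) ∂μ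
        ≤ ∫⁻ x, ENNReal.ofReal (B * (‖u x‖ ^ 2 + gradSqC n u x)) ∂μ := by
          refine lintegral_mono fun x => ?_
          rw [← ofReal_norm, ← ofReal_norm, ← ENNReal.ofReal_add (norm_nonneg _) (norm_nonneg _)]
          exact ENNReal.ofReal_le_ofReal (hpt x)
      _ = ENNReal.ofReal (∫ x, B * (‖u x‖ ^ 2 + gradSqC n u x) ∂μ) := by
          have hi : Integrable (fun x => B * (‖u x‖ ^ 2 + gradSqC n u x)) μ :=
            (hm.add hg).const_mul B
          rw [ofReal_integral_eq_lintegral_ofReal hi]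
          exact Eventually.of_forall fun x =>
            mul_nonneg hB0 (add_nonneg (by positivity) (gradSqC_nonneg u x))
      _ ≤ _ := by
          apply ENNReal.ofReal_le_ofReal
          rw [integral_const_mul, integral_add hm hg]
          have := le_abs_self C
          gcongr <;> linarith
  calc ∫⁻ x in K, ENNReal.ofReal (‖nl (u x)‖ ^ 2) ∂μ
      ≤ ∫⁻ x in K, (4 + ENNReal.ofReal s * ‖v x‖ₑ ^ p) ∂μ := by
        refine setLIntegral_mono' hK.measurableSet fun x hx => ?_
        have e1 : ‖nl (u x)‖ ^ 2 = ‖u x‖ ^ 2 * Real.log (‖u x‖ ^ 2) ^ 2 := by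
          simp only [nl, norm_mul, Complex.norm_real, mul_pow, Real.norm_eq_abs, sq_abs]
        have e2 : ‖v x‖ = ‖u x‖ ^ 2 := by rw [hvn, hχK x hx]; ring
        rw [← ofReal_norm, ENNReal.ofReal_rpow_of_nonneg (norm_nonneg _) hp0.le,
          ← ENNReal.ofReal_mul hs0, e1, e2]
        have h4 : (4 : ENNReal) = ENNReal.ofReal 4 := by norm_num
        rw [h4, ← ENNReal.ofReal_add (by norm_num) (by positivity)]
        exact ENNReal.ofReal_le_ofReal (mul_log_sq_le hp (by positivity))
    _ ≤ ∫⁻ x, (4 + ENNReal.ofReal s * ‖v x‖ₑ ^ p) ∂μ := setLIntegral_le_lintegral _ _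
    _ = 4 + ENNReal.ofReal s * ∫⁻ x, ‖v x‖ₑ ^ p ∂μ := by
        rw [lintegral_add_left measurable_const, lintegral_const_mul' _ _ (by simp)]
        simp
    _ ≤ T := by
        rw [hT]
        gcongr
        refine (hcomp (fun x => ‖v x‖ₑ ^ p) (fun x hx => by simp [hvz x hx, hp0])
          ((ENNReal.continuous_rpow_const.comp hv.cont.enorm).measurable)).2.trans ?_
        gcongr
        refine (hsob v hv.1 hv.2).trans ?_
        gcongr

end

open Set

/-- Classical solutions of the logarithmic Schrödinger equation. -/
structure LSE {n : ℕ} (U : Eu n → ℝ) (μ : Measure (Eu n)) (lam : ℝ) (φ : ℝ → Eu n → ℂ) :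
    Prop where
  smth : ∀ t, Smth (φ t)
  tdiff : ∀ x t, DifferentiableAt ℝ (fun s => φ s x) t
  mass : ∀ t, Integrable (fun x => ‖φ t x‖ ^ 2) μ
  grad : ∀ t, Integrable (gradSqC n (φ t)) μ
  pde : ∀ t x, Complex.I * deriv (fun s => φ s x) t
      = -(LopC n U (φ t) x) +
        (lam : ℂ) * φ t x * (Real.log (‖φ t x‖ ^ 2 / ∫ y, ‖φ t y‖ ^ 2 ∂μ) : ℂ)

section
variable {n : ℕ} {U : Eu n → ℝ} {μ : Measure (Eu n)} {lam : ℝ} {φ : ℝ → Eu n → ℂ}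

/-- The bilinear pairing. -/
def pair (μ : Measure (Eu n)) (u η : Eu n → ℂ) : ℂ := ∫ x, u x * η x ∂μ

/-- Squared `L²` norm. -/
def nsq (μ : Measure (Eu n)) (u : Eu n → ℂ) : ℝ := ∫ x, ‖u x‖ ^ 2 ∂μ

/-- Dirichlet energy. -/
def dir (μ : Measure (Eu n)) (u : Eu n → ℂ) : ℝ := ∫ x, gradSqC n u x ∂μ

/-- Time derivative. -/
def dt (φ : ℝ → Eu n → ℂ) (t : ℝ) (x : Eu n) : ℂ := deriv (fun s => φ s x) t

/-- Logarithm of the total mass. -/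
def kap (μ : Measure (Eu n)) (φ : ℝ → Eu n → ℂ) (t : ℝ) : ℝ := Real.log (nsq μ (φ t))

lemma nsq_nonneg (u : Eu n → ℂ) : 0 ≤ nsq μ u := integral_nonneg fun _ => by positivity
lemma dir_nonneg (u : Eu n → ℂ) : 0 ≤ dir μ u := integral_nonneg fun _ => gradSqC_nonneg _ _

lemma LSE.nsq_pos (hG : Gibbs U μ) (h : LSE U μ lam φ) {t : ℝ} {x : Eu n} (hx : φ t x ≠ 0) :
    0 < nsq μ (φ t) := by
  have := hG.isOpenPos
  have hc : Continuous (fun x => ‖φ t x‖ ^ 2) := (h.smth t).cont.norm.pow 2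
  rcases (nsq_nonneg (μ := μ) (φ t)).eq_or_lt with h0 | h0
  · exfalso
    have := (integral_eq_zero_iff_of_nonneg (fun x => by positivity) (h.mass t)).1 h0.symm
    have h1 := (hc.ae_eq_iff_eq μ continuous_const).1 this
    have h2 : ‖φ t x‖ ^ 2 = 0 := congrFun h1 x
    exact hx (by simpa using h2)
  · exact h0

lemma LSE.dt_eq (hG : Gibbs U μ) (h : LSE U μ lam φ) (t : ℝ) (x : Eu n) :
    dt φ t x = Complex.I * LopC n U (φ t) x - Complex.I * lam * nl (φ t x)
      + Complex.I * lam * kap μ φ t * φ t x := by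
  have h1 := h.pde t x
  have hI : Complex.I * Complex.I = -1 := Complex.I_mul_I
  have h2 : dt φ t x = -Complex.I * (Complex.I * deriv (fun s => φ s x) t) := by
    unfold dt; linear_combination (deriv (fun s => φ s x) t) * hI
  have h3 : φ t x * (Real.log (‖φ t x‖ ^ 2 / ∫ y, ‖φ t y‖ ^ 2 ∂μ) : ℂ)
      = nl (φ t x) - kap μ φ t * φ t x := by
    by_cases hx : φ t x = 0
    · simp [hx, nl]
    · have hp : 0 < ∫ y, ‖φ t y‖ ^ 2 ∂μ := h.nsq_pos hG hx
      rw [Real.log_div (by simpa using hx) hp.ne']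
      unfold nl kap nsq; push_cast; ring
  rw [h2, h1, mul_assoc (lam : ℂ), h3]; ring

lemma IsTest.nsq_integrable (hG : Gibbs U μ) {η : Eu n → ℂ} (hη : IsTest η) :
    Integrable (fun x => ‖η x‖ ^ 2) μ :=
  hG.integrable_hcsR (hη.cont.norm.pow 2) (hcs_of_zero hη.2 fun x hx => by simp [hx])

lemma IsTest.gradSq_integrable (hG : Gibbs U μ) {η : Eu n → ℂ} (hη : IsTest η) :
    Integrable (gradSqC n η) μ :=
  integrable_finsetSum _ fun j _ => (hη.pdC j).nsq_integrable hG

lemma gradSq_pd_integrable {u : Eu n → ℂ} (hu : Smth u) (h : Integrable (gradSqC n u) μ)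
    (j : Fin n) : Integrable (fun x => ‖pdC n u j x‖ ^ 2) μ := by
  refine h.mono' ((hu.pdC j).cont.norm.pow 2).aestronglyMeasurable
    (Eventually.of_forall fun x => ?_)
  rw [Real.norm_of_nonneg (by positivity)]
  exact norm_pdC_sq_le u j x

lemma norm_pair_le {u η : Eu n → ℂ} (hu : Continuous u) (hη : Continuous η)
    (h1 : Integrable (fun x => ‖u x‖ ^ 2) μ) (h2 : Integrable (fun x => ‖η x‖ ^ 2) μ) :
    ‖pair μ u η‖ ≤ √(nsq μ u) * √(nsq μ η) :=
  norm_integral_mul_le_sqrt hu.aestronglyMeasurable hη.aestronglyMeasurable h1 h2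

/-- Cauchy-Schwarz for gradients. -/
lemma integral_sum_norm_le {u η : Eu n → ℂ} (hu : Smth u) (hη : Smth η)
    (h1 : Integrable (gradSqC n u) μ) (h2 : Integrable (gradSqC n η) μ) :
    ∫ x, ∑ j, ‖pdC n u j x‖ * ‖pdC n η j x‖ ∂μ ≤ √(dir μ u) * √(dir μ η) := by
  have hs : ∀ (w : Eu n → ℂ) x, √(gradSqC n w x) ^ 2 = gradSqC n w x := fun w x =>
    Real.sq_sqrt (gradSqC_nonneg w x)
  have h3 := integral_mul_le_sqrt (μ := μ) (f := fun x => √(gradSqC n u x))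
    (g := fun x => √(gradSqC n η x)) (fun _ => Real.sqrt_nonneg _) (fun _ => Real.sqrt_nonneg _)
    (hu.continuous_gradSq.sqrt.aestronglyMeasurable)
    (hη.continuous_gradSq.sqrt.aestronglyMeasurable) (by simpa only [hs] using h1)
    (by simpa only [hs] using h2)
  simp only [hs] at h3
  refine le_trans (integral_mono ?_ ?_ fun x => ?_) h3
  · refine integrable_finsetSum _ fun j _ => ?_
    have := integrable_mul_of_sq (hu.pdC j).cont.aestronglyMeasurable
      (hη.pdC j).cont.aestronglyMeasurable (gradSq_pd_integrable hu h1 j)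
      (gradSq_pd_integrable hη h2 j)
    simpa only [norm_mul] using this.norm
  · have : Integrable (fun x => gradSqC n u x + gradSqC n η x) μ := h1.add h2
    refine this.mono' (hu.continuous_gradSq.sqrt.mul
      hη.continuous_gradSq.sqrt).aestronglyMeasurable (Eventually.of_forall fun x => ?_)
    rw [Real.norm_of_nonneg (by positivity)]
    nlinarith [sq_nonneg (√(gradSqC n u x) - √(gradSqC n η x)), hs u x, hs η x,
      Real.sqrt_nonneg (gradSqC n u x), Real.sqrt_nonneg (gradSqC n η x)]
  · exact Real.sum_mul_le_sqrt_mul_sqrt _ _ _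

lemma norm_sum_pair_le {u η : Eu n → ℂ} (hu : Smth u) (hη : Smth η)
    (h1 : Integrable (gradSqC n u) μ) (h2 : Integrable (gradSqC n η) μ) :
    ‖∑ j, ∫ x, pdC n u j x * pdC n η j x ∂μ‖ ≤ √(dir μ u) * √(dir μ η) := by
  have hi : ∀ j, Integrable (fun x => pdC n u j x * pdC n η j x) μ := fun j =>
    integrable_mul_of_sq (hu.pdC j).cont.aestronglyMeasurable
      (hη.pdC j).cont.aestronglyMeasurable (gradSq_pd_integrable hu h1 j)
      (gradSq_pd_integrable hη h2 j)
  rw [← integral_finsetSum _ fun j _ => hi j]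
  refine le_trans ?_ (integral_sum_norm_le hu hη h1 h2)
  refine norm_integral_le_of_norm_le ?_ (Eventually.of_forall fun x => ?_)
  · exact integrable_finsetSum _ fun j _ => by simpa only [norm_mul] using (hi j).norm
  · refine (norm_sum_le _ _).trans (Finset.sum_le_sum fun j _ => (norm_mul _ _).le)

lemma norm_pair_LopC_le (hG : Gibbs U μ) {u η : Eu n → ℂ} (hu : Smth u) (hη : IsTest η)
    (h1 : Integrable (gradSqC n u) μ) :
    ‖pair μ u (LopC n U η)‖ ≤ √(dir μ u) * √(dir μ η) := by
  unfold pair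
  rw [← hG.symm hu hη, hG.green hu hη, norm_neg]
  exact norm_sum_pair_le hu hη.1 h1 (hη.gradSq_integrable hG)

lemma continuous_nl_comp {u : Eu n → ℂ} (hu : Smth u) : Continuous (fun x => nl (u x)) :=
  continuous_nl.comp hu.cont

/-- The weak form of the equation at a fixed time. -/
lemma LSE.pair_dt (hG : Gibbs U μ) (h : LSE U μ lam φ) (t : ℝ) {η : Eu n → ℂ} (hη : IsTest η) :
    pair μ (dt φ t) η = Complex.I * pair μ (φ t) (LopC n U η)
      - Complex.I * lam * pair μ (fun x => nl (φ t x)) η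
      + Complex.I * lam * kap μ φ t * pair μ (φ t) η := by
  unfold pair
  rw [← hG.symm (h.smth t) hη]
  have i1 := hG.integrable_mul ((h.smth t).LopC hG.smooth).cont hη
  have i2 := hG.integrable_mul (continuous_nl_comp (h.smth t)) hη
  have i3 := hG.integrable_mul (h.smth t).cont hη
  have i12 : Integrable (fun x => Complex.I * (LopC n U (φ t) x * η x)
      - Complex.I * lam * (nl (φ t x) * η x)) μ := (i1.const_mul _).sub (i2.const_mul _)
  rw [← integral_const_mul, ← integral_const_mul, ← integral_const_mul,
    ← integral_sub (i1.const_mul _) (i2.const_mul _), ← integral_add i12 (i3.const_mul _)]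
  refine integral_congr_ae (Eventually.of_forall fun x => ?_)
  simp only [h.dt_eq hG t x]; ring

/-- Uniform bounds on a time interval. -/
def Bd (μ : Measure (Eu n)) (φ : ℝ → Eu n → ℂ) (a b C : ℝ) : Prop :=
  ∀ r ∈ Icc a b, nsq μ (φ r) ≤ C ∧ dir μ (φ r) ≤ C ∧ |kap μ φ r| ≤ C

lemma Bd.mono {a b c d C : ℝ} (h : Bd μ φ a b C) (hs : Icc c d ⊆ Icc a b) : Bd μ φ c d C :=
  fun r hr => h r (hs hr)

lemma norm_pair_nl_le (hG : Gibbs U μ) {K : Set (Eu n)} (hK : IsCompact K) {C' : ℝ}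
    {u η : Eu n → ℂ} (hu : Smth u) (hη : IsTest η) (hηK : ∀ x, x ∉ K → η x = 0)
    (hC : ∫ x in K, ‖nl (u x)‖ ^ 2 ∂μ ≤ C') :
    ‖pair μ (fun x => nl (u x)) η‖ ≤ √C' * √(nsq μ η) := by
  have := hG.prob
  unfold pair
  rw [← setIntegral_eq_integral_of_forall_compl_eq_zero (s := K) fun x hx => by simp [hηK x hx]]
  refine (norm_integral_mul_le_sqrt (continuous_nl_comp hu).aestronglyMeasurable
    hη.cont.aestronglyMeasurable ?_ (hη.nsq_integrable hG).integrableOn).trans ?_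
  · exact ((continuous_nl_comp hu).norm.pow 2).continuousOn.integrableOn_compact hK
  · gcongr
    exact setIntegral_le_integral (hη.nsq_integrable hG) (Eventually.of_forall fun _ => by positivity)

lemma LSE.exists_pair_dt_bound (hG : Gibbs U μ) (h : LSE U μ lam φ) {a b C : ℝ}
    (hB : Bd μ φ a b C) {K : Set (Eu n)} (hK : IsCompact K) :
    ∃ A : ℝ, 0 ≤ A ∧ ∀ r ∈ Icc a b, ∀ η : Eu n → ℂ, IsTest η → (∀ x, x ∉ K → η x = 0) →
      ‖pair μ (fun x => nl (φ r x)) η‖ ≤ A * √(nsq μ η) ∧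
      ‖pair μ (dt φ r) η‖ ≤ A * (√(nsq μ η) + √(dir μ η)) ∧
      ‖pair μ (dt φ r) η‖ ≤ ‖pair μ (φ r) (LopC n U η)‖ + A * √(nsq μ η) ∧
      ‖pair μ (φ r) η‖ ≤ A * √(nsq μ η) := by
  obtain ⟨C', hC'0, hC'⟩ := hG.exists_local_log hK C
  set A : ℝ := √C' + √C + |lam| * √C' + |lam| * |C| * √C with hA
  have hA1 : √C' ≤ A := by rw [hA]; have : 0 ≤ √C + |lam| * √C' + |lam| * |C| * √C := by
                            positivity
                           linarith
  have hA2 : √C ≤ A := by rw [hA]; have : 0 ≤ √C' + |lam| * √C' + |lam| * |C| * √C := by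
                            positivity
                          linarith
  have hA3 : |lam| * √C' + |lam| * |C| * √C ≤ A := by
    rw [hA]; have : 0 ≤ √C' + √C := by positivity
    linarith
  refine ⟨A, by positivity, fun r hr η hη hηK => ?_⟩
  obtain ⟨hm, he, hk⟩ := hB r hr
  have b1 : ‖pair μ (fun x => nl (φ r x)) η‖ ≤ √C' * √(nsq μ η) :=
    norm_pair_nl_le hG hK (h.smth r) hη hηK (hC' _ (h.smth r) (h.mass r) (h.grad r) hm he)
  have b2 : ‖pair μ (φ r) η‖ ≤ √C * √(nsq μ η) := by
    refine (norm_pair_le (h.smth r).cont hη.cont (h.mass r) (hη.nsq_integrable hG)).trans ?_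
    gcongr
  have b3 : ‖pair μ (φ r) (LopC n U η)‖ ≤ √C * √(dir μ η) := by
    refine (norm_pair_LopC_le hG (h.smth r) hη (h.grad r)).trans ?_
    gcongr
  have b4 : ‖pair μ (dt φ r) η‖ ≤ ‖pair μ (φ r) (LopC n U η)‖
      + (|lam| * √C' + |lam| * |C| * √C) * √(nsq μ η) := by
    rw [h.pair_dt hG r hη]
    refine (norm_add_le _ _).trans ?_
    have t1 := norm_sub_le (Complex.I * pair μ (φ r) (LopC n U η))
      (Complex.I * lam * pair μ (fun x => nl (φ r x)) η)
    simp only [norm_mul, Complex.norm_I, one_mul, Complex.norm_real, Real.norm_eq_abs] at t1 ⊢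
    have t2 : |lam| * ‖pair μ (fun x => nl (φ r x)) η‖ ≤ |lam| * (√C' * √(nsq μ η)) := by gcongr
    have t3 : |lam| * |kap μ φ r| * ‖pair μ (φ r) η‖ ≤ |lam| * |C| * (√C * √(nsq μ η)) := by
      exact mul_le_mul (mul_le_mul_of_nonneg_left (hk.trans (le_abs_self C)) (abs_nonneg _)) b2
        (norm_nonneg _) (by positivity)
    linarith
  have hs : 0 ≤ √(nsq μ η) := Real.sqrt_nonneg _
  have hd : 0 ≤ √(dir μ η) := Real.sqrt_nonneg _
  refine ⟨b1.trans (by gcongr), ?_, b4.trans (by gcongr), b2.trans (by gcongr)⟩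
  refine b4.trans ?_
  have : √C * √(dir μ η) ≤ A * √(dir μ η) := by gcongr
  have : (|lam| * √C' + |lam| * |C| * √C) * √(nsq μ η) ≤ A * √(nsq μ η) := by gcongr
  linarith

lemma LSE.continuous_time (h : LSE U μ lam φ) (x : Eu n) : Continuous (fun t => φ t x) :=
  Differentiable.continuous fun t => h.tdiff x t

/-- Weak continuity at a point of a set along which the mass is bounded. -/
lemma LSE.tendsto_pair (hG : Gibbs U μ) (h : LSE U μ lam φ) {S : Set ℝ} {C : ℝ}
    (hS : ∀ r ∈ S, nsq μ (φ r) ≤ C) {η : Eu n → ℂ} (hη : IsTest η) (t : ℝ) :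
    Tendsto (fun r => pair μ (φ r) η) (𝓝[S] t) (𝓝 (pair μ (φ t) η)) := by
  have := hG.prob
  obtain ⟨B, hB⟩ := hη.cont.bounded_above_of_compact_support hη.2
  refine tendsto_integral_mul (C := C) (B := B) (fun i => (h.smth i).cont.aestronglyMeasurable)
    (h.smth t).cont.aestronglyMeasurable (fun i => h.mass i) (h.mass t) ?_ (fun x => ?_)
    hη.cont.aestronglyMeasurable hB
  · filter_upwards [self_mem_nhdsWithin] with r hr using hS r hr
  · exact ((h.continuous_time x).tendsto t).mono_left nhdsWithin_le_nhds

lemma LSE.continuousOn_pair (hG : Gibbs U μ) (h : LSE U μ lam φ) {S : Set ℝ} {C : ℝ}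
    (hS : ∀ r ∈ S, nsq μ (φ r) ≤ C) {η : Eu n → ℂ} (hη : IsTest η) :
    ContinuousOn (fun r => pair μ (φ r) η) S := fun t _ => h.tendsto_pair hG hS hη t

lemma LSE.continuousOn_pair_nl (hG : Gibbs U μ) (h : LSE U μ lam φ) {a b C : ℝ}
    (hB : Bd μ φ a b C) {η : Eu n → ℂ} (hη : IsTest η) :
    ContinuousOn (fun r => pair μ (fun x => nl (φ r x)) η) (Icc a b) := by
  have := hG.prob
  intro t ht
  have hK : IsCompact (tsupport η) := hη.2
  obtain ⟨C', hC'0, hC'⟩ := hG.exists_local_log hK C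
  obtain ⟨B, hBd⟩ := hη.cont.bounded_above_of_compact_support hη.2
  have e : ∀ r, pair μ (fun x => nl (φ r x)) η = ∫ x in tsupport η, nl (φ r x) * η x ∂μ := by
    intro r
    rw [setIntegral_eq_integral_of_forall_compl_eq_zero fun x hx => by
      simp [image_eq_zero_of_notMem_tsupport hx]]
    rfl
  unfold ContinuousWithinAt
  simp only [e]
  have hi : ∀ r, IntegrableOn (fun x => ‖nl (φ r x)‖ ^ 2) (tsupport η) μ := fun r =>
    ((continuous_nl_comp (h.smth r)).norm.pow 2).continuousOn.integrableOn_compact hK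
  refine tendsto_integral_mul (C := C') (B := B)
    (fun i => (continuous_nl_comp (h.smth i)).aestronglyMeasurable)
    (continuous_nl_comp (h.smth t)).aestronglyMeasurable hi (hi t) ?_ (fun x => ?_)
    hη.cont.aestronglyMeasurable hBd
  · filter_upwards [self_mem_nhdsWithin] with r hr
    exact hC' _ (h.smth r) (h.mass r) (h.grad r) (hB r hr).1 (hB r hr).2.1
  · exact ((continuous_nl.comp (h.continuous_time x)).tendsto t).mono_left nhdsWithin_le_nhds

lemma LSE.measurable_uncurry (h : LSE U μ lam φ) :
    StronglyMeasurable (Function.uncurry φ) := by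
  exact stronglyMeasurable_uncurry_of_continuous_of_stronglyMeasurable
    (fun x => h.continuous_time x) (fun t => (h.smth t).cont.stronglyMeasurable)

lemma LSE.measurable_kap (hG : Gibbs U μ) (h : LSE U μ lam φ) : Measurable (kap μ φ) := by
  have := hG.prob
  refine Real.measurable_log.comp ?_
  have h1 : StronglyMeasurable (fun z : ℝ × Eu n => ‖φ z.1 z.2‖ ^ 2) := h.measurable_uncurry.norm.pow 2
  exact (h1.integral_prod_right (ν := μ)).measurable

/-- The weak time derivative is integrable on intervals with bounds. -/
lemma LSE.integrableOn_pair_dt (hG : Gibbs U μ) (h : LSE U μ lam φ) {a b C : ℝ}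
    (hB : Bd μ φ a b C) {η : Eu n → ℂ} (hη : IsTest η) :
    IntegrableOn (fun r => pair μ (dt φ r) η) (Icc a b) := by
  obtain ⟨A, hA0, hA⟩ := h.exists_pair_dt_bound hG hB (K := tsupport η) hη.2
  have c1 := h.continuousOn_pair hG (fun r hr => (hB r hr).1) (hη.LopC hG.smooth)
  have c2 := h.continuousOn_pair_nl hG hB hη
  have c3 := h.continuousOn_pair hG (fun r hr => (hB r hr).1) hη
  have hm : AEStronglyMeasurable (fun r => pair μ (dt φ r) η) (volume.restrict (Icc a b)) := by
    simp only [h.pair_dt hG _ hη]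
    refine AEStronglyMeasurable.add (AEStronglyMeasurable.sub ?_ ?_) ?_
    · exact (c1.aestronglyMeasurable measurableSet_Icc).const_mul _
    · exact (c2.aestronglyMeasurable measurableSet_Icc).const_mul _
    · refine AEStronglyMeasurable.mul ?_ (c3.aestronglyMeasurable measurableSet_Icc)
      refine AEStronglyMeasurable.const_mul ?_ _
      exact (Complex.measurable_ofReal.comp (h.measurable_kap hG)).aestronglyMeasurable
  refine Integrable.mono' (g := fun _ => A * (√(nsq μ η) + √(dir μ η)))
    (integrable_const _) hm ?_
  rw [ae_restrict_iff' measurableSet_Icc]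
  exact Eventually.of_forall fun r hr =>
    (hA r hr η hη fun x hx => image_eq_zero_of_notMem_tsupport hx).2.1

/-- Lower semicontinuity of the mass. -/
lemma LSE.nsq_le_of_tendsto (h : LSE U μ lam φ) {C t : ℝ} {r : ℕ → ℝ}
    (hr : Tendsto r atTop (𝓝 t)) (hC : ∀ k, nsq μ (φ (r k)) ≤ C) : nsq μ (φ t) ≤ C := by
  have hC0 : 0 ≤ C := (nsq_nonneg _).trans (hC 0)
  have e : ∀ s, ENNReal.ofReal (nsq μ (φ s)) = ∫⁻ x, ENNReal.ofReal (‖φ s x‖ ^ 2) ∂μ := fun s =>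
    ofReal_integral_eq_lintegral_ofReal (h.mass s) (Eventually.of_forall fun x => by positivity)
  rw [← ENNReal.ofReal_le_ofReal_iff hC0, e]
  have hl : ∀ x, ENNReal.ofReal (‖φ t x‖ ^ 2)
      = liminf (fun k => ENNReal.ofReal (‖φ (r k) x‖ ^ 2)) atTop := by
    intro x
    refine (Tendsto.liminf_eq ?_).symm
    refine (ENNReal.continuous_ofReal.tendsto _).comp ?_
    exact ((((h.continuous_time x).tendsto t).comp hr).norm.pow 2)
  simp only [hl]
  refine (lintegral_liminf_le fun k => ?_).trans ?_
  · exact ((h.smth (r k)).cont.norm.pow 2).measurable.ennreal_ofReal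
  · refine liminf_le_of_le (by isBoundedDefault) fun b hb => ?_
    obtain ⟨k, hk⟩ := hb.exists
    refine hk.trans ?_
    rw [← e]
    exact ENNReal.ofReal_le_ofReal (hC k)

end

section
variable {n : ℕ} {U : Eu n → ℝ} {μ : Measure (Eu n)} {lam : ℝ} {φ : ℝ → Eu n → ℂ}

lemma exists_cut_seq (n : ℕ) : ∃ C0 : ℝ, 0 < C0 ∧ ∃ χ : ℕ → Eu n → ℝ, (∀ k, IsCut (χ k)) ∧
    (∀ (k : ℕ) x, ‖x‖ ≤ k + 1 → χ k x = 1) ∧ ∀ (k : ℕ) x, ∑ j, pdR n (χ k) j x ^ 2 ≤ (C0 / (k + 1)) ^ 2 := by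
  obtain ⟨C0, h0, h⟩ := exists_cut_ball n
  choose χ h1 h2 h3 using fun k : ℕ => h (k + 1) (by simp)
  exact ⟨C0, h0, χ, h1, h2, h3⟩

lemma tendsto_cut_integral {χ : ℕ → Eu n → ℝ} (h1 : ∀ k, IsCut (χ k))
    (h2 : ∀ (k : ℕ) x, ‖x‖ ≤ k + 1 → χ k x = 1) {F : Eu n → ℝ} (hF : Integrable F μ) :
    Tendsto (fun k => ∫ x, χ k x ^ 2 * F x ∂μ) atTop (𝓝 (∫ x, F x ∂μ)) := by
  refine tendsto_integral_of_dominated_convergence (fun x => ‖F x‖) (fun k => ?_) hF.norm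
    (fun k => Eventually.of_forall fun x => ?_) (Eventually.of_forall fun x => ?_)
  · exact ((h1 k).smooth.continuous.pow 2).aestronglyMeasurable.mul hF.1
  · rw [norm_mul, Real.norm_of_nonneg (by positivity)]
    exact mul_le_of_le_one_left (norm_nonneg _) ((h1 k).sq_le_one x)
  · refine tendsto_const_nhds.congr' ?_
    obtain ⟨N, hN⟩ := exists_nat_ge ‖x‖
    filter_upwards [eventually_ge_atTop N] with k hk
    have : (N : ℝ) ≤ k := by exact_mod_cast hk
    rw [h2 k x (by linarith)]; ring

lemma Gibbs.integrable_cut_sq (hG : Gibbs U μ) {χ : Eu n → ℝ} (hχ : IsCut χ) {F : Eu n → ℝ}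
    (hF : Continuous F) : Integrable (fun x => χ x ^ 2 * F x) μ :=
  hG.integrable_hcsR ((hχ.smooth.continuous.pow 2).mul hF)
    (hcs_of_zero hχ.hcs fun x hx => by simp [hx])

lemma IsCut.sq_smth {χ : Eu n → ℝ} (h : IsCut χ) : Smth (fun x => ((χ x ^ 2 : ℝ) : ℂ)) :=
  Smth.ofReal (h.smooth.pow 2)

lemma IsCut.sq_mul_test {χ : Eu n → ℝ} (h : IsCut χ) {v : Eu n → ℂ} (hv : Smth v) :
    IsTest (fun x => ((χ x ^ 2 : ℝ) : ℂ) * v x) :=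
  ⟨h.sq_smth.mul hv, hcs_of_zero h.hcs fun x hx => by simp [hx]⟩

/-- The Dirichlet energy is lower semicontinuous for the weak topology. -/
lemma dir_le_of_tendsto (hG : Gibbs U μ) {u : Eu n → ℂ} (hu : Smth u)
    (hi : Integrable (gradSqC n u) μ) {w : ℕ → Eu n → ℂ} {B : ℝ} (hw : ∀ k, Smth (w k))
    (hwi : ∀ k, Integrable (gradSqC n (w k)) μ) (hB : ∀ k, dir μ (w k) ≤ B)
    (ht : ∀ η, IsTest η → Tendsto (fun k => pair μ (w k) η) atTop (𝓝 (pair μ u η))) :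
    dir μ u ≤ B := by
  obtain ⟨C0, -, χ, h1, h2, -⟩ := exists_cut_seq n
  refine le_of_tendsto (tendsto_cut_integral h1 h2 hi) (Eventually.of_forall fun m => ?_)
  have hη : ∀ j, IsTest (fun x => ((χ m x ^ 2 : ℝ) : ℂ) * conj (pdC n u j x)) := fun j =>
    (h1 m).sq_mul_test (hu.pdC j).conj
  set Y : (Eu n → ℂ) → ℂ := fun v => ∑ j, ∫ x, pdC n v j x *
    (((χ m x ^ 2 : ℝ) : ℂ) * conj (pdC n u j x)) ∂μ with hY
  have hYl : Tendsto (fun k => (Y (w k)).re) atTop (𝓝 (Y u).re) := by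
    refine (Complex.continuous_re.tendsto _).comp (tendsto_finsetSum _ fun j _ => ?_)
    simp only [hG.ibp (hw _) (hη j) j, hG.ibp hu (hη j) j]
    refine Tendsto.neg (ht _ ?_)
    exact ((hη j).pdC j).sub ((hη j).mul_left (Smth.ofReal (contDiff_pdR hG.smooth j)))
  set X := ∫ x, χ m x ^ 2 * gradSqC n u x ∂μ with hX
  have hXi : Integrable (fun x => χ m x ^ 2 * gradSqC n u x) μ :=
    hG.integrable_cut_sq (h1 m) hu.continuous_gradSq
  have hYe : ∀ v, Smth v → (Y v).re = ∫ x, (∑ j, pdC n v j x *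
      (((χ m x ^ 2 : ℝ) : ℂ) * conj (pdC n u j x))).re ∂μ ∧ Integrable (fun x => (∑ j, pdC n v j x *
      (((χ m x ^ 2 : ℝ) : ℂ) * conj (pdC n u j x))).re) μ := by
    intro v hv
    have i1 : ∀ j, Integrable (fun x => pdC n v j x *
      (((χ m x ^ 2 : ℝ) : ℂ) * conj (pdC n u j x))) μ := fun j =>
      hG.integrable_mul (hv.pdC j).cont (hη j)
    have i2 : Integrable (fun x => ∑ j, pdC n v j x *
      (((χ m x ^ 2 : ℝ) : ℂ) * conj (pdC n u j x))) μ := integrable_finsetSum _ fun j _ => i1 j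
    refine ⟨?_, i2.re⟩
    rw [hY]; simp only
    rw [← integral_finsetSum _ fun j _ => i1 j]
    exact (integral_re i2).symm
  have hYu : (Y u).re = X := by
    rw [(hYe u hu).1]
    refine integral_congr_ae (Eventually.of_forall fun x => ?_)
    simp only [gradSqC, Finset.mul_sum, Complex.re_sum]
    refine Finset.sum_congr rfl fun j _ => ?_
    rw [mul_left_comm, Complex.mul_conj, ← Complex.ofReal_mul, Complex.ofReal_re,
      Complex.normSq_eq_norm_sq]
  have hYw : ∀ k, (Y (w k)).re ≤ B / 2 + X / 2 := by
    intro k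
    rw [(hYe _ (hw k)).1]
    have : ∫ x, (gradSqC n (w k) x / 2 + χ m x ^ 2 * gradSqC n u x / 2) ∂μ ≤ B / 2 + X / 2 := by
      rw [integral_add ((hwi k).div_const 2) (hXi.div_const 2), integral_div, integral_div]
      have := hB k
      unfold dir at this
      linarith
    refine le_trans (integral_mono (hYe _ (hw k)).2 ((hwi k).div_const 2 |>.add
      (hXi.div_const 2)) fun x => ?_) this
    simp only [Pi.add_apply, gradSqC, Finset.mul_sum, Complex.re_sum, Finset.sum_div,
      ← Finset.sum_add_distrib]
    refine Finset.sum_le_sum fun j _ => ?_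
    refine (Complex.re_le_norm _).trans ?_
    rw [norm_mul, norm_mul, Complex.norm_real, Complex.norm_conj, Real.norm_of_nonneg (by positivity)]
    have h01 := (h1 m).sq_le_one x
    have h00 : 0 ≤ χ m x ^ 2 := by positivity
    generalize χ m x ^ 2 = c at h01 h00
    nlinarith [mul_nonneg h00 (sq_nonneg (‖pdC n (w k) j x‖ - ‖pdC n u j x‖)),
      mul_nonneg (sub_nonneg.2 h01) (sq_nonneg ‖pdC n (w k) j x‖)]
  have := le_of_tendsto hYl (Eventually.of_forall hYw)
  rw [hYu] at this
  linarith

/-- The defect in the fundamental theorem of calculus for the weak formulation. -/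
def defect (μ : Measure (Eu n)) (φ : ℝ → Eu n → ℂ) (a : ℝ) (η : Eu n → ℂ) (t : ℝ) : ℂ :=
  pair μ (φ t) η - ∫ r in a..t, pair μ (dt φ r) η

lemma LSE.intervalIntegrable_pair_dt (hG : Gibbs U μ) (h : LSE U μ lam φ) {a b C : ℝ}
    (hB : Bd μ φ a b C) {η : Eu n → ℂ} (hη : IsTest η) {s t : ℝ} (hs : s ∈ Icc a b)
    (ht : t ∈ Icc a b) :
    IntervalIntegrable (fun r => pair μ (dt φ r) η) volume s t := by
  rw [intervalIntegrable_iff]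
  refine (h.integrableOn_pair_dt hG hB hη).mono_set ?_
  exact Set.uIoc_subset_uIcc.trans (Set.uIcc_subset_Icc hs ht)

lemma LSE.continuousOn_defect (hG : Gibbs U μ) (h : LSE U μ lam φ) {a b C : ℝ}
    (hB : Bd μ φ a b C) {η : Eu n → ℂ} (hη : IsTest η) :
    ContinuousOn (defect μ φ a η) (Icc a b) := by
  refine (h.continuousOn_pair hG (fun r hr => (hB r hr).1) hη).sub ?_
  rcases le_or_gt a b with hab | hab
  · have := intervalIntegral.continuousOn_primitive_interval'
      (h.intervalIntegrable_pair_dt hG hB hη ⟨le_rfl, hab⟩ ⟨hab, le_rfl⟩) left_mem_uIcc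
    rwa [Set.uIcc_of_le hab] at this
  · rw [Set.Icc_eq_empty (by linarith)]; exact continuousOn_empty _

lemma LSE.defect_sub (hG : Gibbs U μ) (h : LSE U μ lam φ) {a b C : ℝ}
    (hB : Bd μ φ a b C) {η : Eu n → ℂ} (hη : IsTest η) {s t : ℝ} (hs : s ∈ Icc a b)
    (ht : t ∈ Icc a b) : defect μ φ a η t - defect μ φ a η s =
      pair μ (φ t) η - pair μ (φ s) η - ∫ r in s..t, pair μ (dt φ r) η := by
  have ha : a ∈ Icc a b := ⟨le_rfl, hs.1.trans hs.2⟩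
  have := intervalIntegral.integral_interval_sub_left
    (h.intervalIntegrable_pair_dt hG hB hη ha ht) (h.intervalIntegrable_pair_dt hG hB hη ha hs)
  unfold defect
  rw [← this]; ring

lemma eq_of_locally_const {f : ℝ → ℂ} {s t : ℝ} (hst : s ≤ t) (hf : ContinuousOn f (Icc s t))
    (h : ∀ r ∈ Ioo s t, ∀ᶠ r' in 𝓝 r, f r' = f r) : f t = f s := by
  rcases hst.eq_or_lt with rfl | hlt
  · rfl
  obtain ⟨m, hm⟩ := nonempty_Ioo.2 hlt
  have hd : ∀ r ∈ Ioo s t, HasDerivAt f 0 r := fun r hr =>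
    (hasDerivAt_const r (f r)).congr_of_eventuallyEq (h r hr)
  have hc : ∀ r ∈ Ioo s t, f r = f m := fun r hr =>
    isOpen_Ioo.is_const_of_deriv_eq_zero isPreconnected_Ioo
      (fun r hr => (hd r hr).differentiableAt.differentiableWithinAt)
      (fun r hr => (hd r hr).deriv) hr hm
  have key : ∀ r ∈ Icc s t, f r = f m := by
    intro r hr
    have h1 : Tendsto f (𝓝[Ioo s t] r) (𝓝 (f r)) := (hf r hr).mono_left
      (nhdsWithin_mono _ Ioo_subset_Icc_self)
    have h2 : Tendsto f (𝓝[Ioo s t] r) (𝓝 (f m)) := by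
      refine tendsto_const_nhds.congr' ?_
      filter_upwards [self_mem_nhdsWithin] with r' hr' using (hc r' hr').symm
    have : (𝓝[Ioo s t] r).NeBot := by
      rw [← mem_closure_iff_nhdsWithin_neBot, closure_Ioo hlt.ne]; exact hr
    exact tendsto_nhds_unique h1 h2
  rw [key t ⟨hst, le_rfl⟩, key s ⟨le_rfl, hst⟩]

lemma LSE.measurable_dt (h : LSE U μ lam φ) :
    StronglyMeasurable (fun z : ℝ × Eu n => dt φ z.1 z.2) := by
  have hlim : ∀ z : ℝ × Eu n, Tendsto (fun k : ℕ => ((k : ℂ) + 1) *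
      (φ (z.1 + ((k : ℝ) + 1)⁻¹) z.2 - φ z.1 z.2)) atTop (𝓝 (dt φ z.1 z.2)) := by
    intro z
    have h1 := (h.tdiff z.2 z.1).hasDerivAt.tendsto_slope_zero
    have h2 : Tendsto (fun k : ℕ => ((k : ℝ) + 1)⁻¹) atTop (𝓝[≠] 0) := by
      refine tendsto_nhdsWithin_iff.2 ⟨?_, Eventually.of_forall fun k => ?_⟩
      · simpa using tendsto_one_div_add_atTop_nhds_zero_nat (𝕜 := ℝ)
      · simp only [mem_compl_iff, mem_singleton_iff, inv_eq_zero]; positivity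
    have h3 := h1.comp h2
    refine h3.congr fun k => ?_
    simp only [Function.comp, inv_inv, Complex.real_smul]
    push_cast; ring
  refine stronglyMeasurable_of_tendsto atTop (f := fun (k : ℕ) (z : ℝ × Eu n) => ((k : ℂ) + 1) *
      (φ (z.1 + ((k : ℝ) + 1)⁻¹) z.2 - φ z.1 z.2)) (fun k => ?_) (tendsto_pi_nhds.2 hlim)
  refine StronglyMeasurable.const_mul (StronglyMeasurable.sub ?_ h.measurable_uncurry) _
  exact h.measurable_uncurry.comp_measurable
    (g := fun z : ℝ × Eu n => (z.1 + ((k : ℝ) + 1)⁻¹, z.2)) (by fun_prop)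

end

section Interp

/-- Closed sets of reals that are unbounded in both directions. -/
structure Spread (K : Set ℝ) : Prop where
  closed : IsClosed K
  lo : ∀ r, ∃ k ∈ K, k ≤ r
  hi : ∀ r, ∃ k ∈ K, r < k

/-- The last point of `K` up to `r`. -/
def lft (K : Set ℝ) (r : ℝ) : ℝ := sSup (K ∩ Iic r)
/-- The first point of `K` from `r` on. -/
def rgt (K : Set ℝ) (r : ℝ) : ℝ := sInf (K ∩ Ici r)
/-- The infimum of the points of `K` beyond `r`. -/
def nxt (K : Set ℝ) (r : ℝ) : ℝ := sInf (K ∩ Ioi r)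

variable {K : Set ℝ}

lemma Spread.lft_mem (h : Spread K) (r : ℝ) : lft K r ∈ K ∩ Iic r :=
  (h.closed.inter isClosed_Iic).csSup_mem (h.lo r) ⟨r, fun _ hx => hx.2⟩

lemma Spread.rgt_mem (h : Spread K) (r : ℝ) : rgt K r ∈ K ∩ Ici r :=
  (h.closed.inter isClosed_Ici).csInf_mem
    (let ⟨k, hk, hr⟩ := h.hi r; ⟨k, hk, hr.le⟩) ⟨r, fun _ hx => hx.2⟩

lemma le_lft {r k : ℝ} (hk : k ∈ K) (hr : k ≤ r) : k ≤ lft K r :=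
  le_csSup ⟨r, fun _ hx => hx.2⟩ ⟨hk, hr⟩

lemma rgt_le {r k : ℝ} (hk : k ∈ K) (hr : r ≤ k) : rgt K r ≤ k :=
  csInf_le ⟨r, fun _ hx => hx.2⟩ ⟨hk, hr⟩

lemma nxt_le {r k : ℝ} (hk : k ∈ K) (hr : r < k) : nxt K r ≤ k :=
  csInf_le ⟨r, fun _ hx => le_of_lt hx.2⟩ ⟨hk, hr⟩

lemma Spread.nxt_mem (h : Spread K) (r : ℝ) : nxt K r ∈ K := by
  have := csInf_mem_closure (s := K ∩ Ioi r) (h.hi r) ⟨r, fun _ hx => le_of_lt hx.2⟩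
  exact h.closed.closure_subset_iff.2 inter_subset_left this

lemma Spread.le_nxt (h : Spread K) (r : ℝ) : r ≤ nxt K r :=
  le_csInf (h.hi r) fun _ hx => le_of_lt hx.2

lemma Spread.monotone_lft (h : Spread K) : Monotone (lft K) := fun _ _ hrs =>
  le_lft (h.lft_mem _).1 ((h.lft_mem _).2.trans hrs)

lemma Spread.monotone_nxt (h : Spread K) : Monotone (nxt K) := fun _ s hrs =>
  le_csInf (h.hi s) fun _ hx => nxt_le hx.1 (hrs.trans_lt hx.2)

lemma lft_of_mem {r : ℝ} (hr : r ∈ K) : lft K r = r :=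
  le_antisymm (csSup_le ⟨r, hr, le_refl r⟩ fun _ hx => hx.2) (le_lft hr le_rfl)

lemma rgt_of_mem {r : ℝ} (hr : r ∈ K) : rgt K r = r :=
  le_antisymm (rgt_le hr le_rfl) (le_csInf ⟨r, hr, le_refl r⟩ fun _ hx => hx.2)

lemma Spread.lft_gap (h : Spread K) {p q r : ℝ} (hp : p ∈ K) (hpq : ∀ x ∈ Ioo p q, x ∉ K)
    (hr : r ∈ Ico p q) : lft K r = p := by
  refine le_antisymm ?_ (le_lft hp hr.1)
  by_contra hc
  exact hpq _ ⟨not_le.1 hc, (h.lft_mem r).2.trans_lt hr.2⟩ (h.lft_mem r).1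

lemma Spread.rgt_gap (h : Spread K) {p q r : ℝ} (hq : q ∈ K) (hpq : ∀ x ∈ Ioo p q, x ∉ K)
    (hr : r ∈ Ioc p q) : rgt K r = q := by
  refine le_antisymm (rgt_le hq hr.2) ?_
  by_contra hc
  exact hpq _ ⟨hr.1.trans_le (h.rgt_mem r).2, not_le.1 hc⟩ (h.rgt_mem r).1

lemma Spread.nxt_gap (h : Spread K) {p q r : ℝ} (hq : q ∈ K) (hpq : ∀ x ∈ Ioo p q, x ∉ K)
    (hr : r ∈ Ico p q) : nxt K r = q := by
  refine le_antisymm (nxt_le hq hr.2) (le_csInf (h.hi r) fun x hx => ?_)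
  by_contra hc
  exact hpq _ ⟨hr.1.trans_lt hx.2, not_le.1 hc⟩ hx.1

lemma gap_of_nxt {r : ℝ} : ∀ x ∈ Ioo (lft K r) (nxt K r), x ∉ K := by
  intro x hx hxK
  rcases le_or_gt x r with hxr | hxr
  · exact absurd (le_lft hxK hxr) (not_le.2 hx.1)
  · exact absurd (nxt_le hxK hxr) (not_le.2 hx.2)

/-- Linear interpolation of `f` over the gaps of `K`. -/
def itp (K : Set ℝ) (f : ℝ → ℂ) (r : ℝ) : ℂ :=
  f (lft K r) + ((r - lft K r) / (rgt K r - lft K r)) • (f (rgt K r) - f (lft K r))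

/-- The right derivative of the interpolation. -/
def ditp (K : Set ℝ) (f f' : ℝ → ℂ) (r : ℝ) : ℂ :=
  if nxt K r = r then f' r else (nxt K r - lft K r)⁻¹ • (f (nxt K r) - f (lft K r))

variable {f f' : ℝ → ℂ}

lemma itp_of_mem {r : ℝ} (hr : r ∈ K) : itp K f r = f r := by
  unfold itp; rw [lft_of_mem hr, rgt_of_mem hr]; simp

lemma Spread.itp_gap (h : Spread K) {p q r : ℝ} (hp : p ∈ K) (hq : q ∈ K) (hlt : p < q)
    (hpq : ∀ x ∈ Ioo p q, x ∉ K) (hr : r ∈ Icc p q) :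
    itp K f r = f p + ((r - p) / (q - p)) • (f q - f p) := by
  rcases hr.1.eq_or_lt with rfl | h1
  · rw [itp_of_mem hp]; simp
  rcases hr.2.eq_or_lt with rfl | h2
  · rw [itp_of_mem hq, div_self (by linarith)]; simp
  · unfold itp
    rw [h.lft_gap hp hpq ⟨h1.le, h2⟩, h.rgt_gap hq hpq ⟨h1, h2.le⟩]

lemma hasDerivAt_chord (p q r : ℝ) (A B : ℂ) :
    HasDerivAt (fun y : ℝ => A + ((y - p) / (q - p)) • B) ((q - p)⁻¹ • B) r := by
  have h1 : HasDerivAt (fun y : ℝ => (y - p) / (q - p)) ((q - p)⁻¹) r := by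
    simpa using ((hasDerivAt_id r).sub_const p).div_const (q - p)
  exact (h1.smul_const B).const_add A

lemma Spread.itp_est (h : Spread K) {r : ℝ} (hr : r ∈ K) {B : ℂ} (hB : HasDerivAt f B r) {ε : ℝ}
    (hε : 0 < ε) : ∃ δ > 0, ∀ y, |lft K y - r| < δ → |rgt K y - r| < δ →
      ‖itp K f y - f r - (y - r) • B‖ ≤ ε * |y - r| := by
  have h1 := (hasDerivAt_iff_isLittleO.1 hB).def hε
  obtain ⟨δ, hδ, h2⟩ := Metric.eventually_nhds_iff.1 h1
  refine ⟨δ, hδ, fun y hl hg => ?_⟩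
  have el := h2 (y := lft K y) (by rwa [Real.dist_eq])
  have eg := h2 (y := rgt K y) (by rwa [Real.dist_eq])
  set p := lft K y with hp
  set q := rgt K y with hq
  have hpy : p ≤ y := (h.lft_mem y).2
  have hyq : y ≤ q := (h.rgt_mem y).2
  rw [Real.norm_eq_abs] at el eg
  rcases hpy.eq_or_lt with hpe | hpl
  · have hyK : y ∈ K := by rw [← hpe]; exact (h.lft_mem y).1
    rw [itp_of_mem hyK]
    rwa [hpe] at el
  have hpq : 0 < q - p := by linarith
  set w := (y - p) / (q - p) with hw
  have hw0 : 0 ≤ w := div_nonneg (by linarith) hpq.le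
  have hw1 : w ≤ 1 := (div_le_one hpq).2 (by linarith)
  have hy : y = (1 - w) * p + w * q := by rw [hw]; field_simp; ring
  have e : itp K f y - f r - (y - r) • B = (1 - w) • (f p - f r - (p - r) • B)
      + w • (f q - f r - (q - r) • B) := by
    have : itp K f y = f p + w • (f q - f p) := rfl
    rw [this]
    have hyc : (y : ℂ) = (1 - w) * p + w * q := by exact_mod_cast congrArg (fun z : ℝ => (z : ℂ)) hy
    simp only [Complex.real_smul]
    push_cast
    rw [hyc]
    ring
  rw [e]
  refine (norm_add_le _ _).trans ?_
  rw [norm_smul, norm_smul, Real.norm_of_nonneg hw0, Real.norm_of_nonneg (by linarith)]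
  have hs : (1 - w) * |p - r| + w * |q - r| = |y - r| := by
    rcases le_total r y with hry | hry
    · have : r ≤ p := le_lft hr hry
      rw [abs_of_nonneg (by linarith), abs_of_nonneg (by linarith), abs_of_nonneg (by linarith)]
      linear_combination -hy
    · have : q ≤ r := rgt_le hr hry
      rw [abs_of_nonpos (by linarith), abs_of_nonpos (by linarith), abs_of_nonpos (by linarith)]
      linear_combination hy
  calc (1 - w) * ‖f p - f r - (p - r) • B‖ + w * ‖f q - f r - (q - r) • B‖
      ≤ (1 - w) * (ε * |p - r|) + w * (ε * |q - r|) := by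
        gcongr
    _ = ε * |y - r| := by rw [← hs]; ring

lemma Spread.hasDerivWithinAt_itp (h : Spread K) (hf : ∀ r, HasDerivAt f (f' r) r) (r : ℝ) :
    HasDerivWithinAt (itp K f) (ditp K f f' r) (Ioi r) r := by
  unfold ditp
  split_ifs with hn
  · have hrK : r ∈ K := hn ▸ h.nxt_mem r
    rw [hasDerivWithinAt_iff_isLittleO, Asymptotics.isLittleO_iff]
    intro ε hε
    obtain ⟨δ, hδ, he⟩ := h.itp_est hrK (hf r) hε
    obtain ⟨k, hk, hkδ⟩ := exists_lt_of_csInf_lt (h.hi r)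
      (show sInf (K ∩ Ioi r) < r + δ by change nxt K r < _; linarith)
    filter_upwards [Ioo_mem_nhdsGT hk.2] with y hy
    have l1 : r ≤ lft K y := le_lft hrK hy.1.le
    have l2 := (h.lft_mem y).2
    have l3 : rgt K y ≤ k := rgt_le hk.1 hy.2.le
    have l4 := (h.rgt_mem y).2
    simp only [mem_Iic, mem_Ici] at l2 l4
    have hy1 := hy.1
    have hy2 := hy.2
    rw [itp_of_mem hrK, Real.norm_eq_abs]
    exact he y (by rw [abs_of_nonneg (by linarith)]; linarith)
      (by rw [abs_of_nonneg (by linarith)]; linarith)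
  · have hlt : r < nxt K r := lt_of_le_of_ne (h.le_nxt r) (Ne.symm hn)
    have hl := (h.lft_mem r).2
    have hlt2 : lft K r < nxt K r := lt_of_le_of_lt hl hlt
    have e : ∀ y ∈ Icc (lft K r) (nxt K r), itp K f y = f (lft K r) +
        ((y - lft K r) / (nxt K r - lft K r)) • (f (nxt K r) - f (lft K r)) := fun y hy =>
      h.itp_gap (h.lft_mem r).1 (h.nxt_mem r) hlt2 gap_of_nxt hy
    refine ((hasDerivAt_chord (lft K r) (nxt K r) r (f (lft K r)) _).hasDerivWithinAt).congr_of_eventuallyEq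
      ?_ (e r ⟨hl, hlt.le⟩)
    filter_upwards [Ioo_mem_nhdsGT hlt] with y hy using e y ⟨le_trans hl hy.1.le, hy.2.le⟩

lemma Spread.continuousWithinAt_Iio_itp (h : Spread K) (hf : ∀ r, HasDerivAt f (f' r) r) (r : ℝ) :
    ContinuousWithinAt (itp K f) (Iio r) r := by
  by_cases hn : ∃ δ > 0, ∀ x ∈ Ioo (r - δ) r, x ∉ K
  · obtain ⟨δ, hδ, hx⟩ := hn
    have hp := h.lft_mem (r - δ / 2)
    have hq := h.rgt_mem r
    simp only [mem_inter_iff, mem_Iic, mem_Ici] at hp hq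
    have hpq : ∀ x ∈ Ioo (lft K (r - δ / 2)) (rgt K r), x ∉ K := by
      intro x hx' hxK
      rcases le_or_gt x (r - δ / 2) with h1 | h1
      · exact absurd (le_lft hxK h1) (not_le.2 hx'.1)
      rcases lt_or_ge x r with h2 | h2
      · exact hx x ⟨by linarith, h2⟩ hxK
      · exact absurd (rgt_le hxK h2) (not_le.2 hx'.2)
    have e : ∀ y ∈ Icc (lft K (r - δ / 2)) (rgt K r), itp K f y = f (lft K (r - δ / 2)) +
        ((y - lft K (r - δ / 2)) / (rgt K r - lft K (r - δ / 2))) •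
          (f (rgt K r) - f (lft K (r - δ / 2))) := fun y hy =>
      h.itp_gap hp.1 hq.1 (by linarith [hp.2, hq.2]) hpq hy
    refine ((hasDerivAt_chord (lft K (r - δ / 2)) (rgt K r) r (f (lft K (r - δ / 2)))
      _).continuousAt.continuousWithinAt).congr_of_eventuallyEq ?_
      (e r ⟨by linarith [hp.2, hq.2], hq.2⟩)
    filter_upwards [Ioo_mem_nhdsLT (show r - δ / 2 < r by linarith)] with y hy
    exact e y ⟨by linarith [hp.2, hy.1], by linarith [hq.2, hy.2]⟩
  · push Not at hn
    have hrK : r ∈ K := by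
      refine h.closed.closure_subset_iff.2 subset_rfl (Metric.mem_closure_iff.2 fun ε hε => ?_)
      obtain ⟨x, hx, hxK⟩ := hn ε hε
      refine ⟨x, hxK, ?_⟩
      rw [Real.dist_eq, abs_of_pos (by linarith [hx.2])]; linarith [hx.1]
    have hd : HasDerivWithinAt (itp K f) (f' r) (Iio r) r := by
      rw [hasDerivWithinAt_iff_isLittleO, Asymptotics.isLittleO_iff]
      intro ε hε
      obtain ⟨δ, hδ, he⟩ := h.itp_est hrK (hf r) hε
      obtain ⟨k, hk, hkK⟩ := hn δ hδ
      filter_upwards [Ioo_mem_nhdsLT hk.2] with y hy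
      have l1 : rgt K y ≤ r := rgt_le hrK hy.2.le
      have l2 := (h.lft_mem y).2
      have l3 : k ≤ lft K y := le_lft hkK hy.1.le
      have l4 := (h.rgt_mem y).2
      simp only [mem_Iic, mem_Ici] at l2 l4
      have hy1 := hy.1
      have hy2 := hy.2
      have hk1 := hk.1
      rw [itp_of_mem hrK, Real.norm_eq_abs]
      exact he y (by rw [abs_of_nonpos (by linarith)]; linarith)
        (by rw [abs_of_nonpos (by linarith)]; linarith)
    exact hd.continuousWithinAt

lemma Spread.continuous_itp (h : Spread K) (hf : ∀ r, HasDerivAt f (f' r) r) :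
    Continuous (itp K f) := by
  rw [continuous_iff_continuousAt]
  intro r
  rw [continuousAt_iff_continuous_left'_right']
  exact ⟨h.continuousWithinAt_Iio_itp hf r, (h.hasDerivWithinAt_itp hf r).continuousWithinAt⟩

/-- Fundamental theorem of calculus for the interpolation. -/
lemma Spread.integral_ditp (h : Spread K) (hf : ∀ r, HasDerivAt f (f' r) r) {s t : ℝ} (hs : s ∈ K)
    (ht : t ∈ K) (hst : s ≤ t) (hi : IntervalIntegrable (ditp K f f') volume s t) :
    ∫ r in s..t, ditp K f f' r = f t - f s := by
  rw [intervalIntegral.integral_eq_sub_of_hasDeriv_right_of_le hst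
    (h.continuous_itp hf).continuousOn (fun r _ => h.hasDerivWithinAt_itp hf r) hi,
    itp_of_mem hs, itp_of_mem ht]

/-- Averaging over gaps does not change the integral. -/
lemma Spread.integral_eq_of_gap_average (h : Spread K) {A G : ℝ → ℂ} {s t : ℝ} (hs : s ∈ K)
    (ht : t ∈ K) (hA : IntegrableOn A (Ico s t)) (hGi : IntegrableOn G (Ico s t))
    (h1 : ∀ r ∈ Ico s t, nxt K r = r → A r = G r)
    (h2 : ∀ p ∈ K ∩ Ico s t, p < nxt K p → ∫ r in Ico p (nxt K p), A r = ∫ r in Ico p (nxt K p), G r) :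
    ∫ r in Ico s t, A r = ∫ r in Ico s t, G r := by
  set I : Set ℝ := {p | p ∈ K ∩ Ico s t ∧ p < nxt K p} with hI
  have hdis : I.PairwiseDisjoint (fun p => Ico p (nxt K p)) := by
    intro p hp q hq hpq
    rcases lt_or_gt_of_ne hpq with hlt | hlt
    · refine Set.disjoint_left.2 fun x hx hx' => ?_
      have := nxt_le hq.1.1 hlt
      exact absurd (hx'.1.trans_lt hx.2) (not_lt.2 this)
    · refine Set.disjoint_left.2 fun x hx hx' => ?_
      have := nxt_le hp.1.1 hlt
      exact absurd (hx.1.trans_lt hx'.2) (not_lt.2 this)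
  have hcount : I.Countable := by
    refine Set.PairwiseDisjoint.countable_of_Ioo (y := nxt K) ?_ fun p hp => hp.2
    exact hdis.mono fun p => Ioo_subset_Ico_self
  set T : Set ℝ := ⋃ p ∈ I, Ico p (nxt K p) with hT
  have hTm : MeasurableSet T := MeasurableSet.biUnion hcount fun _ _ => measurableSet_Ico
  have hTs : T ⊆ Ico s t := by
    refine iUnion₂_subset fun p hp x hx => ⟨hp.1.2.1.trans hx.1, hx.2.trans_le ?_⟩
    exact nxt_le ht hp.1.2.2
  have hdiff : IntegrableOn (fun r => A r - G r) (Ico s t) := hA.sub hGi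
  have hTc : ∀ r ∈ Ico s t \ T, A r - G r = 0 := by
    intro r hr
    refine sub_eq_zero.2 (h1 r hr.1 ?_)
    by_contra hne
    have hlt : r < nxt K r := lt_of_le_of_ne (h.le_nxt r) (Ne.symm hne)
    refine hr.2 (mem_iUnion₂.2 ⟨lft K r, ?_⟩)
    have hl := h.lft_mem r
    have hn : nxt K (lft K r) = nxt K r :=
      h.nxt_gap (h.nxt_mem r) gap_of_nxt ⟨le_rfl, lt_of_le_of_lt hl.2 hlt⟩
    refine ⟨⟨⟨hl.1, le_lft hs hr.1.1, lt_of_le_of_lt hl.2 hr.1.2⟩, ?_⟩, hl.2, ?_⟩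
    · rw [hn]; exact lt_of_le_of_lt hl.2 hlt
    · rw [hn]; exact hlt
  have hTi : ∫ r in T, (A r - G r) = 0 := by
    have := hcount.to_subtype
    rw [hT, biUnion_eq_iUnion, integral_iUnion (fun _ => measurableSet_Ico) ?_ ?_]
    · rw [← tsum_zero (β := I)]
      congr 1
      funext ⟨p, hp⟩
      have hsub : Ico p (nxt K p) ⊆ Ico s t := fun x hx => hTs (mem_iUnion₂.2 ⟨p, hp, hx⟩)
      rw [integral_sub (hA.mono_set hsub) (hGi.mono_set hsub), h2 p hp.1 hp.2, sub_self]
    · intro p q hpq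
      exact hdis p.2 q.2 fun hc => hpq (Subtype.ext hc)
    · rw [← biUnion_eq_iUnion I fun p _ => Ico p (nxt K p)]
      exact hdiff.mono_set hTs
  have := setIntegral_eq_of_subset_of_forall_sdiff_eq_zero (μ := volume) measurableSet_Ico hTs hTc
  have h3 : ∫ r in Ico s t, (A r - G r) = 0 := this.trans hTi
  rw [integral_sub hA hGi] at h3
  exact sub_eq_zero.1 h3

end Interp

section
variable {n : ℕ} {U : Eu n → ℝ} {μ : Measure (Eu n)} {lam : ℝ} {φ : ℝ → Eu n → ℂ} {χ : Eu n → ℝ}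

/-- Test functions divisible by the square of a cutoff. -/
def DivSq (χ : Eu n → ℝ) (η : Eu n → ℂ) : Prop :=
  ∃ v, Smth v ∧ η = fun x => ((χ x ^ 2 : ℝ) : ℂ) * v x

lemma DivSq.test (hχ : IsCut χ) {η : Eu n → ℂ} (h : DivSq χ η) : IsTest η := by
  obtain ⟨v, hv, rfl⟩ := h
  exact hχ.sq_mul_test hv

lemma pdC_pow_mul (hχ : IsCut χ) {v : Eu n → ℂ} (hv : Smth v) (k : ℕ) (j : Fin n) (x : Eu n) :
    pdC n (fun y => ((χ y ^ (k + 1) : ℝ) : ℂ) * v y) j x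
      = ((χ x ^ k : ℝ) : ℂ) * ((χ x : ℂ) * pdC n v j x + (k + 1) * (pdR n χ j x : ℂ) * v x) := by
  have h1 : pdR n (fun y => χ y ^ (k + 1)) j x = (k + 1) * χ x ^ k * pdR n χ j x := by
    unfold pdR
    rw [fderiv_fun_pow _ ((hχ.smooth.differentiable (by simp)) x)]
    simp
  rw [pdC_mul (Smth.ofReal (hχ.smooth.pow (k + 1))) hv, pdC_ofReal (hχ.smooth.pow (k + 1)), h1]
  push_cast; ring

lemma divSq_LopC (hU : ContDiff ℝ (⊤ : ℕ∞) U) (hχ : IsCut χ) {v : Eu n → ℂ} (hv : Smth v) :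
    DivSq χ (LopC n U (fun x => ((χ x ^ 4 : ℝ) : ℂ) * v x)) := by
  set w : Fin n → Eu n → ℂ := fun j x => (χ x : ℂ) * pdC n v j x + ((3 : ℕ) + 1) * (pdR n χ j x : ℂ) * v x
    with hw
  have hc : ∀ j, Smth (fun x => (pdR n χ j x : ℂ)) := fun j => Smth.ofReal (contDiff_pdR hχ.smooth j)
  have hws : ∀ j, Smth (w j) := fun j =>
    (hχ.smth.mul (hv.pdC j)).add ((contDiff_const.mul (hc j)).mul hv)
  refine ⟨fun x => (∑ j, ((χ x : ℂ) * pdC n (w j) j x + ((2 : ℕ) + 1) * (pdR n χ j x : ℂ) * w j x))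
    - ∑ j, (pdR n U j x : ℂ) * ((χ x : ℂ) * w j x), ?_, ?_⟩
  · refine ContDiff.sub (ContDiff.sum fun j _ => ?_) (ContDiff.sum fun j _ => ?_)
    · exact (hχ.smth.mul ((hws j).pdC j)).add ((contDiff_const.mul (hc j)).mul (hws j))
    · exact (Smth.ofReal (contDiff_pdR hU j)).mul (hχ.smth.mul (hws j))
  · funext x
    unfold LopC
    have e1 : ∀ j, pdC n (fun y => ((χ y ^ 4 : ℝ) : ℂ) * v y) j
        = fun y => ((χ y ^ 3 : ℝ) : ℂ) * w j y := fun j => funext fun y => pdC_pow_mul hχ hv 3 j y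
    simp only [e1]
    have e2 : ∀ j, pdC n (fun y => ((χ y ^ 3 : ℝ) : ℂ) * w j y) j x = ((χ x ^ 2 : ℝ) : ℂ) *
      ((χ x : ℂ) * pdC n (w j) j x + ((2 : ℕ) + 1) * (pdR n χ j x : ℂ) * w j x) := fun j =>
      pdC_pow_mul hχ (hws j) 2 j x
    simp only [e2]
    rw [mul_sub, Finset.mul_sum, Finset.mul_sum]
    congr 1
    refine Finset.sum_congr rfl fun j _ => ?_
    push_cast; ring

lemma IsCut.pow4_test (h : IsCut χ) {v : Eu n → ℂ} (hv : Smth v) :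
    IsTest (fun x => ((χ x ^ 4 : ℝ) : ℂ) * v x) :=
  ⟨(Smth.ofReal (h.smooth.pow 4)).mul hv, hcs_of_zero h.hcs fun x hx => by simp [hx]⟩

/-- Quantitative local regularity in weak form. -/
structure Reg (U : Eu n → ℝ) (μ : Measure (Eu n)) (χ : Eu n → ℝ) (N : ℝ) (u : Eu n → ℂ) : Prop where
  one : ∀ η, IsTest η → ‖pair μ u (LopC n U (fun x => ((χ x ^ 2 : ℝ) : ℂ) * η x))‖ ≤ N * √(nsq μ η)
  two : ∀ η, IsTest η → ‖pair μ u (fun x => ((χ x ^ 4 : ℝ) : ℂ) * LopC n U η x)‖ ≤ N * √(nsq μ η)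
  three : ∀ η, IsTest η →
    ‖pair μ u (fun x => ((χ x ^ 4 : ℝ) : ℂ) * LopC n U (LopC n U η) x)‖ ≤ N * √(nsq μ η)

lemma pair_one (hG : Gibbs U μ) (hχ : IsCut χ) {u η : Eu n → ℂ} (hu : Smth u) (hη : IsTest η) :
    pair μ u (LopC n U (fun x => ((χ x ^ 2 : ℝ) : ℂ) * η x))
      = pair μ (fun x => ((χ x ^ 2 : ℝ) : ℂ) * LopC n U u x) η := by
  unfold pair
  rw [← hG.symm hu (hχ.sq_mul_test hη.1)]
  exact integral_congr_ae (Eventually.of_forall fun x => by simp only; ring)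

lemma pair_two (hG : Gibbs U μ) (hχ : IsCut χ) {u η : Eu n → ℂ} (hu : Smth u) (hη : IsTest η) :
    pair μ u (fun x => ((χ x ^ 4 : ℝ) : ℂ) * LopC n U η x)
      = pair μ (LopC n U (fun x => ((χ x ^ 4 : ℝ) : ℂ) * u x)) η := by
  unfold pair
  rw [hG.symm (hχ.pow4_test hu).1 hη]
  exact integral_congr_ae (Eventually.of_forall fun x => by simp only; ring)

lemma pair_three (hG : Gibbs U μ) (hχ : IsCut χ) {u η : Eu n → ℂ} (hu : Smth u) (hη : IsTest η) :
    pair μ u (fun x => ((χ x ^ 4 : ℝ) : ℂ) * LopC n U (LopC n U η) x)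
      = pair μ (LopC n U (LopC n U (fun x => ((χ x ^ 4 : ℝ) : ℂ) * u x))) η := by
  rw [pair_two hG hχ hu (hη.LopC hG.smooth)]
  exact (hG.symm ((hχ.pow4_test hu).LopC hG.smooth).1 hη).symm

lemma exists_reg (hG : Gibbs U μ) (hχ : IsCut χ) {u : Eu n → ℂ} (hu : Smth u) :
    ∃ N : ℕ, Reg U μ χ N u := by
  have t1 := hχ.sq_mul_test (hu.LopC hG.smooth)
  have t2 := (hχ.pow4_test hu).LopC hG.smooth
  have t3 := t2.LopC hG.smooth
  set a1 := √(nsq μ (fun x => ((χ x ^ 2 : ℝ) : ℂ) * LopC n U u x))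
  set a2 := √(nsq μ (LopC n U (fun x => ((χ x ^ 4 : ℝ) : ℂ) * u x)))
  set a3 := √(nsq μ (LopC n U (LopC n U (fun x => ((χ x ^ 4 : ℝ) : ℂ) * u x))))
  obtain ⟨N, hN⟩ := exists_nat_ge (max a1 (max a2 a3))
  have l1 : a1 ≤ N := (le_max_left _ _).trans hN
  have l2 : a2 ≤ N := ((le_max_left _ _).trans (le_max_right _ _)).trans hN
  have l3 : a3 ≤ N := ((le_max_right _ _).trans (le_max_right _ _)).trans hN
  have key : ∀ {w η : Eu n → ℂ}, IsTest w → IsTest η → √(nsq μ w) ≤ N →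
      ‖pair μ w η‖ ≤ N * √(nsq μ η) := fun {w η} hw hη hl =>
    (norm_pair_le hw.cont hη.cont (hw.nsq_integrable hG) (hη.nsq_integrable hG)).trans (by gcongr)
  refine ⟨N, fun η hη => ?_, fun η hη => ?_, fun η hη => ?_⟩
  · rw [pair_one hG hχ hu hη]; exact key t1 hη l1
  · rw [pair_two hG hχ hu hη]; exact key t2 hη l2
  · rw [pair_three hG hχ hu hη]; exact key t3 hη l3

lemma pair_conj_self (w : Eu n → ℂ) : pair μ w (fun x => conj (w x)) = (nsq μ w : ℂ) := by
  unfold pair nsq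
  rw [← integral_complex_ofReal]
  refine integral_congr_ae (Eventually.of_forall fun x => ?_)
  simp only [Complex.mul_conj, Complex.normSq_eq_norm_sq]

lemma nsq_conj (w : Eu n → ℂ) : nsq μ (fun x => conj (w x)) = nsq μ w := by
  unfold nsq; simp

lemma sqrt_nsq_le_of_pair {w : Eu n → ℂ} (hw : IsTest w) {N : ℝ} (hN : 0 ≤ N)
    (h : ∀ η, IsTest η → ‖pair μ w η‖ ≤ N * √(nsq μ η)) : √(nsq μ w) ≤ N := by
  have h1 := h _ hw.conj
  rw [pair_conj_self, nsq_conj, Complex.norm_real, Real.norm_of_nonneg (nsq_nonneg _)] at h1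
  nth_rewrite 1 [← Real.mul_self_sqrt (nsq_nonneg (μ := μ) w)] at h1
  rcases (Real.sqrt_nonneg (nsq μ w)).eq_or_lt with h0 | h0
  · rw [← h0]; exact hN
  · exact le_of_mul_le_mul_right h1 h0

lemma Reg.sqrt_one (hG : Gibbs U μ) (hχ : IsCut χ) {u : Eu n → ℂ} (hu : Smth u) {N : ℝ} (hN : 0 ≤ N)
    (h : Reg U μ χ N u) : √(nsq μ (fun x => ((χ x ^ 2 : ℝ) : ℂ) * LopC n U u x)) ≤ N :=
  sqrt_nsq_le_of_pair (hχ.sq_mul_test (hu.LopC hG.smooth)) hN fun η hη => by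
    rw [← pair_one hG hχ hu hη]; exact h.one η hη

lemma Reg.sqrt_two (hG : Gibbs U μ) (hχ : IsCut χ) {u : Eu n → ℂ} (hu : Smth u) {N : ℝ} (hN : 0 ≤ N)
    (h : Reg U μ χ N u) : √(nsq μ (LopC n U (fun x => ((χ x ^ 4 : ℝ) : ℂ) * u x))) ≤ N :=
  sqrt_nsq_le_of_pair ((hχ.pow4_test hu).LopC hG.smooth) hN fun η hη => by
    rw [← pair_two hG hχ hu hη]; exact h.two η hη

lemma Reg.sqrt_three (hG : Gibbs U μ) (hχ : IsCut χ) {u : Eu n → ℂ} (hu : Smth u) {N : ℝ} (hN : 0 ≤ N)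
    (h : Reg U μ χ N u) : √(nsq μ (LopC n U (LopC n U (fun x => ((χ x ^ 4 : ℝ) : ℂ) * u x)))) ≤ N :=
  sqrt_nsq_le_of_pair (((hχ.pow4_test hu).LopC hG.smooth).LopC hG.smooth) hN fun η hη => by
    rw [← pair_three hG hχ hu hη]; exact h.three η hη

lemma LSE.isClosed_reg (hG : Gibbs U μ) (h : LSE U μ lam φ) (hχ : IsCut χ) {a b C : ℝ}
    (hB : Bd μ φ a b C) (N : ℝ) : IsClosed {r | r ∈ Icc a b ∧ Reg U μ χ N (φ r)} := by
  refine IsSeqClosed.isClosed fun r t hr ht => ?_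
  have htI : t ∈ Icc a b := isClosed_Icc.mem_of_tendsto ht (Eventually.of_forall fun k => (hr k).1)
  have hT : ∀ {η : Eu n → ℂ} {c : ℝ}, IsTest η → (∀ k, ‖pair μ (φ (r k)) η‖ ≤ c) →
      ‖pair μ (φ t) η‖ ≤ c := by
    intro η c hη hc
    have h1 := h.tendsto_pair hG (S := Icc a b) (fun r hr => (hB r hr).1) hη t
    have h2 : Tendsto r atTop (𝓝[Icc a b] t) :=
      tendsto_nhdsWithin_iff.2 ⟨ht, Eventually.of_forall fun k => (hr k).1⟩
    exact le_of_tendsto (h1.comp h2).norm (Eventually.of_forall hc)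
  refine ⟨htI, fun η hη => hT ?_ fun k => (hr k).2.one η hη,
    fun η hη => hT ?_ fun k => (hr k).2.two η hη, fun η hη => hT ?_ fun k => (hr k).2.three η hη⟩
  · exact (hχ.sq_mul_test hη.1).LopC hG.smooth
  · exact hχ.pow4_test (hη.LopC hG.smooth).1
  · exact hχ.pow4_test ((hη.LopC hG.smooth).LopC hG.smooth).1

lemma sqrt_nsq_sub_le {f g : Eu n → ℂ} (hf : Continuous f) (hg : Continuous g)
    (hf2 : Integrable (fun x => ‖f x‖ ^ 2) μ) (hg2 : Integrable (fun x => ‖g x‖ ^ 2) μ) {N : ℝ}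
    (hN : 0 ≤ N) (h1 : √(nsq μ f) ≤ N) (h2 : √(nsq μ g) ≤ N) :
    √(nsq μ (fun x => f x - g x)) ≤ 2 * N := by
  have h3 := integral_sub_sq_le hf.aestronglyMeasurable hg.aestronglyMeasurable hf2 hg2
  rw [Real.sqrt_le_left hN] at h1 h2
  rw [Real.sqrt_le_left (by positivity)]
  unfold nsq at *
  nlinarith

lemma le_of_sq_le_gap {X l c1 c2 : ℝ} (hl : 0 ≤ l) (h1 : 0 ≤ c1) (h2 : 0 ≤ c2)
    (h : X ^ 2 ≤ l * (c1 * X + c2 * l)) : X ≤ (c1 + c2 + 1) * l := by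
  by_contra hc
  push Not at hc
  have hlX : l ≤ X := by nlinarith [mul_nonneg h1 hl, mul_nonneg h2 hl]
  have hX : 0 < X := by nlinarith [mul_nonneg h1 hl, mul_nonneg h2 hl]
  nlinarith [mul_lt_mul_of_pos_right hc hX, mul_le_mul_of_nonneg_left hlX (mul_nonneg h2 hl),
    mul_nonneg hl hX.le]

/-- Across a gap on which the fundamental theorem holds, the solution is Lipschitz. -/
lemma LSE.gap_bound (hG : Gibbs U μ) (h : LSE U μ lam φ) (hχ : IsCut χ) {a b C : ℝ}
    (hB : Bd μ φ a b C) {N : ℝ} (hN : 0 ≤ N) : ∃ M : ℝ, 0 ≤ M ∧ ∀ p q, p ∈ Icc a b → q ∈ Icc a b →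
      p < q → Reg U μ χ N (φ p) → Reg U μ χ N (φ q) →
      (∀ η, DivSq χ η → ∀ r ∈ Icc p q, defect μ φ a η r = defect μ φ a η p) →
      √(nsq μ (fun x => ((χ x ^ 2 : ℝ) : ℂ) * (φ q x - φ p x))) ≤ M * (q - p) := by
  obtain ⟨A, hA0, hA⟩ := h.exists_pair_dt_bound hG hB (K := tsupport χ) hχ.hcs
  set c2 := √C * (2 * N) + A * (2 * N) with hc2
  refine ⟨(N + A) + c2 + 1, by positivity, fun p q hp hq hpq rp rq hd => ?_⟩
  have hsub : ∀ r ∈ Icc p q, r ∈ Icc a b := fun r hr => ⟨hp.1.trans hr.1, hr.2.trans hq.2⟩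
  have hus : Smth (fun x => φ q x - φ p x) := (h.smth q).sub (h.smth p)
  set u : Eu n → ℂ := fun x => φ q x - φ p x with hu
  set η : Eu n → ℂ := fun x => ((χ x ^ 4 : ℝ) : ℂ) * conj (u x) with hη
  have hηt : IsTest η := hχ.pow4_test hus.conj
  have hηc : η = fun x => conj (((χ x ^ 4 : ℝ) : ℂ) * u x) := by
    funext x; simp [hη]
  have hηD : DivSq χ η := ⟨fun x => ((χ x ^ 2 : ℝ) : ℂ) * conj (u x), hχ.sq_smth.mul hus.conj, by
    funext x; simp only [hη]; push_cast; ring⟩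
  have hLD : DivSq χ (LopC n U η) := divSq_LopC hG.smooth hχ hus.conj
  have hLt := hηt.LopC hG.smooth
  have hLLt := hLt.LopC hG.smooth
  have zero_out : ∀ {ζ : Eu n → ℂ}, DivSq χ ζ → ∀ x, x ∉ tsupport χ → ζ x = 0 := by
    rintro ζ ⟨v, -, rfl⟩ x hx
    simp [image_eq_zero_of_notMem_tsupport hx]
  have p4 : ∀ r, IsTest (fun x => ((χ x ^ 4 : ℝ) : ℂ) * φ r x) := fun r => hχ.pow4_test (h.smth r)
  have eu : (fun x => ((χ x ^ 4 : ℝ) : ℂ) * u x)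
      = fun x => ((χ x ^ 4 : ℝ) : ℂ) * φ q x - ((χ x ^ 4 : ℝ) : ℂ) * φ p x := by
    funext x; simp only [hu]; ring
  have eL : LopC n U (fun x => ((χ x ^ 4 : ℝ) : ℂ) * u x)
      = fun x => LopC n U (fun x => ((χ x ^ 4 : ℝ) : ℂ) * φ q x) x
        - LopC n U (fun x => ((χ x ^ 4 : ℝ) : ℂ) * φ p x) x := by
    rw [eu]; funext x; exact LopC_sub (p4 q).1 (p4 p).1 x
  have eLη : LopC n U η = fun x => conj (LopC n U (fun x => ((χ x ^ 4 : ℝ) : ℂ) * u x) x) := by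
    rw [hηc]; funext x; exact LopC_conj _ x
  have nL : √(nsq μ (LopC n U η)) ≤ 2 * N := by
    rw [eLη, nsq_conj, eL]
    have tq := (p4 q).LopC hG.smooth
    have tp := (p4 p).LopC hG.smooth
    exact sqrt_nsq_sub_le tq.cont tp.cont (tq.nsq_integrable hG) (tp.nsq_integrable hG) hN
      (rq.sqrt_two hG hχ (h.smth q) hN) (rp.sqrt_two hG hχ (h.smth p) hN)
  have nLL : √(nsq μ (LopC n U (LopC n U η))) ≤ 2 * N := by
    have e3 : LopC n U (LopC n U η) = fun x => conj (LopC n U (LopC n U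
        (fun x => ((χ x ^ 4 : ℝ) : ℂ) * u x)) x) := by
      rw [eLη]; funext x; exact LopC_conj _ x
    have tq := (p4 q).LopC hG.smooth
    have tp := (p4 p).LopC hG.smooth
    have e4 : LopC n U (LopC n U (fun x => ((χ x ^ 4 : ℝ) : ℂ) * u x))
      = fun x => LopC n U (LopC n U (fun x => ((χ x ^ 4 : ℝ) : ℂ) * φ q x)) x
        - LopC n U (LopC n U (fun x => ((χ x ^ 4 : ℝ) : ℂ) * φ p x)) x := by
      rw [eL]; funext x; exact LopC_sub tq.1 tp.1 x
    rw [e3, nsq_conj, e4]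
    have tq := tq.LopC hG.smooth
    have tp := tp.LopC hG.smooth
    exact sqrt_nsq_sub_le tq.cont tp.cont (tq.nsq_integrable hG) (tp.nsq_integrable hG) hN
      (rq.sqrt_three hG hχ (h.smth q) hN) (rp.sqrt_three hG hχ (h.smth p) hN)
  have hftc : ∀ ζ, DivSq χ ζ → ∀ r ∈ Icc p q, pair μ (φ r) ζ - pair μ (φ p) ζ
      = ∫ y in p..r, pair μ (dt φ y) ζ := by
    intro ζ hζ r hr
    have := h.defect_sub hG hB (hζ.test hχ) hp (hsub r hr)
    rw [hd ζ hζ r hr, sub_self] at this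
    exact (sub_eq_zero.1 this.symm)
  set X := √(nsq μ (fun x => ((χ x ^ 2 : ℝ) : ℂ) * u x)) with hX
  have tX : IsTest (fun x => ((χ x ^ 2 : ℝ) : ℂ) * u x) := hχ.sq_mul_test hus
  have nη : √(nsq μ η) ≤ X := by
    refine Real.sqrt_le_sqrt (integral_mono (hηt.nsq_integrable hG) (tX.nsq_integrable hG) fun x => ?_)
    simp only [hη, norm_mul, Complex.norm_real, Complex.norm_conj, norm_pow, mul_pow]
    have h01 : ‖χ x‖ ≤ 1 := by
      rw [Real.norm_of_nonneg (hχ.nonneg x)]; exact hχ.le_one x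
    have : (‖χ x‖ ^ 4) ^ 2 ≤ (‖χ x‖ ^ 2) ^ 2 := by
      rw [← pow_mul, ← pow_mul]
      exact pow_le_pow_of_le_one (norm_nonneg _) h01 (by norm_num)
    gcongr
  -- bound of the second increment
  have gL : ∀ r ∈ Icc p q, ‖pair μ (dt φ r) (LopC n U η)‖ ≤ c2 := by
    intro r hr
    refine ((hA r (hsub r hr) _ hLt (zero_out hLD)).2.2.1).trans ?_
    have h1 := norm_pair_le (h.smth r).cont hLLt.cont (h.mass r) (hLLt.nsq_integrable hG)
    have h2 : √(nsq μ (φ r)) ≤ √C := Real.sqrt_le_sqrt (hB r (hsub r hr)).1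
    rw [hc2]
    have h3 : √(nsq μ (φ r)) * √(nsq μ (LopC n U (LopC n U η))) ≤ √C * (2 * N) := by gcongr
    have h4 : A * √(nsq μ (LopC n U η)) ≤ A * (2 * N) := by gcongr
    linarith
  have gη : ∀ r ∈ Icc p q, ‖pair μ (dt φ r) η‖ ≤ (N + A) * X + c2 * (q - p) := by
    intro r hr
    refine ((hA r (hsub r hr) _ hηt (zero_out hηD)).2.2.1).trans ?_
    have h1 : pair μ (φ r) (LopC n U η) = pair μ (φ p) (LopC n U η)
        + ∫ y in p..r, pair μ (dt φ y) (LopC n U η) := by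
      rw [← hftc _ hLD r hr]; ring
    have h2 : ‖∫ y in p..r, pair μ (dt φ y) (LopC n U η)‖ ≤ c2 * (q - p) := by
      refine (intervalIntegral.norm_integral_le_of_norm_le_const (C := c2) fun y hy => ?_).trans ?_
      · rw [Set.uIoc_of_le hr.1] at hy
        exact gL y ⟨hy.1.le, hy.2.trans hr.2⟩
      · rw [abs_of_nonneg (by linarith [hr.1])]
        have : 0 ≤ c2 := by positivity
        gcongr
        exact hr.2
    have h3 : ‖pair μ (φ p) (LopC n U η)‖ ≤ N * X := by
      have := rp.one _ tX.conj
      rw [nsq_conj] at this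
      convert this using 4
      funext x; simp only [hη]; push_cast; simp; ring
    have h4 : A * √(nsq μ η) ≤ A * X := by gcongr
    rw [h1]
    have := norm_add_le (pair μ (φ p) (LopC n U η)) (∫ y in p..r, pair μ (dt φ y) (LopC n U η))
    linarith
  have hX2 : X ^ 2 = ‖pair μ (φ q) η - pair μ (φ p) η‖ := by
    have e1 : pair μ (φ q) η - pair μ (φ p) η = ((X ^ 2 : ℝ) : ℂ) := by
      unfold pair
      rw [← integral_sub (hG.integrable_mul (h.smth q).cont hηt)
        (hG.integrable_mul (h.smth p).cont hηt), hX, Real.sq_sqrt (nsq_nonneg _), ← pair_conj_self]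
      refine integral_congr_ae (Eventually.of_forall fun x => ?_)
      simp only [hη, hu, map_mul, Complex.conj_ofReal]; push_cast; ring
    rw [e1, Complex.norm_real, Real.norm_of_nonneg (by positivity)]
  refine le_of_sq_le_gap (by linarith) (by positivity) (by positivity) ?_
  rw [hX2, hftc η hηD q ⟨hpq.le, le_rfl⟩]
  refine (intervalIntegral.norm_integral_le_of_norm_le_const fun y hy => ?_).trans
    (le_of_eq (?_ : ((N + A) * X + c2 * (q - p)) * |q - p| = _))
  · rw [Set.uIoc_of_le hpq.le] at hy
    exact gη y ⟨hy.1.le, hy.2⟩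
  · rw [abs_of_pos (by linarith)]; ring

end

section
variable {n : ℕ} {U : Eu n → ℝ} {μ : Measure (Eu n)} {lam : ℝ} {φ : ℝ → Eu n → ℂ} {χ : Eu n → ℝ}

lemma integral_norm_le_nsq_add_one [IsProbabilityMeasure μ] {f : Eu n → ℂ} (hf : Continuous f)
    (h2 : Integrable (fun x => ‖f x‖ ^ 2) μ) : ∫ x, ‖f x‖ ∂μ ≤ nsq μ f + 1 := by
  have e : nsq μ f + 1 = ∫ x, (‖f x‖ ^ 2 + 1) ∂μ := by
    rw [integral_add h2 (integrable_const 1)]; simp [nsq]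
  rw [e]
  refine integral_mono (integrable_norm_of_sq hf.aestronglyMeasurable h2).norm
    (h2.add (integrable_const 1)) fun x => ?_
  simp only
  nlinarith [sq_nonneg (‖f x‖ - 1)]

lemma LSE.continuous_dt (hG : Gibbs U μ) (h : LSE U μ lam φ) (r : ℝ) : Continuous (dt φ r) := by
  have e : dt φ r = fun x => Complex.I * LopC n U (φ r) x - Complex.I * lam * nl (φ r x)
      + Complex.I * lam * kap μ φ r * φ r x := funext fun x => h.dt_eq hG r x
  rw [e]
  exact ((continuous_const.mul ((h.smth r).LopC hG.smooth).cont).sub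
    (continuous_const.mul (continuous_nl_comp (h.smth r)))).add (continuous_const.mul (h.smth r).cont)

lemma LSE.exists_dt_bound_reg (hG : Gibbs U μ) (h : LSE U μ lam φ) (hχ : IsCut χ) {a b C : ℝ}
    (hB : Bd μ φ a b C) {N : ℝ} (hN : 0 ≤ N) : ∃ M : ℝ, 0 ≤ M ∧ ∀ r ∈ Icc a b,
      Reg U μ χ N (φ r) → ∫ x, ‖((χ x ^ 2 : ℝ) : ℂ) * dt φ r x‖ ∂μ ≤ M := by
  have := hG.prob
  have hK : IsCompact (tsupport χ) := hχ.hcs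
  obtain ⟨C', hC'0, hC'⟩ := hG.exists_local_log hK C
  refine ⟨(N ^ 2 + 1) + |lam| * (C' + 1) + |lam| * |C| * (|C| + 1), by positivity,
    fun r hr hreg => ?_⟩
  obtain ⟨hm, he, hk⟩ := hB r hr
  have t1 : IsTest (fun x => ((χ x ^ 2 : ℝ) : ℂ) * LopC n U (φ r) x) :=
    hχ.sq_mul_test ((h.smth r).LopC hG.smooth)
  have b1 : ∫ x, ‖((χ x ^ 2 : ℝ) : ℂ) * LopC n U (φ r) x‖ ∂μ ≤ N ^ 2 + 1 := by
    refine (integral_norm_le_nsq_add_one t1.cont (t1.nsq_integrable hG)).trans ?_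
    have := hreg.sqrt_one hG hχ (h.smth r) hN
    rw [Real.sqrt_le_left hN] at this
    linarith
  have cχ : Continuous (fun x => ((χ x ^ 2 : ℝ) : ℂ)) := hχ.sq_smth.cont
  have nχ : ∀ x, ‖((χ x ^ 2 : ℝ) : ℂ)‖ ≤ 1 := fun x => by
    rw [Complex.norm_real, Real.norm_of_nonneg (by positivity)]; exact hχ.sq_le_one x
  have c2 : Continuous (fun x => ((χ x ^ 2 : ℝ) : ℂ) * nl (φ r x)) :=
    cχ.mul (continuous_nl_comp (h.smth r))
  have z2 : ∀ x, x ∉ tsupport χ → ((χ x ^ 2 : ℝ) : ℂ) * nl (φ r x) = 0 := fun x hx => by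
    simp [image_eq_zero_of_notMem_tsupport hx]
  have i2 : Integrable (fun x => ‖((χ x ^ 2 : ℝ) : ℂ) * nl (φ r x)‖) μ :=
    (c2.integrable_of_hasCompactSupport (hcs_of_zero hχ.hcs fun x hx => by simp [hx])).norm
  have b2 : ∫ x, ‖((χ x ^ 2 : ℝ) : ℂ) * nl (φ r x)‖ ∂μ ≤ C' + 1 := by
    rw [← setIntegral_eq_integral_of_forall_compl_eq_zero (s := tsupport χ) fun x hx => by
      rw [z2 x hx, norm_zero]]
    have cn : Continuous (fun x => ‖nl (φ r x)‖ ^ 2) := (continuous_nl_comp (h.smth r)).norm.pow 2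
    have iK : IntegrableOn (fun x => ‖nl (φ r x)‖ ^ 2) (tsupport χ) μ :=
      cn.continuousOn.integrableOn_compact hK
    have e : ∫ x in tsupport χ, (‖nl (φ r x)‖ ^ 2 + 1) ∂μ
        = (∫ x in tsupport χ, ‖nl (φ r x)‖ ^ 2 ∂μ) + μ.real (tsupport χ) := by
      rw [integral_add iK (integrable_const 1)]; simp
    have e2 := hC' (φ r) (h.smth r) (h.mass r) (h.grad r) hm he
    have e3 : μ.real (tsupport χ) ≤ 1 := measureReal_le_one
    refine (integral_mono i2.integrableOn (iK.add (integrable_const 1)) fun x => ?_).trans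
      (e.le.trans (by linarith))
    simp only [Pi.add_apply, norm_mul]
    nlinarith [sq_nonneg (‖nl (φ r x)‖ - 1), mul_le_mul_of_nonneg_right (nχ x) (norm_nonneg (nl (φ r x)))]
  have t3 : IsTest (fun x => ((χ x ^ 2 : ℝ) : ℂ) * φ r x) := hχ.sq_mul_test (h.smth r)
  have b3 : ∫ x, ‖((χ x ^ 2 : ℝ) : ℂ) * φ r x‖ ∂μ ≤ |C| + 1 := by
    refine (integral_norm_le_nsq_add_one t3.cont (t3.nsq_integrable hG)).trans ?_
    have : nsq μ (fun x => ((χ x ^ 2 : ℝ) : ℂ) * φ r x) ≤ nsq μ (φ r) := by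
      refine integral_mono (t3.nsq_integrable hG) (h.mass r) fun x => ?_
      simp only [norm_mul, mul_pow]
      have := pow_le_one₀ (n := 2) (norm_nonneg _) (nχ x)
      nlinarith [sq_nonneg ‖φ r x‖]
    linarith [le_abs_self C]
  have i1 : Integrable (fun x => ‖((χ x ^ 2 : ℝ) : ℂ) * LopC n U (φ r) x‖) μ :=
    (t1.cont.integrable_of_hasCompactSupport t1.2).norm
  have i3 : Integrable (fun x => ‖((χ x ^ 2 : ℝ) : ℂ) * φ r x‖) μ :=
    (t3.cont.integrable_of_hasCompactSupport t3.2).norm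
  have i12 : Integrable (fun x => ‖((χ x ^ 2 : ℝ) : ℂ) * LopC n U (φ r) x‖
      + |lam| * ‖((χ x ^ 2 : ℝ) : ℂ) * nl (φ r x)‖) μ := i1.add (i2.const_mul _)
  have i4 : Integrable (fun x => ‖((χ x ^ 2 : ℝ) : ℂ) * LopC n U (φ r) x‖
      + |lam| * ‖((χ x ^ 2 : ℝ) : ℂ) * nl (φ r x)‖
      + |lam| * |kap μ φ r| * ‖((χ x ^ 2 : ℝ) : ℂ) * φ r x‖) μ := i12.add (i3.const_mul _)
  have hd : Integrable (fun x => ‖((χ x ^ 2 : ℝ) : ℂ) * dt φ r x‖) μ :=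
    ((cχ.mul (h.continuous_dt hG r)).integrable_of_hasCompactSupport
      (hcs_of_zero hχ.hcs fun x hx => by simp [hx])).norm
  refine (integral_mono hd i4 fun x => ?_).trans ?_
  · dsimp only
    rw [h.dt_eq hG, show ((χ x ^ 2 : ℝ) : ℂ) * (Complex.I * LopC n U (φ r) x
      - Complex.I * lam * nl (φ r x) + Complex.I * lam * kap μ φ r * φ r x)
      = Complex.I * (((χ x ^ 2 : ℝ) : ℂ) * LopC n U (φ r) x)
        - Complex.I * lam * (((χ x ^ 2 : ℝ) : ℂ) * nl (φ r x))
        + Complex.I * lam * kap μ φ r * (((χ x ^ 2 : ℝ) : ℂ) * φ r x) by ring]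
    refine (norm_add_le _ _).trans (add_le_add ((norm_sub_le _ _).trans (le_of_eq ?_)) (le_of_eq ?_))
    · rw [norm_mul, norm_mul (Complex.I * lam), norm_mul Complex.I]; simp
    · rw [norm_mul, norm_mul (Complex.I * lam), norm_mul Complex.I]; simp
  · rw [integral_add i12 (i3.const_mul _), integral_add i1 (i2.const_mul _), integral_const_mul,
      integral_const_mul]
    have hkC : |kap μ φ r| ≤ |C| := hk.trans (le_abs_self C)
    have h0 : 0 ≤ ∫ x, ‖((χ x ^ 2 : ℝ) : ℂ) * φ r x‖ ∂μ := integral_nonneg fun x => norm_nonneg _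
    gcongr

lemma spread_of_isClosed {K : Set ℝ} (hK : IsClosed K) {s t : ℝ} :
    Spread ((K ∩ Icc s t) ∪ Iic s ∪ Ici t) where
  closed := ((hK.inter isClosed_Icc).union isClosed_Iic).union isClosed_Ici
  lo r := ⟨min r s, Or.inl (Or.inr (mem_Iic.2 (min_le_right _ _))), min_le_left _ _⟩
  hi r := ⟨max (r + 1) t, Or.inr (mem_Ici.2 (le_max_right _ _)), lt_of_lt_of_le (by linarith) (le_max_left _ _)⟩

lemma LSE.measurable_ditp (h : LSE U μ lam φ) {K : Set ℝ} (hK : Spread K) :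
    StronglyMeasurable (fun z : ℝ × Eu n => ditp K (fun r => φ r z.2) (fun r => dt φ r z.2) z.1) := by
  have m1 := hK.monotone_lft.measurable
  have m2 := hK.monotone_nxt.measurable
  unfold ditp
  refine StronglyMeasurable.ite (measurableSet_eq_fun (m2.comp measurable_fst) measurable_fst)
    h.measurable_dt ?_
  refine StronglyMeasurable.smul (f := fun z : ℝ × Eu n => (nxt K z.1 - lft K z.1)⁻¹) ?_ ?_
  · exact ((m2.comp measurable_fst).sub (m1.comp measurable_fst)).inv.stronglyMeasurable
  · exact (h.measurable_uncurry.comp_measurable ((m2.comp measurable_fst).prodMk measurable_snd)).sub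
      (h.measurable_uncurry.comp_measurable ((m1.comp measurable_fst).prodMk measurable_snd))

/-- On a closed set of uniformly regular times, the fundamental theorem propagates across it. -/
lemma LSE.defect_eq_of_reg (hG : Gibbs U μ) (h : LSE U μ lam φ) (hχ : IsCut χ) {a b C : ℝ}
    (hB : Bd μ φ a b C) {N : ℝ} (hN : 0 ≤ N) {K : Set ℝ} (hK : IsClosed K) {s t : ℝ}
    (hs : s ∈ Icc a b) (ht : t ∈ Icc a b) (hst : s ≤ t) (hsK : s ∈ K) (htK : t ∈ K)
    (hreg : ∀ r ∈ K ∩ Icc s t, Reg U μ χ N (φ r))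
    (hgap : ∀ p q, s ≤ p → p ≤ q → q ≤ t → (∀ x ∈ Ioo p q, x ∉ K) → ∀ η, DivSq χ η →
      defect μ φ a η q = defect μ φ a η p) {η : Eu n → ℂ} (hη : DivSq χ η) :
    defect μ φ a η t = defect μ φ a η s := by
  have := hG.prob
  set L : Set ℝ := (K ∩ Icc s t) ∪ Iic s ∪ Ici t with hL
  have hS : Spread L := spread_of_isClosed hK
  have hsL : s ∈ L := Or.inl (Or.inr (le_refl s))
  have htL : t ∈ L := Or.inr (le_refl t)
  have toK : ∀ r ∈ L, r ∈ Icc s t → r ∈ K ∩ Icc s t := by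
    rintro r ((hr | hr) | hr) hI
    · exact hr
    · rw [show r = s from le_antisymm hr hI.1]; exact ⟨hsK, le_rfl, hst⟩
    · rw [show r = t from le_antisymm hI.2 hr]; exact ⟨htK, hst, le_rfl⟩
  have hsub : ∀ r ∈ Icc s t, r ∈ Icc a b := fun r hr => ⟨hs.1.trans hr.1, hr.2.trans ht.2⟩
  have hlI : ∀ r ∈ Ico s t, lft L r ∈ Icc s t := fun r hr =>
    ⟨le_lft hsL hr.1, (show lft L r ≤ r from (hS.lft_mem r).2).trans hr.2.le⟩
  have hnI : ∀ r ∈ Ico s t, nxt L r ∈ Icc s t := fun r hr =>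
    ⟨hr.1.trans (hS.le_nxt r), nxt_le htL hr.2⟩
  have hgp : ∀ p q, s ≤ p → p ≤ q → q ≤ t → (∀ x ∈ Ioo p q, x ∉ L) → ∀ η, DivSq χ η →
      ∀ r ∈ Icc p q, defect μ φ a η r = defect μ φ a η p := by
    intro p q hp hpq hq hx η hη r hr
    refine hgap p r hp hr.1 (hr.2.trans hq) (fun x hxI hxK => ?_) η hη
    exact hx x ⟨hxI.1, hxI.2.trans_le hr.2⟩
      (Or.inl (Or.inl ⟨hxK, hp.trans hxI.1.le, (hxI.2.trans_le (hr.2.trans hq)).le⟩))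
  obtain ⟨M1, hM10, hM1⟩ := h.exists_dt_bound_reg hG hχ hB hN
  obtain ⟨M2, hM20, hM2⟩ := h.gap_bound hG hχ hB hN
  set D : ℝ → Eu n → ℂ := fun r x => ditp L (fun r => φ r x) (fun r => dt φ r x) r with hD
  have D1 : ∀ r, nxt L r = r → D r = dt φ r := fun r hr => by
    funext x; simp only [hD, ditp, if_pos hr]
  have D2 : ∀ r, nxt L r ≠ r → D r = fun x => (nxt L r - lft L r)⁻¹ • (φ (nxt L r) x - φ (lft L r) x) :=
    fun r hr => by funext x; simp only [hD, ditp, if_neg hr]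
  have Dc : ∀ r, Continuous (D r) := by
    intro r
    by_cases hr : nxt L r = r
    · rw [D1 r hr]; exact h.continuous_dt hG r
    · rw [D2 r hr]; 
      exact (continuous_const (y := (nxt L r - lft L r)⁻¹)).smul
        ((h.smth (nxt L r)).cont.sub (h.smth (lft L r)).cont)
  have cχ : Continuous (fun x => ((χ x ^ 2 : ℝ) : ℂ)) := hχ.sq_smth.cont
  have Dcs : ∀ r, HasCompactSupport (fun x => ((χ x ^ 2 : ℝ) : ℂ) * D r x) := fun r =>
    hcs_of_zero hχ.hcs fun x hx => by simp [hx]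
  have Di : ∀ r, Integrable (fun x => ((χ x ^ 2 : ℝ) : ℂ) * D r x) μ := fun r =>
    (cχ.mul (Dc r)).integrable_of_hasCompactSupport (Dcs r)
  have Db : ∀ r ∈ Ico s t, ∫ x, ‖((χ x ^ 2 : ℝ) : ℂ) * D r x‖ ∂μ ≤ M1 + (M2 ^ 2 + 1) := by
    intro r hr
    by_cases hn : nxt L r = r
    · have hrL : r ∈ L := hn ▸ hS.nxt_mem r
      rw [D1 r hn]
      have := hM1 r (hsub r ⟨hr.1, hr.2.le⟩) (hreg r (toK r hrL ⟨hr.1, hr.2.le⟩))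
      nlinarith
    · have hp := hlI r hr
      have hq := hnI r hr
      have hlt : lft L r < nxt L r :=
        lt_of_le_of_lt (hS.lft_mem r).2 (lt_of_le_of_ne (hS.le_nxt r) (Ne.symm hn))
      have hb := hM2 _ _ (hsub _ hp) (hsub _ hq) hlt (hreg _ (toK _ (hS.lft_mem r).1 hp))
        (hreg _ (toK _ (hS.nxt_mem r) hq)) (hgp _ _ hp.1 hlt.le hq.2 gap_of_nxt)
      have hl : 0 < nxt L r - lft L r := by linarith
      refine (integral_norm_le_nsq_add_one (cχ.mul (Dc r)) ?_).trans ?_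
      · exact ((cχ.mul (Dc r)).norm.pow 2).integrable_of_hasCompactSupport
          (hcs_of_zero (Dcs r) fun x hx => by
            show ‖((χ x ^ 2 : ℝ) : ℂ) * D r x‖ ^ 2 = 0
            rw [hx]; simp)
      · rw [Real.sqrt_le_left (by positivity)] at hb
        have e : nsq μ (fun x => ((χ x ^ 2 : ℝ) : ℂ) * D r x) = (nxt L r - lft L r)⁻¹ ^ 2 *
            nsq μ (fun x => ((χ x ^ 2 : ℝ) : ℂ) * (φ (nxt L r) x - φ (lft L r) x)) := by
          unfold nsq
          rw [← integral_const_mul]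
          refine integral_congr_ae (Eventually.of_forall fun x => ?_)
          simp only [D2 r hn, norm_mul, norm_smul, Real.norm_of_nonneg (inv_nonneg.2 hl.le)]
          ring
        have e2 : nsq μ (fun x => ((χ x ^ 2 : ℝ) : ℂ) * D r x) ≤ M2 ^ 2 := by
          rw [e, inv_pow, inv_mul_le_iff₀ (by positivity)]
          linarith
        have e3 : nsq μ (fun x => ((χ x ^ 2 : ℝ) : ℂ) * D r x) + 1 ≤ M1 + (M2 ^ 2 + 1) := by linarith
        exact e3
  have hηt := hη.test hχ
  obtain ⟨v, hv, rfl⟩ := hη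
  have hη : DivSq χ (fun x => ((χ x ^ 2 : ℝ) : ℂ) * v x) := ⟨v, hv, rfl⟩
  set η : Eu n → ℂ := fun x => ((χ x ^ 2 : ℝ) : ℂ) * v x with hηd
  obtain ⟨V, hV⟩ := (show IsCompact (tsupport χ) from hχ.hcs).exists_bound_of_continuousOn
    hv.cont.continuousOn
  have hFb : ∀ r x, ‖D r x * η x‖ ≤ |V| * ‖((χ x ^ 2 : ℝ) : ℂ) * D r x‖ := by
    intro r x
    by_cases hx : x ∈ tsupport χ
    · have := (hV x hx).trans (le_abs_self V)
      rw [hηd]; dsimp only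
      rw [show D r x * (((χ x ^ 2 : ℝ) : ℂ) * v x) = v x * (((χ x ^ 2 : ℝ) : ℂ) * D r x) by ring,
        norm_mul]
      gcongr
    · rw [hηd]; simp [image_eq_zero_of_notMem_tsupport hx]
  have Fi : ∀ r, Integrable (fun x => D r x * η x) μ := fun r =>
    ((Di r).norm.const_mul |V|).mono' ((Dc r).mul hηt.cont).aestronglyMeasurable
      (Eventually.of_forall fun x => hFb r x)
  have Fm : StronglyMeasurable (fun z : ℝ × Eu n => D z.1 z.2 * η z.2) :=
    (h.measurable_ditp hS).mul (hηt.cont.comp continuous_snd).stronglyMeasurable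
  have Fb : ∀ r ∈ Ico s t, ∫ x, ‖D r x * η x‖ ∂μ ≤ |V| * (M1 + (M2 ^ 2 + 1)) := by
    intro r hr
    refine (integral_mono (Fi r).norm ((Di r).norm.const_mul |V|) fun x => hFb r x).trans ?_
    rw [integral_const_mul]
    have := Db r hr
    gcongr
  have hfin : IsFiniteMeasure (volume.restrict (Ico s t)) := ⟨by simp⟩
  have Fp : Integrable (fun z : ℝ × Eu n => D z.1 z.2 * η z.2)
      ((volume.restrict (Ico s t)).prod μ) := by
    rw [integrable_prod_iff Fm.aestronglyMeasurable]
    refine ⟨Eventually.of_forall fun r => Fi r, ?_⟩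
    refine Integrable.of_bound (C := |V| * (M1 + (M2 ^ 2 + 1)))
      (Fm.norm.integral_prod_right (ν := μ)).aestronglyMeasurable ?_
    filter_upwards [ae_restrict_mem measurableSet_Ico] with r hr
    rw [Real.norm_of_nonneg (integral_nonneg fun x => norm_nonneg _)]
    exact Fb r hr
  set A : ℝ → ℂ := fun r => ∫ x, D r x * η x ∂μ with hA
  have Ai : IntegrableOn A (Ico s t) := Fp.integral_prod_left
  have ico : ∀ {p q : ℝ} (f : ℝ → ℂ), p ≤ q → ∫ r in Ico p q, f r = ∫ r in p..q, f r := by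
    intro p q f hpq
    rw [intervalIntegral.integral_of_le hpq, integral_Ico_eq_integral_Ioo, integral_Ioc_eq_integral_Ioo]
  have pd : ∀ p q, ∫ x, (φ q x - φ p x) * η x ∂μ = pair μ (φ q) η - pair μ (φ p) η := by
    intro p q
    unfold pair
    rw [← integral_sub (hG.integrable_mul (h.smth q).cont hηt)
        (hG.integrable_mul (h.smth p).cont hηt)]
    simp only [sub_mul]
  have hA1 : ∫ r in Ico s t, A r = pair μ (φ t) η - pair μ (φ s) η := by
    rw [hA, integral_integral_swap Fp, ← pd]
    refine integral_congr_ae ?_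
    filter_upwards [Fp.prod_left_ae] with x hx
    by_cases hx0 : η x = 0
    · simp [hx0]
    · rw [integral_mul_const, ico _ hst]
      congr 1
      refine hS.integral_ditp (fun r => (h.tdiff x r).hasDerivAt) hsL htL hst ?_
      rw [intervalIntegrable_iff_integrableOn_Ico_of_le hst]
      have := hx.mul_const (η x)⁻¹
      refine this.congr (Eventually.of_forall fun r => ?_)
      simp only [hD]
      field_simp
      rfl
  have hGi : IntegrableOn (fun r => pair μ (dt φ r) η) (Ico s t) :=
    (h.integrableOn_pair_dt hG hB hηt).mono_set fun r hr => hsub r ⟨hr.1, hr.2.le⟩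
  have key := hS.integral_eq_of_gap_average hsL htL Ai hGi
    (fun r _ hr => by simp only [hA, D1 r hr, pair]) ?_
  · rw [hA1, ico _ hst] at key
    have := h.defect_sub hG hB hηt hs ht
    rw [key, sub_self] at this
    exact sub_eq_zero.1 this
  · rintro p ⟨hpL, hpI⟩ hlt
    have hq := hnI p hpI
    have hg : ∀ x ∈ Ioo p (nxt L p), x ∉ L := by
      have := gap_of_nxt (K := L) (r := p)
      rwa [lft_of_mem hpL] at this
    have e1 : ∀ r ∈ Ico p (nxt L p), A r = (nxt L p - p)⁻¹ • (pair μ (φ (nxt L p)) η - pair μ (φ p) η) := by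
      intro r hr
      have n1 := hS.nxt_gap (hS.nxt_mem p) hg hr
      have n2 := hS.lft_gap hpL hg hr
      rw [← pd, ← integral_smul]
      simp only [hA]
      rw [D2 r (by rw [n1]; exact hr.2.ne'), n1, n2]
      simp only [smul_mul_assoc]
    rw [setIntegral_congr_fun measurableSet_Ico e1, setIntegral_const, ico _ hlt.le]
    have e2 := h.defect_sub hG hB hηt (hsub p ⟨hpI.1, hpI.2.le⟩) (hsub _ hq)
    rw [hgp p _ hpI.1 hlt.le hq.2 hg η hη _ ⟨hlt.le, le_rfl⟩, sub_self] at e2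
    rw [← sub_eq_zero.1 e2.symm, smul_smul]
    have : volume.real (Ico p (nxt L p)) = nxt L p - p := by
      rw [Real.volume_real_Ico_of_le hlt.le]
    rw [this, mul_inv_cancel₀ (by linarith), one_smul]

end

section
variable {n : ℕ} {U : Eu n → ℝ} {μ : Measure (Eu n)} {lam : ℝ} {φ : ℝ → Eu n → ℂ} {χ : Eu n → ℝ}

/-- A Baire argument upgrading the pointwise equation to its weak integrated form. -/
lemma LSE.defect_const (hG : Gibbs U μ) (h : LSE U μ lam φ) (hχ : IsCut χ) {a b C : ℝ}
    (hB : Bd μ φ a b C) {s t : ℝ} (hs : s ∈ Icc a b) (ht : t ∈ Icc a b) (hst : s ≤ t) {η : Eu n → ℂ}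
    (hη : DivSq χ η) : defect μ φ a η t = defect μ φ a η s := by
  set good : Set ℝ := {t | ∃ δ > 0, ∀ η, DivSq χ η → ∀ r ∈ Icc a b, ∀ r' ∈ Icc a b,
    |r - t| < δ → |r' - t| < δ → defect μ φ a η r = defect μ φ a η r'} with hgood
  have hopen : IsOpen good := by
    rw [Metric.isOpen_iff]
    rintro t ⟨δ, hδ, hc⟩
    refine ⟨δ / 2, by linarith, fun t' ht' => ⟨δ / 2, by linarith, fun η hη r hr r' hr' h1 h2 => ?_⟩⟩
    rw [Metric.mem_ball, Real.dist_eq] at ht'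
    refine hc η hη r hr r' hr' ?_ ?_
    · have := abs_sub_le r t' t; linarith
    · have := abs_sub_le r' t' t; linarith
  set K : Set ℝ := Icc a b ∩ goodᶜ with hKd
  have hK : IsClosed K := isClosed_Icc.inter hopen.isClosed_compl
  have hgap : ∀ p q, p ∈ Icc a b → q ∈ Icc a b → p ≤ q → (∀ x ∈ Ioo p q, x ∉ K) → ∀ η, DivSq χ η →
      defect μ φ a η q = defect μ φ a η p := by
    intro p q hp hq hpq hx η hη
    refine eq_of_locally_const hpq ((h.continuousOn_defect hG hB (hη.test hχ)).mono
      fun r hr => ⟨hp.1.trans hr.1, hr.2.trans hq.2⟩) fun r hr => ?_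
    have hI : ∀ r ∈ Ioo p q, r ∈ Icc a b := fun r hr => ⟨hp.1.trans hr.1.le, hr.2.le.trans hq.2⟩
    have hg : r ∈ good := by
      by_contra hc
      exact hx r hr ⟨hI r hr, hc⟩
    obtain ⟨δ, hδ, hc⟩ := hg
    filter_upwards [Ioo_mem_nhds hr.1 hr.2, Metric.ball_mem_nhds r hδ] with r' h1 h2
    rw [Metric.mem_ball, Real.dist_eq] at h2
    exact hc η hη r' (hI r' h1) r (hI r hr) h2 (by simpa using hδ)
  have hKe : K = ∅ := by
    by_contra hne
    have hne : Nonempty K := (nonempty_iff_ne_empty.2 hne).to_subtype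
    have := hK.completeSpace_coe
    obtain ⟨N, x0, hx0⟩ := nonempty_interior_of_iUnion_of_closed
      (X := K) (f := fun N : ℕ => {x : K | Reg U μ χ N (φ x)}) (fun N => by
        have := (h.isClosed_reg hG hχ hB N).preimage (continuous_subtype_val (p := (· ∈ K)))
        convert this using 1
        ext x
        exact ⟨fun hx => ⟨x.2.1, hx⟩, fun hx => hx.2⟩) (by
        refine eq_univ_of_forall fun x => mem_iUnion.2 ?_
        exact exists_reg hG hχ (h.smth x))
    obtain ⟨δ, hδ, hb⟩ := Metric.isOpen_iff.1 isOpen_interior x0 hx0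
    have hreg : ∀ x ∈ K, |x - x0| < δ → Reg U μ χ N (φ x) := fun x hx hd => by
      have h1 : (⟨x, hx⟩ : K) ∈ {x : K | Reg U μ χ N (φ x)} :=
        interior_subset (hb (show (⟨x, hx⟩ : K) ∈ Metric.ball x0 δ from hd))
      exact h1
    refine x0.2.2 ⟨δ, hδ, fun η hη => ?_⟩
    have main : ∀ r ∈ Icc a b, ∀ r' ∈ Icc a b, |r - x0| < δ → |r' - x0| < δ → r ≤ r' →
        defect μ φ a η r' = defect μ φ a η r := by
      intro s hs t ht hs' ht' hst
      rcases (K ∩ Icc s t).eq_empty_or_nonempty with he | hne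
      · refine hgap s t hs ht hst (fun x hx hxK => ?_) η hη
        have : x ∈ K ∩ Icc s t := ⟨hxK, hx.1.le, hx.2.le⟩
        rw [he] at this; exact this
      · have hcl : IsClosed (K ∩ Icc s t) := hK.inter isClosed_Icc
        have bb : BddBelow (K ∩ Icc s t) := ⟨s, fun x hx => hx.2.1⟩
        have ba : BddAbove (K ∩ Icc s t) := ⟨t, fun x hx => hx.2.2⟩
        have hp := hcl.csInf_mem hne bb
        have hq := hcl.csSup_mem hne ba
        set p := sInf (K ∩ Icc s t)
        set q := sSup (K ∩ Icc s t)
        have hpq : p ≤ q := csInf_le bb hq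
        have e1 := hgap s p hs hp.1.1 hp.2.1 (fun x hx hxK => absurd
          (csInf_le bb ⟨hxK, hx.1.le, hx.2.le.trans hp.2.2⟩) (not_le.2 hx.2)) η hη
        have e2 := hgap q t hq.1.1 ht hq.2.2 (fun x hx hxK => absurd
          (le_csSup ba ⟨hxK, hq.2.1.trans hx.1.le, hx.2.le⟩) (not_le.2 hx.1)) η hη
        have e3 := h.defect_eq_of_reg hG hχ hB (Nat.cast_nonneg N) hK hp.1.1 hq.1.1 hpq hp.1 hq.1
          (fun r hr => hreg r hr.1 (by
            have h1 := hp.2.1.trans hr.2.1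
            have h2 := hr.2.2.trans hq.2.2
            rw [abs_lt] at *
            constructor <;> linarith))
          (fun p' q' h1 h2 h3 hx η hη => hgap p' q' ⟨hp.1.1.1.trans h1, (h2.trans h3).trans hq.1.1.2⟩
            ⟨hp.1.1.1.trans (h1.trans h2), h3.trans hq.1.1.2⟩ h2 hx η hη) hη
        rw [e2, e3, e1]
    intro r hr r' hr' h1 h2
    rcases le_total r r' with hrr | hrr
    · exact (main r hr r' hr' h1 h2 hrr).symm
    · exact main r' hr' r hr h2 h1 hrr
  exact hgap s t hs ht hst (fun x _ hxK => by rw [hKe] at hxK; exact hxK) η hη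

/-- The weak integrated form of the equation. -/
lemma LSE.ftc (hG : Gibbs U μ) (h : LSE U μ lam φ) {a b C : ℝ}
    (hB : Bd μ φ a b C) {s t : ℝ} (hs : s ∈ Icc a b) (ht : t ∈ Icc a b) {η : Eu n → ℂ}
    (hη : IsTest η) : pair μ (φ t) η - pair μ (φ s) η = ∫ r in s..t, pair μ (dt φ r) η := by
  have hK : IsCompact (tsupport η) := hη.2
  obtain ⟨χ, hχ, h1⟩ := exists_cut_compact hK
  have hD : DivSq χ η := ⟨η, hη.1, by
    funext x
    by_cases hx : x ∈ tsupport η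
    · simp [h1 x hx]
    · simp [image_eq_zero_of_notMem_tsupport hx]⟩
  have key : defect μ φ a η t = defect μ φ a η s := by
    rcases le_total s t with hst | hst
    · exact h.defect_const hG hχ hB hs ht hst hD
    · exact (h.defect_const hG hχ hB ht hs hst hD).symm
  have := h.defect_sub hG hB hη hs ht
  rw [key, sub_self] at this
  exact sub_eq_zero.1 this.symm

end

lemma gronwall_two_sided {f : ℝ → ℝ} {a b K c : ℝ} (hf : ContinuousOn f (Icc a b))
    (h : ∀ s ∈ Icc a b, ∀ ρ > 0, ∀ᶠ t in 𝓝[Icc a b] s, f t ≤ f s + (K * f s + c + ρ) * |t - s|)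
    {s t : ℝ} (hs : s ∈ Icc a b) (ht : t ∈ Icc a b) : f t ≤ gronwallBound (f s) K c |t - s| := by
  have fwd : ∀ {g : ℝ → ℝ} {a b : ℝ}, ContinuousOn g (Icc a b) →
      (∀ s ∈ Icc a b, ∀ ρ > 0, ∀ᶠ t in 𝓝[Icc a b] s, g t ≤ g s + (K * g s + c + ρ) * |t - s|) →
      ∀ {s t : ℝ}, s ∈ Icc a b → t ∈ Icc a b → s ≤ t → g t ≤ gronwallBound (g s) K c (t - s) := by
    intro g a b hg h s t hs ht hst
    have hsub : Icc s t ⊆ Icc a b := Icc_subset_Icc hs.1 ht.2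
    refine le_gronwallBound_of_liminf_deriv_right_le (f' := fun x => K * g x + c) (hg.mono hsub)
      (fun x hx r hr => ?_) le_rfl (fun x _ => le_rfl) t ⟨hst, le_rfl⟩
    have h1 := h x (hsub ⟨hx.1, hx.2.le⟩) ((r - (K * g x + c)) / 2) (by linarith)
    have h2 : 𝓝[Ioo x t] x ≤ 𝓝[Icc a b] x :=
      nhdsWithin_mono _ fun y hy => hsub ⟨hx.1.trans hy.1.le, hy.2.le⟩
    have h3 : 𝓝[Ioo x t] x = 𝓝[>] x := nhdsWithin_Ioo_eq_nhdsGT hx.2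
    refine Eventually.frequently ?_
    filter_upwards [h3 ▸ h2 h1, self_mem_nhdsWithin] with z hz hxz
    have hxz : x < z := hxz
    rw [abs_of_pos (by linarith)] at hz
    rw [inv_mul_lt_iff₀ (by linarith)]
    nlinarith
  rcases le_total s t with hst | hst
  · rw [abs_of_nonneg (by linarith)]; exact fwd hf h hs ht hst
  · have hmem : ∀ {x}, x ∈ Icc (-b) (-a) → -x ∈ Icc a b := fun {x} hx => ⟨by linarith [hx.2], by linarith [hx.1]⟩
    have := fwd (g := fun x => f (-x)) (a := -b) (b := -a)
      (hf.comp continuous_neg.continuousOn fun x hx => hmem hx) (fun x hx ρ hρ => by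
        have h1 := h (-x) (hmem hx) ρ hρ
        have h2 : Tendsto (fun y : ℝ => -y) (𝓝[Icc (-b) (-a)] x) (𝓝[Icc a b] (-x)) :=
          tendsto_nhdsWithin_of_tendsto_nhds_of_eventually_within _
            ((continuous_neg.tendsto x).mono_left nhdsWithin_le_nhds)
            (by filter_upwards [self_mem_nhdsWithin] with y hy using hmem hy)
        filter_upwards [h2.eventually h1] with y hy
        rwa [show |-y - -x| = |y - x| by rw [← abs_neg]; congr 1; ring] at hy)
      (s := -s) (t := -t) ⟨by linarith [hs.2], by linarith [hs.1]⟩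
      ⟨by linarith [ht.2], by linarith [ht.1]⟩ (by linarith)
    simp only [neg_neg] at this
    rw [abs_of_nonpos (by linarith)]
    convert this using 2; ring

section
variable {n : ℕ} {U : Eu n → ℝ} {μ : Measure (Eu n)} {lam : ℝ} {φ : ℝ → Eu n → ℂ} {χ : Eu n → ℝ}

/-- Localised squared `L²` norm. -/
def wsq (μ : Measure (Eu n)) (χ : Eu n → ℝ) (u : Eu n → ℂ) : ℝ := ∫ x, χ x ^ 2 * ‖u x‖ ^ 2 ∂μ

lemma wsq_nonneg (u : Eu n → ℂ) : 0 ≤ wsq μ χ u := integral_nonneg fun _ => by positivity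

lemma Smth.wsq_integrable (hG : Gibbs U μ) (hχ : IsCut χ) {u : Eu n → ℂ} (hu : Smth u) :
    Integrable (fun x => χ x ^ 2 * ‖u x‖ ^ 2) μ := hG.integrable_cut_sq hχ (hu.cont.norm.pow 2)

lemma wsq_conj (u : Eu n → ℂ) : wsq μ χ (fun x => conj (u x)) = wsq μ χ u := by simp [wsq]

lemma gradSqC_conj (u : Eu n → ℂ) : gradSqC n (fun x => conj (u x)) = gradSqC n u := by
  funext x; simp [gradSqC, pdC_conj]

lemma dir_conj (u : Eu n → ℂ) : dir μ (fun x => conj (u x)) = dir μ u := by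
  unfold dir; rw [gradSqC_conj]

lemma wsq_le_nsq (hG : Gibbs U μ) (hχ : IsCut χ) {u : Eu n → ℂ} (hu : Smth u)
    (hi : Integrable (fun x => ‖u x‖ ^ 2) μ) : wsq μ χ u ≤ nsq μ u :=
  integral_mono (hu.wsq_integrable hG hχ) hi fun x =>
    mul_le_of_le_one_left (by positivity) (hχ.sq_le_one x)

lemma pdC_sq_mul (hχ : IsCut χ) {v : Eu n → ℂ} (hv : Smth v) (j : Fin n) (x : Eu n) :
    pdC n (fun y => ((χ y ^ 2 : ℝ) : ℂ) * v y) j x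
      = ((χ x ^ 2 : ℝ) : ℂ) * pdC n v j x + 2 * ((χ x * pdR n χ j x : ℝ) : ℂ) * v x := by
  rw [pdC_pow_mul hχ hv 1]; push_cast; ring

lemma gradSqC_sq_mul_le (hχ : IsCut χ) {c : ℝ} (hc : ∀ x, ∑ j, pdR n χ j x ^ 2 ≤ c ^ 2)
    {v : Eu n → ℂ} (hv : Smth v) (x : Eu n) :
    gradSqC n (fun y => ((χ y ^ 2 : ℝ) : ℂ) * v y) x
      ≤ 2 * gradSqC n v x + 8 * c ^ 2 * (χ x ^ 2 * ‖v x‖ ^ 2) := by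
  have h1 : ∀ j, ‖pdC n (fun y => ((χ y ^ 2 : ℝ) : ℂ) * v y) j x‖ ^ 2
      ≤ 2 * ‖pdC n v j x‖ ^ 2 + 8 * (χ x ^ 2 * ‖v x‖ ^ 2) * pdR n χ j x ^ 2 := by
    intro j
    rw [pdC_sq_mul hχ hv]
    refine (norm_add_sq_le _ _).trans ?_
    simp only [norm_mul, Complex.norm_real, mul_pow, Complex.norm_ofNat, norm_pow, Real.norm_eq_abs,
      sq_abs]
    have := pow_le_one₀ (n := 2) (sq_nonneg (χ x)) (hχ.sq_le_one x)
    nlinarith [sq_nonneg ‖pdC n v j x‖]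
  refine (Finset.sum_le_sum fun j _ => h1 j).trans ?_
  rw [Finset.sum_add_distrib, ← Finset.mul_sum, ← Finset.mul_sum]
  have h2 : 0 ≤ 8 * (χ x ^ 2 * ‖v x‖ ^ 2) := by positivity
  have := mul_le_mul_of_nonneg_left (hc x) h2
  unfold gradSqC
  linarith

lemma dir_sq_mul_le (hG : Gibbs U μ) (hχ : IsCut χ) {c : ℝ}
    (hc : ∀ x, ∑ j, pdR n χ j x ^ 2 ≤ c ^ 2) {v : Eu n → ℂ} (hv : Smth v)
    (hi : Integrable (gradSqC n v) μ) :
    dir μ (fun y => ((χ y ^ 2 : ℝ) : ℂ) * v y) ≤ 2 * dir μ v + 8 * c ^ 2 * wsq μ χ v := by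
  have iw := hv.wsq_integrable hG hχ
  have : 2 * dir μ v + 8 * c ^ 2 * wsq μ χ v
      = ∫ x, (2 * gradSqC n v x + 8 * c ^ 2 * (χ x ^ 2 * ‖v x‖ ^ 2)) ∂μ := by
    rw [integral_add (hi.const_mul 2) (iw.const_mul _), integral_const_mul, integral_const_mul]; rfl
  rw [this]
  exact integral_mono ((hχ.sq_mul_test hv).gradSq_integrable hG)
    ((hi.const_mul 2).add (iw.const_mul _)) fun x => gradSqC_sq_mul_le hχ hc hv x

lemma nsq_sq_mul_le (hG : Gibbs U μ) (hχ : IsCut χ) {v : Eu n → ℂ} (hv : Smth v) :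
    nsq μ (fun y => ((χ y ^ 2 : ℝ) : ℂ) * v y) ≤ wsq μ χ v := by
  refine integral_mono ((hχ.sq_mul_test hv).nsq_integrable hG) (hv.wsq_integrable hG hχ) fun x => ?_
  simp only [norm_mul, Complex.norm_real, mul_pow, norm_pow, Real.norm_eq_abs, sq_abs]
  have := hχ.sq_le_one x
  have : (χ x ^ 2) ^ 2 ≤ χ x ^ 2 := by nlinarith [sq_nonneg (χ x)]
  gcongr

lemma LSE.exists_lip (hG : Gibbs U μ) (h : LSE U μ lam φ) (hχ : IsCut χ) {c : ℝ} (hc0 : 0 ≤ c)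
    (hc : ∀ x, ∑ j, pdR n χ j x ^ 2 ≤ c ^ 2) {a b C : ℝ} (hB : Bd μ φ a b C) :
    ∃ A : ℝ, 0 ≤ A ∧ ∀ s ∈ Icc a b, ∀ t ∈ Icc a b, ∀ v : Eu n → ℂ, Smth v →
      Integrable (gradSqC n v) μ →
      ‖pair μ (φ t) (fun x => ((χ x ^ 2 : ℝ) : ℂ) * v x) - pair μ (φ s) (fun x => ((χ x ^ 2 : ℝ) : ℂ) * v x)‖
        ≤ A * (√(wsq μ χ v) + √(dir μ v)) * |t - s| := by
  obtain ⟨A, hA0, hA⟩ := h.exists_pair_dt_bound hG hB (K := tsupport χ) hχ.hcs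
  refine ⟨A * (3 + 3 * c), by positivity, fun s hs t ht v hv hi => ?_⟩
  have hη := hχ.sq_mul_test hv
  rw [h.ftc hG hB hs ht hη]
  refine intervalIntegral.norm_integral_le_of_norm_le_const fun r hr => ?_
  have hr' := Set.uIcc_subset_Icc hs ht (Set.uIoc_subset_uIcc hr)
  refine ((hA r hr' _ hη fun x hx => by simp [image_eq_zero_of_notMem_tsupport hx]).2.1).trans ?_
  rw [mul_assoc]
  gcongr
  have h1 : √(nsq μ (fun y => ((χ y ^ 2 : ℝ) : ℂ) * v y)) ≤ √(wsq μ χ v) :=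
    Real.sqrt_le_sqrt (nsq_sq_mul_le hG hχ hv)
  have w0 := wsq_nonneg (μ := μ) (χ := χ) v
  have d0 := dir_nonneg (μ := μ) v
  have h2 : √(dir μ (fun y => ((χ y ^ 2 : ℝ) : ℂ) * v y)) ≤ 2 * √(dir μ v) + 3 * c * √(wsq μ χ v) := by
    rw [Real.sqrt_le_left (by positivity)]
    refine (dir_sq_mul_le hG hχ hc hv hi).trans ?_
    have e1 := Real.sq_sqrt w0
    have e2 := Real.sq_sqrt d0
    have : 0 ≤ √(dir μ v) * (c * √(wsq μ χ v)) := by positivity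
    nlinarith [mul_nonneg (sq_nonneg c) w0]
  have : 0 ≤ c * √(dir μ v) := by positivity
  nlinarith [Real.sqrt_nonneg (dir μ v), Real.sqrt_nonneg (wsq μ χ v)]

lemma LSE.re_increment (hG : Gibbs U μ) (h : LSE U μ lam φ) {a b C : ℝ} (hB : Bd μ φ a b C)
    {η : Eu n → ℂ} (hη : IsTest η) {s : ℝ} (hs : s ∈ Icc a b) {B : ℝ}
    (hr : ∀ᶠ r in 𝓝[Icc a b] s, |(pair μ (dt φ r) η).re| ≤ B) :
    ∀ᶠ t in 𝓝[Icc a b] s, |(pair μ (φ t) η - pair μ (φ s) η).re| ≤ B * |t - s| := by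
  obtain ⟨δ, hδ, hd⟩ := Metric.mem_nhdsWithin_iff.1 hr
  filter_upwards [self_mem_nhdsWithin, mem_nhdsWithin_of_mem_nhds (Metric.ball_mem_nhds s hδ)]
    with t ht htd
  rw [h.ftc hG hB hs ht hη]
  have e := Complex.reCLM.intervalIntegral_comp_comm (h.intervalIntegrable_pair_dt hG hB hη hs ht)
  have e' : (∫ r in s..t, pair μ (dt φ r) η).re = ∫ r in s..t, (pair μ (dt φ r) η).re := e.symm
  rw [e', ← Real.norm_eq_abs]
  refine intervalIntegral.norm_integral_le_of_norm_le_const fun r hr => ?_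
  have hr1 := Set.uIoc_subset_uIcc hr
  refine hd ⟨?_, Set.uIcc_subset_Icc hs ht hr1⟩
  rw [Metric.mem_ball, Real.dist_eq] at *
  exact (Set.abs_sub_left_of_mem_uIcc hr1).trans_lt htd

lemma abs_im_form_cut_le (hG : Gibbs U μ) (hχ : IsCut χ) {c : ℝ} (hc0 : 0 ≤ c)
    (hc : ∀ x, ∑ j, pdR n χ j x ^ 2 ≤ c ^ 2) {u : Eu n → ℂ} (hu : Smth u)
    (hi : Integrable (gradSqC n u) μ) :
    |(∑ j, ∫ x, pdC n u j x * pdC n (fun y => ((χ y ^ 2 : ℝ) : ℂ) * conj (u y)) j x ∂μ).im|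
      ≤ 2 * c * (√(wsq μ χ u) * √(dir μ u)) := by
  have hη := hχ.sq_mul_test hu.conj
  have hj : ∀ j, Integrable (fun x => pdC n u j x *
      pdC n (fun y => ((χ y ^ 2 : ℝ) : ℂ) * conj (u y)) j x) μ := fun j =>
    hG.integrable_mul (hu.pdC j).cont (hη.pdC j)
  have hs : ∀ x, √(gradSqC n u x) ^ 2 = gradSqC n u x := fun x => Real.sq_sqrt (gradSqC_nonneg u x)
  have hχu : ∀ x, (χ x * ‖u x‖) ^ 2 = χ x ^ 2 * ‖u x‖ ^ 2 := fun x => by ring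
  have cχ := hχ.smooth.continuous
  have h3 := integral_mul_le_sqrt (μ := μ) (f := fun x => χ x * ‖u x‖)
    (g := fun x => √(gradSqC n u x)) (fun x => mul_nonneg (hχ.nonneg x) (norm_nonneg _))
    (fun _ => Real.sqrt_nonneg _) (cχ.mul hu.cont.norm).aestronglyMeasurable
    (hu.continuous_gradSq.sqrt.aestronglyMeasurable)
    (by simpa only [hχu] using hu.wsq_integrable hG hχ)
    (by simpa only [hs] using hi)
  simp only [hs, hχu] at h3
  have e : (∑ j, ∫ x, pdC n u j x * pdC n (fun y => ((χ y ^ 2 : ℝ) : ℂ) * conj (u y)) j x ∂μ).im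
      = ∫ x, (∑ j, pdC n u j x * pdC n (fun y => ((χ y ^ 2 : ℝ) : ℂ) * conj (u y)) j x).im ∂μ := by
    rw [← integral_finsetSum _ fun j _ => hj j]
    exact (integral_im (integrable_finsetSum _ fun j _ => hj j)).symm
  rw [e, ← Real.norm_eq_abs]
  have h4 : 2 * c * ∫ x, χ x * ‖u x‖ * √(gradSqC n u x) ∂μ ≤ 2 * c * (√(wsq μ χ u) * √(dir μ u)) := by
    unfold wsq dir; gcongr
  refine le_trans ?_ h4
  rw [← integral_const_mul]
  refine norm_integral_le_of_norm_le ?_ (Eventually.of_forall fun x => ?_)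
  · refine Integrable.const_mul ?_ _
    exact hG.integrable_hcsR ((cχ.mul hu.cont.norm).mul hu.continuous_gradSq.sqrt)
      (hcs_of_zero hχ.hcs fun x hx => by simp [hx])
  · have e1 : (∑ j, pdC n u j x * pdC n (fun y => ((χ y ^ 2 : ℝ) : ℂ) * conj (u y)) j x).im
        = (∑ j, pdC n u j x * (2 * ((χ x * pdR n χ j x : ℝ) : ℂ) * conj (u x))).im := by
      rw [Complex.im_sum, Complex.im_sum]
      refine Finset.sum_congr rfl fun j _ => ?_
      rw [pdC_sq_mul hχ hu.conj, pdC_conj]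
      have : pdC n u j x * (((χ x ^ 2 : ℝ) : ℂ) * conj (pdC n u j x)
          + 2 * ((χ x * pdR n χ j x : ℝ) : ℂ) * conj (u x))
          = ((χ x ^ 2 * ‖pdC n u j x‖ ^ 2 : ℝ) : ℂ)
          + pdC n u j x * (2 * ((χ x * pdR n χ j x : ℝ) : ℂ) * conj (u x)) := by
        rw [← Complex.normSq_eq_norm_sq, Complex.ofReal_mul (χ x ^ 2), ← Complex.mul_conj]; ring
      rw [this, Complex.add_im, Complex.ofReal_im, zero_add]
    rw [e1, Real.norm_eq_abs]
    refine (Complex.abs_im_le_norm _).trans ((norm_sum_le _ _).trans ?_)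
    have e2 : ∑ j, ‖pdC n u j x * (2 * ((χ x * pdR n χ j x : ℝ) : ℂ) * conj (u x))‖
        = 2 * (χ x * ‖u x‖) * ∑ j, ‖pdC n u j x‖ * |pdR n χ j x| := by
      rw [Finset.mul_sum]
      refine Finset.sum_congr rfl fun j _ => ?_
      simp only [norm_mul, Complex.norm_real, RCLike.norm_conj, Complex.norm_ofNat,
        Real.norm_eq_abs, abs_of_nonneg (hχ.nonneg x)]
      ring
    rw [e2]
    have e3 := Real.sum_mul_le_sqrt_mul_sqrt Finset.univ (fun j => ‖pdC n u j x‖) (fun j => |pdR n χ j x|)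
    simp only [sq_abs] at e3
    have e4 : √(∑ j, pdR n χ j x ^ 2) ≤ c := (Real.sqrt_le_left hc0).2 (hc x)
    have e5 : ∑ j, ‖pdC n u j x‖ * |pdR n χ j x| ≤ √(gradSqC n u x) * c :=
      e3.trans (mul_le_mul_of_nonneg_left e4 (Real.sqrt_nonneg _))
    have e6 : 0 ≤ 2 * (χ x * ‖u x‖) := by have := hχ.nonneg x; positivity
    nlinarith [mul_le_mul_of_nonneg_left e5 e6]

end

section
variable {n : ℕ} {U : Eu n → ℝ} {μ : Measure (Eu n)} {lam : ℝ} {φ : ℝ → Eu n → ℂ} {χ : Eu n → ℝ}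

/-- The test function dual to `v` for the localised pairing. -/
def dual (χ : Eu n → ℝ) (v : Eu n → ℂ) : Eu n → ℂ := fun x => ((χ x ^ 2 : ℝ) : ℂ) * conj (v x)

lemma IsCut.dual_test (hχ : IsCut χ) {v : Eu n → ℂ} (hv : Smth v) : IsTest (dual χ v) :=
  hχ.sq_mul_test hv.conj

/-- The localised real inner product. -/
def wip (μ : Measure (Eu n)) (χ : Eu n → ℝ) (u v : Eu n → ℂ) : ℝ := (pair μ u (dual χ v)).re

lemma wip_eq (hG : Gibbs U μ) (hχ : IsCut χ) {u v : Eu n → ℂ} (hu : Smth u) (hv : Smth v) :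
    wip μ χ u v = ∫ x, χ x ^ 2 * (u x * conj (v x)).re ∂μ := by
  have hi := hG.integrable_mul hu.cont (hχ.dual_test hv)
  have e : wip μ χ u v = ∫ x, (u x * dual χ v x).re ∂μ := (integral_re hi).symm
  rw [e]
  refine integral_congr_ae (Eventually.of_forall fun x => ?_)
  simp only [dual]
  rw [show u x * (((χ x ^ 2 : ℝ) : ℂ) * conj (v x)) = ((χ x ^ 2 : ℝ) : ℂ) * (u x * conj (v x)) by ring,
    Complex.re_ofReal_mul]

lemma Gibbs.integrable_wip (hG : Gibbs U μ) (hχ : IsCut χ) {u v : Eu n → ℂ} (hu : Smth u)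
    (hv : Smth v) : Integrable (fun x => χ x ^ 2 * (u x * conj (v x)).re) μ :=
  hG.integrable_cut_sq hχ (Complex.continuous_re.comp (hu.cont.mul hv.conj.cont))

lemma wip_self (hG : Gibbs U μ) (hχ : IsCut χ) {u : Eu n → ℂ} (hu : Smth u) :
    wip μ χ u u = wsq μ χ u := by
  rw [wip_eq hG hχ hu hu]
  simp only [Complex.mul_conj, Complex.normSq_eq_norm_sq, Complex.ofReal_re]; rfl

lemma wip_comm (hG : Gibbs U μ) (hχ : IsCut χ) {u v : Eu n → ℂ} (hu : Smth u) (hv : Smth v) :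
    wip μ χ u v = wip μ χ v u := by
  rw [wip_eq hG hχ hu hv, wip_eq hG hχ hv hu]
  refine integral_congr_ae (Eventually.of_forall fun x => ?_)
  simp only [Complex.mul_re, Complex.conj_re, Complex.conj_im]; ring

lemma wip_sub_left (hG : Gibbs U μ) (hχ : IsCut χ) {u w v : Eu n → ℂ} (hu : Smth u) (hw : Smth w)
    (hv : Smth v) : wip μ χ (fun x => u x - w x) v = wip μ χ u v - wip μ χ w v := by
  rw [wip_eq hG hχ (hu.sub hw) hv, wip_eq hG hχ hu hv, wip_eq hG hχ hw hv,
    ← integral_sub (hG.integrable_wip hχ hu hv) (hG.integrable_wip hχ hw hv)]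
  refine integral_congr_ae (Eventually.of_forall fun x => ?_)
  simp only [sub_mul, Complex.sub_re]; ring

lemma wip_sub_right (hG : Gibbs U μ) (hχ : IsCut χ) {u w v : Eu n → ℂ} (hu : Smth u) (hw : Smth w)
    (hv : Smth v) : wip μ χ v (fun x => u x - w x) = wip μ χ v u - wip μ χ v w := by
  rw [wip_comm hG hχ hv (hu.sub hw), wip_sub_left hG hχ hu hw hv, wip_comm hG hχ hu hv,
    wip_comm hG hχ hw hv]

lemma wsq_sub (hG : Gibbs U μ) (hχ : IsCut χ) {u v : Eu n → ℂ} (hu : Smth u) (hv : Smth v) :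
    wsq μ χ (fun x => u x - v x) = wsq μ χ u - 2 * wip μ χ u v + wsq μ χ v := by
  rw [← wip_self hG hχ (hu.sub hv), wip_sub_left hG hχ hu hv (hu.sub hv),
    wip_sub_right hG hχ hu hv hu, wip_sub_right hG hχ hu hv hv, wip_self hG hχ hu,
    wip_self hG hχ hv, wip_comm hG hχ hv hu]
  ring

lemma LSE.exists_wip_lip (hG : Gibbs U μ) (h : LSE U μ lam φ) (hχ : IsCut χ) {c : ℝ} (hc0 : 0 ≤ c)
    (hc : ∀ x, ∑ j, pdR n χ j x ^ 2 ≤ c ^ 2) {a b C : ℝ} (hB : Bd μ φ a b C) :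
    ∃ A : ℝ, 0 ≤ A ∧ ∀ s ∈ Icc a b, ∀ t ∈ Icc a b, ∀ v : Eu n → ℂ, Smth v →
      Integrable (gradSqC n v) μ →
      |wip μ χ (φ t) v - wip μ χ (φ s) v| ≤ A * (√(wsq μ χ v) + √(dir μ v)) * |t - s| := by
  obtain ⟨A, hA0, hA⟩ := h.exists_lip hG hχ hc0 hc hB
  refine ⟨A, hA0, fun s hs t ht v hv hi => ?_⟩
  have := hA s hs t ht _ hv.conj (by rwa [gradSqC_conj])
  rw [wsq_conj, dir_conj] at this
  refine le_trans ?_ this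
  rw [wip, wip, ← Complex.sub_re]
  exact Complex.abs_re_le_norm _

lemma continuousOn_of_lip {f : ℝ → ℝ} {S : Set ℝ} {A : ℝ}
    (h : ∀ s ∈ S, ∀ t ∈ S, |f t - f s| ≤ A * |t - s|) : ContinuousOn f S :=
  (LipschitzOnWith.of_dist_le_mul (K := A.toNNReal) fun x hx y hy => by
    rw [Real.dist_eq, Real.dist_eq]
    exact (h y hy x hx).trans (by gcongr; exact Real.le_coe_toNNReal A)).continuousOn

lemma LSE.continuousOn_wsq (hG : Gibbs U μ) (h : LSE U μ lam φ) (hχ : IsCut χ) {c : ℝ} (hc0 : 0 ≤ c)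
    (hc : ∀ x, ∑ j, pdR n χ j x ^ 2 ≤ c ^ 2) {a b C : ℝ} (hB : Bd μ φ a b C) :
    ContinuousOn (fun t => wsq μ χ (φ t)) (Icc a b) := by
  obtain ⟨A, hA0, hA⟩ := h.exists_wip_lip hG hχ hc0 hc hB
  refine continuousOn_of_lip (A := 2 * (A * (√C + √C))) fun s hs t ht => ?_
  have hb : ∀ v ∈ Icc a b, A * (√(wsq μ χ (φ v)) + √(dir μ (φ v))) ≤ A * (√C + √C) := fun v hv => by
    have h1 := (wsq_le_nsq hG hχ (h.smth v) (h.mass v)).trans (hB v hv).1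
    have h2 := (hB v hv).2.1
    gcongr
  have e : wsq μ χ (φ t) - wsq μ χ (φ s) = (wip μ χ (φ t) (φ t) - wip μ χ (φ s) (φ t))
      + (wip μ χ (φ t) (φ s) - wip μ χ (φ s) (φ s)) := by
    rw [wip_self hG hχ (h.smth t), wip_self hG hχ (h.smth s), wip_comm hG hχ (h.smth s) (h.smth t)]
    ring
  have h1 := hA s hs t ht (φ t) (h.smth t) (h.grad t)
  have h2 := hA s hs t ht (φ s) (h.smth s) (h.grad s)
  have h3 := mul_le_mul_of_nonneg_right (hb t ht) (abs_nonneg (t - s))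
  have h4 := mul_le_mul_of_nonneg_right (hb s hs) (abs_nonneg (t - s))
  rw [e]
  refine (abs_add_le _ _).trans ?_
  linarith

lemma pair_dual_self (u : Eu n → ℂ) :
    pair μ u (dual χ u) = (wsq μ χ u : ℂ) := by
  unfold pair wsq
  rw [← integral_complex_ofReal]
  refine integral_congr_ae (Eventually.of_forall fun x => ?_)
  simp only [dual]
  rw [show u x * (((χ x ^ 2 : ℝ) : ℂ) * conj (u x)) = ((χ x ^ 2 : ℝ) : ℂ) * (u x * conj (u x)) by ring,
    Complex.mul_conj, Complex.normSq_eq_norm_sq]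
  push_cast; ring

lemma pair_nl_dual_im (hG : Gibbs U μ) (hχ : IsCut χ) {u : Eu n → ℂ} (hu : Smth u) :
    (pair μ (fun x => nl (u x)) (dual χ u)).im = 0 := by
  have e : (pair μ (fun x => nl (u x)) (dual χ u)).im = ∫ x, (nl (u x) * dual χ u x).im ∂μ :=
    (integral_im (hG.integrable_mul (continuous_nl_comp hu) (hχ.dual_test hu))).symm
  rw [e]
  refine integral_eq_zero_of_ae (Eventually.of_forall fun x => ?_)
  simp only [nl, dual, Pi.zero_apply]
  rw [show u x * (Real.log (‖u x‖ ^ 2) : ℂ) * (((χ x ^ 2 : ℝ) : ℂ) * conj (u x))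
    = (Real.log (‖u x‖ ^ 2) : ℂ) * ((χ x ^ 2 : ℝ) : ℂ) * (u x * conj (u x)) by ring, Complex.mul_conj,
    ← Complex.ofReal_mul, ← Complex.ofReal_mul, Complex.ofReal_im]

lemma pair_LopC (hG : Gibbs U μ) {u η : Eu n → ℂ} (hu : Smth u) (hη : IsTest η) :
    pair μ u (LopC n U η) = - ∑ j, ∫ x, pdC n u j x * pdC n η j x ∂μ := by
  unfold pair; rw [← hG.symm hu hη, hG.green hu hη]

lemma LSE.wsq_dini (hG : Gibbs U μ) (h : LSE U μ lam φ) (hχ : IsCut χ) {c : ℝ} (hc0 : 0 ≤ c)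
    (hc : ∀ x, ∑ j, pdR n χ j x ^ 2 ≤ c ^ 2) {a b C : ℝ} (hB : Bd μ φ a b C) {s : ℝ}
    (hs : s ∈ Icc a b) {ρ : ℝ} (hρ : 0 < ρ) :
    ∀ᶠ t in 𝓝[Icc a b] s, wsq μ χ (φ s) - (4 * c * C + ρ) * |t - s| ≤ wsq μ χ (φ t) := by
  have hη := hχ.dual_test (h.smth s)
  set η := dual χ (φ s) with hηd
  have hw := wsq_le_nsq hG hχ (h.smth s) (h.mass s)
  have c1 := h.continuousOn_pair hG (fun r hr => (hB r hr).1) (hη.LopC hG.smooth) s hs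
  have c2 := h.continuousOn_pair_nl hG hB hη s hs
  have c3 := h.continuousOn_pair hG (fun r hr => (hB r hr).1) hη s hs
  have l1 : Tendsto (fun r => |(pair μ (φ r) (LopC n U η)).im|
      + |lam| * |(pair μ (fun x => nl (φ r x)) η).im| + |lam| * |C| * |(pair μ (φ r) η).im|)
      (𝓝[Icc a b] s) (𝓝 (|(pair μ (φ s) (LopC n U η)).im|
      + |lam| * |(pair μ (fun x => nl (φ s x)) η).im| + |lam| * |C| * |(pair μ (φ s) η).im|)) := by
    have im : ∀ {F : ℝ → ℂ}, ContinuousWithinAt F (Icc a b) s →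
        Tendsto (fun r => |(F r).im|) (𝓝[Icc a b] s) (𝓝 |(F s).im|) := fun hF =>
      ((Complex.continuous_im.tendsto _).comp hF).abs
    exact ((im c1).add ((im c2).const_mul _)).add ((im c3).const_mul _)
  have hval : |(pair μ (φ s) (LopC n U η)).im| + |lam| * |(pair μ (fun x => nl (φ s x)) η).im|
      + |lam| * |C| * |(pair μ (φ s) η).im| ≤ 2 * c * C := by
    rw [hηd, pair_nl_dual_im hG hχ (h.smth s), pair_dual_self (φ s), Complex.ofReal_im,
      abs_zero, mul_zero, mul_zero, add_zero, add_zero, pair_LopC hG (h.smth s) hη, Complex.neg_im,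
      abs_neg]
    refine (abs_im_form_cut_le hG hχ hc0 hc (h.smth s) (h.grad s)).trans ?_
    have h1 : √(wsq μ χ (φ s)) ≤ √C := Real.sqrt_le_sqrt (hw.trans (hB s hs).1)
    have h2 : √(dir μ (φ s)) ≤ √C := Real.sqrt_le_sqrt (hB s hs).2.1
    have h0 : 0 ≤ C := (nsq_nonneg _).trans (hB s hs).1
    calc 2 * c * (√(wsq μ χ (φ s)) * √(dir μ (φ s))) ≤ 2 * c * (√C * √C) := by gcongr
      _ = 2 * c * C := by rw [Real.mul_self_sqrt h0]
  have hev : ∀ᶠ r in 𝓝[Icc a b] s, |(pair μ (dt φ r) η).re| ≤ 2 * c * C + ρ / 2 := by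
    filter_upwards [l1.eventually_lt_const (show _ < 2 * c * C + ρ / 2 by linarith),
      self_mem_nhdsWithin] with r hr hrI
    refine le_trans ?_ hr.le
    rw [h.pair_dt hG r hη]
    have hk : |kap μ φ r| ≤ |C| := (hB r hrI).2.2.trans (le_abs_self C)
    have e : (Complex.I * pair μ (φ r) (LopC n U η)
      - Complex.I * lam * pair μ (fun x => nl (φ r x)) η
      + Complex.I * lam * kap μ φ r * pair μ (φ r) η).re
      = -(pair μ (φ r) (LopC n U η)).im + lam * (pair μ (fun x => nl (φ r x)) η).im
        + -(lam * kap μ φ r * (pair μ (φ r) η).im) := by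
      simp [Complex.add_re, Complex.mul_re, Complex.mul_im]
    rw [e]
    refine (abs_add_le _ _).trans (add_le_add ((abs_add_le _ _).trans (add_le_add ?_ ?_)) ?_)
    · rw [abs_neg]
    · rw [abs_mul]
    · rw [abs_neg, abs_mul, abs_mul]; gcongr
  filter_upwards [h.re_increment hG hB hη hs hev] with t ht
  have h1 : |wip μ χ (φ t) (φ s) - wip μ χ (φ s) (φ s)| ≤ (2 * c * C + ρ / 2) * |t - s| := by
    rw [wip, wip, ← Complex.sub_re]; exact ht
  have h2 := wsq_nonneg (μ := μ) (χ := χ) (fun x => φ t x - φ s x)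
  rw [wsq_sub hG hχ (h.smth t) (h.smth s)] at h2
  rw [wip_self hG hχ (h.smth s)] at h1
  have := (abs_le.1 h1).1
  linarith

lemma LSE.wsq_le (hG : Gibbs U μ) (h : LSE U μ lam φ) (hχ : IsCut χ) {c : ℝ} (hc0 : 0 ≤ c)
    (hc : ∀ x, ∑ j, pdR n χ j x ^ 2 ≤ c ^ 2) {a b C : ℝ} (hB : Bd μ φ a b C) {s t : ℝ}
    (hs : s ∈ Icc a b) (ht : t ∈ Icc a b) : wsq μ χ (φ s) ≤ wsq μ χ (φ t) + 4 * c * C * |t - s| := by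
  have := gronwall_two_sided (f := fun t => - wsq μ χ (φ t)) (K := 0)
    (c := 4 * c * C) (h.continuousOn_wsq hG hχ hc0 hc hB).neg
    (fun s hs ρ hρ => by
      filter_upwards [h.wsq_dini hG hχ hc0 hc hB hs hρ] with t ht
      linarith) hs ht
  rw [gronwallBound_K0] at this
  linarith

/-- Conservation of mass. -/
lemma LSE.nsq_const (hG : Gibbs U μ) (h : LSE U μ lam φ) {a b C : ℝ} (hB : Bd μ φ a b C) {s t : ℝ}
    (hs : s ∈ Icc a b) (ht : t ∈ Icc a b) : nsq μ (φ t) = nsq μ (φ s) := by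
  obtain ⟨C0, hC0, χ, h1, h2, h3⟩ := exists_cut_seq n
  have key : ∀ {s t : ℝ}, s ∈ Icc a b → t ∈ Icc a b → nsq μ (φ s) ≤ nsq μ (φ t) := by
    intro s t hs ht
    have hk : ∀ k : ℕ, wsq μ (χ k) (φ s) ≤ wsq μ (χ k) (φ t) + 4 * (C0 / (k + 1)) * C * |t - s| :=
      fun k => h.wsq_le hG (h1 k) (by positivity) (h3 k) hB hs ht
    have l1 := tendsto_cut_integral h1 h2 (h.mass s)
    have l2 := tendsto_cut_integral h1 h2 (h.mass t)
    have l3 : Tendsto (fun k : ℕ => 4 * (C0 / ((k : ℝ) + 1)) * C * |t - s|) atTop (𝓝 0) := by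
      have := (tendsto_one_div_add_atTop_nhds_zero_nat (𝕜 := ℝ)).const_mul (4 * C0 * C * |t - s|)
      rw [mul_zero] at this
      refine this.congr fun k => ?_
      field_simp
    have l4 := l2.add l3
    rw [add_zero] at l4
    exact le_of_tendsto_of_tendsto' l1 l4 hk
  exact le_antisymm (key ht hs) (key hs ht)

end

section
variable {n : ℕ} {U : Eu n → ℝ} {μ : Measure (Eu n)} {lam : ℝ} {φ : ℝ → Eu n → ℂ} {χ : Eu n → ℝ}

/-- Smooth functions of finite Dirichlet energy. -/
structure Adm (μ : Measure (Eu n)) (v : Eu n → ℂ) : Prop where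
  smth : Smth v
  int : Integrable (gradSqC n v) μ

lemma IsTest.adm (hG : Gibbs U μ) {v : Eu n → ℂ} (hv : IsTest v) : Adm μ v :=
  ⟨hv.smth, hv.gradSq_integrable hG⟩

lemma LSE.adm (h : LSE U μ lam φ) (t : ℝ) : Adm μ (φ t) := ⟨h.smth t, h.grad t⟩

lemma gradSqC_sub_le {u v : Eu n → ℂ} (hu : Smth u) (hv : Smth v) (x : Eu n) :
    gradSqC n (fun y => u y - v y) x ≤ 2 * gradSqC n u x + 2 * gradSqC n v x := by
  simp only [gradSqC, Finset.mul_sum, ← Finset.sum_add_distrib]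
  refine Finset.sum_le_sum fun j _ => ?_
  rw [pdC_sub hu hv]; exact norm_sub_sq_le _ _

lemma Adm.sub {u v : Eu n → ℂ} (hu : Adm μ u) (hv : Adm μ v) : Adm μ (fun x => u x - v x) := by
  have hs : Smth (fun x => u x - v x) := hu.smth.sub hv.smth
  refine ⟨hs, ((hu.int.const_mul 2).add (hv.int.const_mul 2)).mono'
    hs.continuous_gradSq.aestronglyMeasurable (Eventually.of_forall fun x => ?_)⟩
  rw [Real.norm_of_nonneg (gradSqC_nonneg _ _)]
  exact gradSqC_sub_le hu.smth hv.smth x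

lemma dir_sub_le {u v : Eu n → ℂ} (hu : Adm μ u) (hv : Adm μ v) :
    dir μ (fun x => u x - v x) ≤ 2 * dir μ u + 2 * dir μ v := by
  unfold dir
  rw [← integral_const_mul, ← integral_const_mul,
    ← integral_add (hu.int.const_mul 2) (hv.int.const_mul 2)]
  exact integral_mono (hu.sub hv).int ((hu.int.const_mul 2).add (hv.int.const_mul 2))
    fun x => gradSqC_sub_le hu.smth hv.smth x

lemma Smth.const_mul {v : Eu n → ℂ} (hv : Smth v) (c : ℂ) : Smth (fun x => c * v x) :=
  (contDiff_const (c := c)).mul hv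

lemma gradSqC_const_mul {v : Eu n → ℂ} (hv : Smth v) (c : ℂ) (x : Eu n) :
    gradSqC n (fun y => c * v y) x = ‖c‖ ^ 2 * gradSqC n v x := by
  simp only [gradSqC, pdC_const_mul c hv, norm_mul, mul_pow, Finset.mul_sum]

lemma Adm.const_mul {v : Eu n → ℂ} (hv : Adm μ v) (c : ℂ) : Adm μ (fun x => c * v x) :=
  ⟨hv.smth.const_mul c, by
    rw [show gradSqC n (fun x => c * v x) = fun x => ‖c‖ ^ 2 * gradSqC n v x from
      funext (gradSqC_const_mul hv.smth c)]
    exact hv.int.const_mul _⟩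

lemma dir_const_mul {v : Eu n → ℂ} (hv : Smth v) (c : ℂ) :
    dir μ (fun x => c * v x) = ‖c‖ ^ 2 * dir μ v := by
  unfold dir; simp only [gradSqC_const_mul hv, integral_const_mul]

lemma wsq_const_mul (v : Eu n → ℂ) (c : ℂ) :
    wsq μ χ (fun x => c * v x) = ‖c‖ ^ 2 * wsq μ χ v := by
  unfold wsq
  rw [← integral_const_mul]
  refine integral_congr_ae (Eventually.of_forall fun x => ?_)
  simp only [norm_mul]; ring

lemma wip_real_mul (hG : Gibbs U μ) (hχ : IsCut χ) {u v : Eu n → ℂ} (hu : Smth u) (hv : Smth v)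
    (a : ℝ) : wip μ χ u (fun x => (a : ℂ) * v x) = a * wip μ χ u v := by
  rw [wip_eq hG hχ hu (hv.const_mul a), wip_eq hG hχ hu hv, ← integral_const_mul]
  refine integral_congr_ae (Eventually.of_forall fun x => ?_)
  simp only [map_mul, Complex.conj_ofReal]
  rw [show u x * ((a : ℂ) * conj (v x)) = (a : ℂ) * (u x * conj (v x)) by ring, Complex.re_ofReal_mul]
  ring

/-- The real Dirichlet form. -/
def dip (μ : Measure (Eu n)) (u v : Eu n → ℂ) : ℝ :=
  ∫ x, ∑ j, (pdC n u j x * conj (pdC n v j x)).re ∂μ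

lemma Adm.integrable_mul_conj {u v : Eu n → ℂ} (hu : Adm μ u) (hv : Adm μ v) (j : Fin n) :
    Integrable (fun x => pdC n u j x * conj (pdC n v j x)) μ := by
  refine integrable_mul_of_sq (hu.smth.pdC j).cont.aestronglyMeasurable
    (hv.smth.pdC j).conj.cont.aestronglyMeasurable (gradSq_pd_integrable hu.smth hu.int j) ?_
  simpa only [RCLike.norm_conj] using gradSq_pd_integrable hv.smth hv.int j

lemma Adm.integrable_dip {u v : Eu n → ℂ} (hu : Adm μ u) (hv : Adm μ v) :
    Integrable (fun x => ∑ j, (pdC n u j x * conj (pdC n v j x)).re) μ :=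
  integrable_finsetSum _ fun j _ => (hu.integrable_mul_conj hv j).re

lemma dip_sub_left {u w v : Eu n → ℂ} (hu : Adm μ u) (hw : Adm μ w) (hv : Adm μ v) :
    dip μ (fun x => u x - w x) v = dip μ u v - dip μ w v := by
  unfold dip
  rw [← integral_sub (hu.integrable_dip hv) (hw.integrable_dip hv)]
  refine integral_congr_ae (Eventually.of_forall fun x => ?_)
  simp only [pdC_sub hu.smth hw.smth, sub_mul, Complex.sub_re, Finset.sum_sub_distrib]

lemma dip_self (u : Eu n → ℂ) : dip μ u u = dir μ u := by
  unfold dip dir gradSqC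
  simp only [Complex.mul_conj, Complex.normSq_eq_norm_sq, Complex.ofReal_re]

lemma dir_sub_real_mul {u v : Eu n → ℂ} (hu : Adm μ u) (hv : Adm μ v) (a : ℝ) :
    dir μ (fun x => u x - (a : ℂ) * v x) = dir μ u - 2 * a * dip μ u v + a ^ 2 * dir μ v := by
  unfold dir dip
  have h1 := hu.int
  have h2 := (hu.integrable_dip hv).const_mul (2 * a)
  have h3 := hv.int.const_mul (a ^ 2)
  have h12 : Integrable (fun x => gradSqC n u x
    - 2 * a * ∑ j, (pdC n u j x * conj (pdC n v j x)).re) μ := h1.sub h2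
  rw [← integral_const_mul, ← integral_const_mul, ← integral_sub h1 h2, ← integral_add h12 h3]
  refine integral_congr_ae (Eventually.of_forall fun x => ?_)
  simp only [gradSqC, Finset.mul_sum, ← Finset.sum_sub_distrib, ← Finset.sum_add_distrib]
  refine Finset.sum_congr rfl fun j _ => ?_
  rw [pdC_sub hu.smth (hv.smth.const_mul a), pdC_const_mul a hv.smth]
  simp only [← Complex.normSq_eq_norm_sq, Complex.normSq_apply, Complex.sub_re, Complex.sub_im,
    Complex.mul_re, Complex.mul_im, Complex.ofReal_re, Complex.ofReal_im, Complex.conj_re,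
    Complex.conj_im]
  ring

/-- The quadratic form of the regularised problem. -/
def qf (μ : Measure (Eu n)) (χ : Eu n → ℝ) (ε : ℝ) (v : Eu n → ℂ) : ℝ := wsq μ χ v + ε * dir μ v

/-- The functional whose infimum is the regularised Dirichlet energy of `u`. -/
def fnl (μ : Measure (Eu n)) (χ : Eu n → ℝ) (ε : ℝ) (u w : Eu n → ℂ) : ℝ :=
  wsq μ χ (fun x => u x - w x) + ε * dir μ w

/-- `w` minimises `fnl μ χ ε u` up to an error `κ`. -/
structure NearMin (μ : Measure (Eu n)) (χ : Eu n → ℝ) (ε : ℝ) (u : Eu n → ℂ) (κ : ℝ)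
    (w : Eu n → ℂ) : Prop where
  adm : Adm μ w
  le : ∀ v, Adm μ v → fnl μ χ ε u w ≤ fnl μ χ ε u v + κ

lemma NearMin.abs_le (hG : Gibbs U μ) (hχ : IsCut χ) {ε κ : ℝ} {u w η : Eu n → ℂ} (hu : Smth u)
    (hw : NearMin μ χ ε u κ w) (hη : Adm μ η) :
    |wip μ χ (fun x => u x - w x) η - ε * dip μ w η| ≤ √κ * √(qf μ χ ε η) := by
  have hκ : 0 ≤ κ := by have := hw.le w hw.adm; linarith
  set X := wip μ χ (fun x => u x - w x) η - ε * dip μ w η with hX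
  have h : ∀ a : ℝ, 0 ≤ qf μ χ ε η * (a * a) + (2 * X) * a + κ := by
    intro a
    have h1 := hw.le _ (hw.adm.sub (hη.const_mul (a : ℂ)))
    unfold fnl at h1
    have e : (fun x => u x - (w x - (a : ℂ) * η x))
        = fun x => (u x - w x) - (((-a : ℝ) : ℂ) * η x) := by
      funext x; push_cast; ring
    rw [e, wsq_sub hG hχ (hu.sub hw.adm.smth) (hη.smth.const_mul _),
      wip_real_mul hG hχ (hu.sub hw.adm.smth) hη.smth, wsq_const_mul,
      dir_sub_real_mul hw.adm hη, Complex.norm_real, Real.norm_eq_abs, sq_abs] at h1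
    unfold qf; rw [hX]; nlinarith
  have := discrim_le_zero h
  unfold discrim at this
  rw [← Real.sqrt_mul hκ]
  refine Real.le_sqrt_of_sq_le ?_
  rw [sq_abs]; nlinarith

lemma NearMin.qf_sub_le (hG : Gibbs U μ) (hχ : IsCut χ) {ε κ κ' : ℝ} (hε : 0 ≤ ε)
    {u w w' : Eu n → ℂ} (hu : Smth u)
    (hw : NearMin μ χ ε u κ w) (hw' : NearMin μ χ ε u κ' w') :
    √(qf μ χ ε (fun x => w' x - w x)) ≤ √κ + √κ' := by
  have hη := hw'.adm.sub hw.adm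
  set η := fun x => w' x - w x with hηd
  have hq : 0 ≤ qf μ χ ε η := add_nonneg (wsq_nonneg _) (mul_nonneg hε (dir_nonneg _))
  have h1 := hw.abs_le hG hχ hu hη
  have h2 := hw'.abs_le hG hχ hu hη
  have s1 := hw.adm.smth
  have s2 := hw'.adm.smth
  rw [wip_sub_left hG hχ hu s1 hη.smth] at h1
  rw [wip_sub_left hG hχ hu s2 hη.smth] at h2
  have e1 : wsq μ χ η = wip μ χ w' η - wip μ χ w η := by
    rw [← wip_self hG hχ hη.smth, hηd, wip_sub_left hG hχ s2 s1 hη.smth]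
  have e2 : dir μ η = dip μ w' η - dip μ w η := by
    rw [← dip_self, hηd, dip_sub_left hw'.adm hw.adm hη]
  have h3 : qf μ χ ε η ≤ (√κ + √κ') * √(qf μ χ ε η) := by
    have := (_root_.abs_le.1 h1).2
    have := (_root_.abs_le.1 h2).1
    have e : qf μ χ ε η = wip μ χ w' η - wip μ χ w η + ε * (dip μ w' η - dip μ w η) := by
      rw [qf, e1, e2]
    linarith
  by_contra! hlt
  have hpos : 0 < √(qf μ χ ε η) := lt_of_le_of_lt (by positivity) hlt
  nlinarith [Real.mul_self_sqrt hq]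

end

section
variable {n : ℕ} {U : Eu n → ℝ} {μ : Measure (Eu n)} {lam : ℝ} {φ : ℝ → Eu n → ℂ} {χ : Eu n → ℝ}

/-- Smooth bounded multipliers `ψ` for which `z ↦ z ψ(z)` has the structure of the logarithmic
nonlinearity. -/
structure Mult (ψ : ℂ → ℝ) (M : ℝ) : Prop where
  smooth : ContDiff ℝ (⊤ : ℕ∞) ψ
  bd : ∀ z, |ψ z| ≤ M
  im_le : ∀ z v, |(z * conj v).im * fderiv ℝ ψ z v| ≤ ‖v‖ ^ 2
  norm_le : ∀ z v, ‖z‖ * |fderiv ℝ ψ z v| ≤ 2 * ‖v‖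

section
variable {ψ : ℂ → ℝ} {M : ℝ}

lemma Mult.abs_im_sub_le (hψ : Mult ψ M) (z w : ℂ) :
    |((z * ψ z - w * ψ w) * conj (z - w)).im| ≤ ‖z - w‖ ^ 2 := by
  set v := z - w with hv
  have hd : ∀ t : ℝ, HasDerivAt (fun t : ℝ => (w * conj v).im * ψ (w + t * v))
      ((w * conj v).im * fderiv ℝ ψ (w + t * v) v) t := by
    intro t
    have h1 : HasDerivAt (fun t : ℝ => w + t * v) v t := by
      have := ((Complex.ofRealCLM.hasDerivAt (x := t)).mul_const v).const_add w
      simpa using this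
    have h2 := (hψ.smooth.differentiable (by simp) (w + t * v)).hasFDerivAt.comp_hasDerivAt t h1
    exact h2.const_mul _
  have him : ∀ t : ℝ, ((w + t * v) * conj v).im = (w * conj v).im := fun t => by
    rw [add_mul, mul_assoc, Complex.mul_conj, ← Complex.ofReal_mul, Complex.add_im,
      Complex.ofReal_im, add_zero]
  have := norm_image_sub_le_of_norm_deriv_le_segment_01' (C := ‖v‖ ^ 2)
    (fun t _ => (hd t).hasDerivWithinAt) (fun t _ => by
      rw [Real.norm_eq_abs, ← him t]; exact hψ.im_le _ _)
  simp only [Complex.ofReal_one, one_mul, Complex.ofReal_zero, zero_mul, add_zero,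
    Real.norm_eq_abs] at this
  have e : w + v = z := by rw [hv]; ring
  rw [e] at this
  refine le_of_eq_of_le ?_ this
  congr 1
  have h1 : (z * conj v).im = (w * conj v).im := by
    have := him 1; simpa [e] using this
  rw [sub_mul, Complex.sub_im, ← h1]
  rw [show z * (ψ z : ℂ) * conj v = (ψ z : ℂ) * (z * conj v) by ring,
    show w * (ψ w : ℂ) * conj v = (ψ w : ℂ) * (w * conj v) by ring, Complex.im_ofReal_mul,
    Complex.im_ofReal_mul, h1]
  ring

lemma Mult.smth (hψ : Mult ψ M) {w : Eu n → ℂ} (hw : Smth w) : Smth (fun x => w x * ψ (w x)) :=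
  hw.mul (Smth.ofReal (hψ.smooth.comp hw))

lemma Mult.pdC_eq (hψ : Mult ψ M) {w : Eu n → ℂ} (hw : Smth w) (j : Fin n) (x : Eu n) :
    pdC n (fun x => w x * ψ (w x)) j x
      = w x * (fderiv ℝ ψ (w x) (pdC n w j x) : ℝ) + pdC n w j x * ψ (w x) := by
  have hs : ContDiff ℝ (⊤ : ℕ∞) (fun x => ψ (w x)) := hψ.smooth.comp hw
  rw [pdC_mul hw (Smth.ofReal hs), pdC_ofReal hs]
  congr 3
  unfold pdR pdC
  have := fderiv_comp x (hψ.smooth.differentiable (by simp) (w x)) (hw.differentiable x)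
  rw [show (fun x => ψ (w x)) = ψ ∘ w from rfl, this]; rfl

lemma Mult.norm_pdC_le (hψ : Mult ψ M) {w : Eu n → ℂ} (hw : Smth w) (j : Fin n) (x : Eu n) :
    ‖pdC n (fun x => w x * ψ (w x)) j x‖ ≤ (2 + M) * ‖pdC n w j x‖ := by
  rw [hψ.pdC_eq hw, add_mul]
  refine (norm_add_le _ _).trans (add_le_add ?_ ?_)
  · rw [norm_mul, Complex.norm_real]; exact hψ.norm_le _ _
  · rw [norm_mul, Complex.norm_real, mul_comm]
    exact mul_le_mul_of_nonneg_right (hψ.bd _) (norm_nonneg _)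

lemma Mult.abs_im_pdC_le (hψ : Mult ψ M) {w : Eu n → ℂ} (hw : Smth w) (j : Fin n) (x : Eu n) :
    |(pdC n w j x * conj (pdC n (fun x => w x * ψ (w x)) j x)).im| ≤ ‖pdC n w j x‖ ^ 2 := by
  rw [hψ.pdC_eq hw]
  refine le_of_eq_of_le ?_ (hψ.im_le (w x) (pdC n w j x))
  rw [← abs_neg]
  congr 1
  simp only [map_add, map_mul, Complex.conj_ofReal, Complex.mul_im, Complex.add_re, Complex.add_im,
    Complex.mul_re, Complex.conj_re, Complex.conj_im, Complex.ofReal_re, Complex.ofReal_im]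
  ring

lemma Mult.gradSq_le (hψ : Mult ψ M) {w : Eu n → ℂ} (hw : Smth w) (x : Eu n) :
    gradSqC n (fun x => w x * ψ (w x)) x ≤ (2 + M) ^ 2 * gradSqC n w x := by
  simp only [gradSqC, Finset.mul_sum]
  refine Finset.sum_le_sum fun j _ => ?_
  rw [← mul_pow]
  exact pow_le_pow_left₀ (norm_nonneg _) (hψ.norm_pdC_le hw j x) 2

lemma Mult.adm (hψ : Mult ψ M) {w : Eu n → ℂ} (hw : Adm μ w) : Adm μ (fun x => w x * ψ (w x)) := by
  refine ⟨hψ.smth hw.smth, (hw.int.const_mul ((2 + M) ^ 2)).mono'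
    (hψ.smth hw.smth).continuous_gradSq.aestronglyMeasurable (Eventually.of_forall fun x => ?_)⟩
  rw [Real.norm_of_nonneg (gradSqC_nonneg _ _)]
  exact hψ.gradSq_le hw.smth x

lemma Mult.dir_le (hψ : Mult ψ M) {w : Eu n → ℂ} (hw : Adm μ w) :
    dir μ (fun x => w x * ψ (w x)) ≤ (2 + M) ^ 2 * dir μ w := by
  unfold dir
  rw [← integral_const_mul]
  exact integral_mono (hψ.adm hw).int (hw.int.const_mul _) (hψ.gradSq_le hw.smth)

lemma Mult.wsq_le (hψ : Mult ψ M) (hG : Gibbs U μ) (hχ : IsCut χ) {w : Eu n → ℂ} (hw : Smth w) :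
    wsq μ χ (fun x => w x * ψ (w x)) ≤ (2 + M) ^ 2 * wsq μ χ w := by
  unfold wsq
  rw [← integral_const_mul]
  refine integral_mono ((hψ.smth hw).wsq_integrable hG hχ) ((hw.wsq_integrable hG hχ).const_mul _)
    fun x => ?_
  simp only [norm_mul, Complex.norm_real, mul_pow, Real.norm_eq_abs]
  have h1 : |ψ (w x)| ^ 2 ≤ (2 + M) ^ 2 :=
    pow_le_pow_left₀ (abs_nonneg _) ((hψ.bd _).trans (by linarith)) 2
  have h2 : 0 ≤ χ x ^ 2 * ‖w x‖ ^ 2 := by positivity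
  nlinarith

/-- The form `w ↦ Im ⟨∇w, ∇(w ψ(w))⟩` is controlled by the Dirichlet energy. -/
lemma Mult.abs_dip_le (hψ : Mult ψ M) {w : Eu n → ℂ} (hw : Adm μ w) :
    |dip μ w (fun x => Complex.I * (w x * ψ (w x)))| ≤ dir μ w := by
  unfold dip dir
  rw [← Real.norm_eq_abs]
  refine norm_integral_le_of_norm_le hw.int (Eventually.of_forall fun x => ?_)
  refine (norm_sum_le _ _).trans (Finset.sum_le_sum fun j _ => ?_)
  rw [pdC_const_mul _ (hψ.smth hw.smth), Real.norm_eq_abs]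
  refine le_of_eq_of_le ?_ (hψ.abs_im_pdC_le hw.smth j x)
  congr 1
  simp [Complex.mul_re, Complex.mul_im]
  ring

end

/-- A bounded regularisation of the logarithm. -/
def regLog (δ r : ℝ) : ℝ := Real.log (r + δ) - Real.log (1 + δ * r)

lemma regLog_eq {δ r : ℝ} (hδ : 0 < δ) (hr : 0 ≤ r) : regLog δ r = Real.log ((r + δ) / (1 + δ * r)) := by
  rw [Real.log_div (by positivity) (by positivity)]; rfl

lemma abs_regLog_le {δ r : ℝ} (hδ : 0 < δ) (h1 : δ ≤ 1) (hr : 0 ≤ r) : |regLog δ r| ≤ -Real.log δ := by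
  rw [regLog_eq hδ hr, abs_le, neg_neg, ← Real.log_inv]
  have hp : 0 < 1 + δ * r := by positivity
  refine ⟨Real.log_le_log hδ ?_, Real.log_le_log (by positivity) ?_⟩
  · rw [le_div_iff₀ hp]; nlinarith [mul_nonneg hr (sub_nonneg.2 h1), mul_nonneg hδ.le hr]
  · rw [div_le_iff₀ hp, inv_mul_eq_div, le_div_iff₀ hδ]; nlinarith [mul_nonneg hr (sub_nonneg.2 h1)]

lemma abs_regLog_le_abs_log {δ r : ℝ} (hδ : 0 < δ) (h1 : δ ≤ 1) (hr : 0 < r) :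
    |regLog δ r| ≤ |Real.log r| := by
  rw [regLog_eq hδ hr.le]
  have hp : 0 < 1 + δ * r := by positivity
  rcases le_total 1 r with h | h
  · have h2 : 1 ≤ (r + δ) / (1 + δ * r) := by rw [le_div_iff₀ hp]; nlinarith
    rw [abs_of_nonneg (Real.log_nonneg h2), abs_of_nonneg (Real.log_nonneg h)]
    refine Real.log_le_log (by positivity) ?_
    rw [div_le_iff₀ hp]; nlinarith [mul_nonneg hδ.le (sub_nonneg.2 h)]
  · have h2 : (r + δ) / (1 + δ * r) ≤ 1 := by rw [div_le_iff₀ hp]; nlinarith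
    rw [abs_of_nonpos (Real.log_nonpos (by positivity) h2), abs_of_nonpos (Real.log_nonpos hr.le h)]
    refine neg_le_neg (Real.log_le_log hr ?_)
    rw [le_div_iff₀ hp]; nlinarith [mul_nonneg hδ.le (sub_nonneg.2 h)]

lemma tendsto_regLog {r : ℝ} (hr : 0 < r) : Tendsto (fun δ => regLog δ r) (𝓝 0) (𝓝 (Real.log r)) := by
  have : ContinuousAt (fun δ => regLog δ r) 0 := by
    unfold regLog
    refine ContinuousAt.sub (ContinuousAt.log (by fun_prop) (by simp [hr.ne']))
      (ContinuousAt.log (by fun_prop) (by simp))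
  simpa [ContinuousAt, regLog] using this

lemma hasFDerivAt_normSq (z : ℂ) :
    HasFDerivAt (fun z : ℂ => ‖z‖ ^ 2) (2 • (innerSL ℝ z)) z := (hasStrictFDerivAt_norm_sq z).hasFDerivAt

lemma mult_regLog {δ : ℝ} (hδ : 0 < δ) (h1 : δ ≤ 1) (k : ℝ) :
    Mult (fun z => regLog δ (‖z‖ ^ 2) - k) (-Real.log δ + |k|) := by
  have p1 : ∀ z : ℂ, 0 < ‖z‖ ^ 2 + δ := fun z => by positivity
  have p2 : ∀ z : ℂ, 0 < 1 + δ * ‖z‖ ^ 2 := fun z => by positivity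
  have hd : ∀ z v : ℂ, fderiv ℝ (fun z : ℂ => regLog δ (‖z‖ ^ 2) - k) z v
      = ((‖z‖ ^ 2 + δ)⁻¹ - δ * (1 + δ * ‖z‖ ^ 2)⁻¹) * (2 * (z * conj v).re) := by
    intro z v
    have a1 := ((hasFDerivAt_normSq z).add_const δ).log (p1 z).ne'
    have a2 := (((hasFDerivAt_normSq z).const_mul δ).const_add 1).log (p2 z).ne'
    have a3 : HasFDerivAt (fun z : ℂ => regLog δ (‖z‖ ^ 2) - k) _ z := (a1.sub a2).sub_const k
    rw [a3.fderiv]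
    simp [innerSL_apply_apply, Complex.inner, Complex.mul_re]
    ring
  have hr : ∀ z : ℂ, ‖z‖ ^ 2 * |(‖z‖ ^ 2 + δ)⁻¹ - δ * (1 + δ * ‖z‖ ^ 2)⁻¹| ≤ 1 := by
    intro z
    have q1 : ‖z‖ ^ 2 * (‖z‖ ^ 2 + δ)⁻¹ ≤ 1 := by
      rw [← div_eq_mul_inv, div_le_one (p1 z)]; linarith
    have q2 : ‖z‖ ^ 2 * (δ * (1 + δ * ‖z‖ ^ 2)⁻¹) ≤ 1 := by
      rw [← mul_assoc, ← div_eq_mul_inv, div_le_one (p2 z)]; linarith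
    have q3 : 0 ≤ ‖z‖ ^ 2 * (‖z‖ ^ 2 + δ)⁻¹ := by have := p1 z; positivity
    have q4 : 0 ≤ ‖z‖ ^ 2 * (δ * (1 + δ * ‖z‖ ^ 2)⁻¹) := by have := p2 z; positivity
    rw [← abs_of_nonneg (sq_nonneg ‖z‖), ← abs_mul, abs_of_nonneg (sq_nonneg ‖z‖), mul_sub, abs_le]
    constructor <;> linarith
  refine ⟨?_, fun z => ?_, fun z v => ?_, fun z v => ?_⟩
  · have hn : ContDiff ℝ (⊤ : ℕ∞) (fun z : ℂ => ‖z‖ ^ 2) := contDiff_norm_sq ℝ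
    exact (((hn.add contDiff_const).log fun z => (p1 z).ne').sub
      ((contDiff_const.add (contDiff_const.mul hn)).log fun z => (p2 z).ne')).sub contDiff_const
  · exact (abs_sub _ _).trans (add_le_add (abs_regLog_le hδ h1 (sq_nonneg _)) le_rfl)
  · rw [hd, abs_mul, abs_mul]
    set q := |(‖z‖ ^ 2 + δ)⁻¹ - δ * (1 + δ * ‖z‖ ^ 2)⁻¹|
    have h3 : |(z * conj v).im| * |2 * (z * conj v).re| ≤ ‖z‖ ^ 2 * ‖v‖ ^ 2 := by
      rw [abs_mul, abs_two]
      have : ‖z * conj v‖ ^ 2 = ‖z‖ ^ 2 * ‖v‖ ^ 2 := by rw [norm_mul, RCLike.norm_conj, mul_pow]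
      rw [← this, ← Complex.normSq_eq_norm_sq, Complex.normSq_apply]
      nlinarith [sq_nonneg (|(z * conj v).im| - |(z * conj v).re|), sq_abs (z * conj v).im,
        sq_abs (z * conj v).re]
    calc |(z * conj v).im| * (q * |2 * (z * conj v).re|)
        = q * (|(z * conj v).im| * |2 * (z * conj v).re|) := by ring
      _ ≤ q * (‖z‖ ^ 2 * ‖v‖ ^ 2) := mul_le_mul_of_nonneg_left h3 (abs_nonneg _)
      _ = (‖z‖ ^ 2 * q) * ‖v‖ ^ 2 := by ring
      _ ≤ 1 * ‖v‖ ^ 2 := mul_le_mul_of_nonneg_right (hr z) (sq_nonneg _)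
      _ = _ := one_mul _
  · rw [hd, abs_mul]
    set q := |(‖z‖ ^ 2 + δ)⁻¹ - δ * (1 + δ * ‖z‖ ^ 2)⁻¹|
    have h3 : |2 * (z * conj v).re| ≤ 2 * (‖z‖ * ‖v‖) := by
      rw [abs_mul, abs_two]
      have := Complex.abs_re_le_norm (z * conj v)
      rw [norm_mul, RCLike.norm_conj] at this
      linarith
    calc ‖z‖ * (q * |2 * (z * conj v).re|) ≤ ‖z‖ * (q * (2 * (‖z‖ * ‖v‖))) := by gcongr
      _ = (‖z‖ ^ 2 * q) * (2 * ‖v‖) := by ring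
      _ ≤ 1 * (2 * ‖v‖) := mul_le_mul_of_nonneg_right (hr z) (by positivity)
      _ = _ := one_mul _

/-- The regularised nonlinearity approximates the logarithmic one in the localised `L²` norm. -/
lemma tendsto_wsq_regLog (hG : Gibbs U μ) (hχ : IsCut χ) {u : Eu n → ℂ} (hu : Smth u) (k : ℝ) :
    Tendsto (fun δ => wsq μ χ (fun x => nl (u x) - k * u x
      - u x * ((regLog δ (‖u x‖ ^ 2) - k : ℝ) : ℂ))) (𝓝[>] 0) (𝓝 0) := by
  rw [show 𝓝 (0 : ℝ) = 𝓝 (∫ _x : Eu n, (0 : ℝ) ∂μ) by simp]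
  unfold wsq
  have hnl := continuous_nl_comp hu
  have key : ∀ (δ : ℝ) x, ‖nl (u x) - k * u x - u x * ((regLog δ (‖u x‖ ^ 2) - k : ℝ) : ℂ)‖
      = ‖u x‖ * |Real.log (‖u x‖ ^ 2) - regLog δ (‖u x‖ ^ 2)| := by
    intro δ x
    rw [nl, ← Real.norm_eq_abs, ← Complex.norm_real, ← norm_mul]
    congr 1; push_cast; ring
  refine tendsto_integral_filter_of_dominated_convergence
    (fun x => χ x ^ 2 * (4 * ‖nl (u x)‖ ^ 2)) ?_ ?_ ?_ ?_
  · filter_upwards [self_mem_nhdsWithin] with δ hδ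
    have hδ : 0 < δ := hδ
    have c : Continuous (fun x => regLog δ (‖u x‖ ^ 2)) := by
      have hn : Continuous fun x => ‖u x‖ ^ 2 := hu.cont.norm.pow 2
      unfold regLog
      refine ((hn.add continuous_const).log fun x => ?_).sub
        ((continuous_const.add (continuous_const.mul hn)).log fun x => ?_)
      · exact (show 0 < ‖u x‖ ^ 2 + δ by positivity).ne'
      · exact (show 0 < 1 + δ * ‖u x‖ ^ 2 by positivity).ne'
    refine Continuous.aestronglyMeasurable ?_
    have := hu.cont
    have := hχ.smooth.continuous
    fun_prop
  · have : Ioc (0 : ℝ) 1 ∈ 𝓝[>] (0 : ℝ) := Ioc_mem_nhdsGT one_pos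
    filter_upwards [this] with δ hδ
    refine Eventually.of_forall fun x => ?_
    rw [Real.norm_of_nonneg (by positivity), key]
    refine mul_le_mul_of_nonneg_left ?_ (sq_nonneg _)
    rcases eq_or_ne (u x) 0 with hz | hz
    · rw [hz]; simp
    · have hp : 0 < ‖u x‖ ^ 2 := by positivity
      have h1 := abs_regLog_le_abs_log hδ.1 hδ.2 hp
      have h2 : |Real.log (‖u x‖ ^ 2) - regLog δ (‖u x‖ ^ 2)| ≤ 2 * |Real.log (‖u x‖ ^ 2)| :=
        (abs_sub _ _).trans (by linarith)
      have h3 : ‖nl (u x)‖ = ‖u x‖ * |Real.log (‖u x‖ ^ 2)| := by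
        rw [nl, norm_mul, Complex.norm_real, Real.norm_eq_abs]
      rw [h3]
      calc (‖u x‖ * |Real.log (‖u x‖ ^ 2) - regLog δ (‖u x‖ ^ 2)|) ^ 2
          ≤ (‖u x‖ * (2 * |Real.log (‖u x‖ ^ 2)|)) ^ 2 := by gcongr
        _ = _ := by ring
  · exact hG.integrable_cut_sq hχ (continuous_const.mul (hnl.norm.pow 2))
  · refine Eventually.of_forall fun x => ?_
    rw [show (0 : ℝ) = χ x ^ 2 * 0 by ring]
    refine Tendsto.const_mul _ ?_
    simp only [key]
    rcases eq_or_ne (u x) 0 with hz | hz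
    · simp [hz]
    · have hp : 0 < ‖u x‖ ^ 2 := by positivity
      have l1 : Tendsto (fun δ => regLog δ (‖u x‖ ^ 2)) (𝓝[>] 0) (𝓝 (Real.log (‖u x‖ ^ 2))) :=
        (tendsto_regLog hp).mono_left nhdsWithin_le_nhds
      have l2 := (((tendsto_const_nhds (x := Real.log (‖u x‖ ^ 2))).sub l1).abs.const_mul ‖u x‖).pow 2
      simpa using l2

end

section
variable {n : ℕ} {U : Eu n → ℝ} {μ : Measure (Eu n)} {lam : ℝ} {φ : ℝ → Eu n → ℂ} {χ : Eu n → ℝ}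

lemma dip_I_mul {u v : Eu n → ℂ} (hu : Adm μ u) (hv : Adm μ v) :
    dip μ u (fun x => Complex.I * v x) = (∑ j, ∫ x, pdC n u j x * conj (pdC n v j x) ∂μ).im := by
  rw [← integral_finsetSum _ fun j _ => hu.integrable_mul_conj hv j]
  have e : (∫ x, ∑ j, pdC n u j x * conj (pdC n v j x) ∂μ).im
      = ∫ x, (∑ j, pdC n u j x * conj (pdC n v j x)).im ∂μ :=
    (integral_im (integrable_finsetSum _ fun j _ => hu.integrable_mul_conj hv j)).symm
  rw [e]
  refine integral_congr_ae (Eventually.of_forall fun x => ?_)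
  simp only [Complex.im_sum]
  refine Finset.sum_congr rfl fun j _ => ?_
  rw [pdC_const_mul _ hv.smth]
  simp [Complex.mul_re, Complex.mul_im]
  ring

lemma pair_dual_im (hG : Gibbs U μ) (hχ : IsCut χ) {F v : Eu n → ℂ} (hF : Continuous F) (hv : Smth v) :
    (pair μ F (dual χ v)).im = ∫ x, χ x ^ 2 * (F x * conj (v x)).im ∂μ := by
  have e : (pair μ F (dual χ v)).im = ∫ x, (F x * dual χ v x).im ∂μ :=
    (integral_im (hG.integrable_mul hF (hχ.dual_test hv))).symm
  rw [e]
  refine integral_congr_ae (Eventually.of_forall fun x => ?_)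
  simp only [dual]
  rw [show F x * (((χ x ^ 2 : ℝ) : ℂ) * conj (v x)) = ((χ x ^ 2 : ℝ) : ℂ) * (F x * conj (v x)) by ring,
    Complex.im_ofReal_mul]

lemma wip_I_mul (hG : Gibbs U μ) (hχ : IsCut χ) {u v : Eu n → ℂ} (hu : Smth u) (hv : Smth v) :
    wip μ χ u (fun x => Complex.I * v x) = -(pair μ v (dual χ u)).im := by
  rw [wip_eq hG hχ hu (hv.const_mul _), pair_dual_im hG hχ hv.cont hu, ← integral_neg]
  refine integral_congr_ae (Eventually.of_forall fun x => ?_)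
  simp [Complex.mul_re, Complex.mul_im]
  ring

lemma wsq_sub_le (hG : Gibbs U μ) (hχ : IsCut χ) {u v : Eu n → ℂ} (hu : Smth u) (hv : Smth v) :
    wsq μ χ (fun x => u x - v x) ≤ 2 * wsq μ χ u + 2 * wsq μ χ v := by
  have i1 := (hu.wsq_integrable hG hχ).const_mul 2
  have i2 := (hv.wsq_integrable hG hχ).const_mul 2
  unfold wsq
  rw [← integral_const_mul, ← integral_const_mul, ← integral_add i1 i2]
  refine integral_mono (Smth.wsq_integrable hG hχ (hu.sub hv)) (i1.add i2) fun x => ?_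
  have := mul_le_mul_of_nonneg_left (norm_sub_sq_le (u x) (v x)) (sq_nonneg (χ x))
  linarith

lemma NearMin.abs_im_pair_LopC_le (hG : Gibbs U μ) (hχ : IsCut χ) {c : ℝ} (hc0 : 0 ≤ c)
    (hc : ∀ x, ∑ j, pdR n χ j x ^ 2 ≤ c ^ 2) {ε κ : ℝ} (hε : 0 < ε) {u w : Eu n → ℂ}
    (hu : Adm μ u) (hw : NearMin μ χ ε u κ w) :
    |(pair μ u (LopC n U (dual χ fun x => u x - w x))).im|
      ≤ ε⁻¹ * (√κ * √(qf μ χ ε (fun x => Complex.I * (((χ x ^ 2 : ℝ) : ℂ) * (u x - w x)))))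
        + 2 * c * (√(wsq μ χ fun x => u x - w x) * √(dir μ fun x => u x - w x)) := by
  have hζ := hu.sub hw.adm
  set ζ := fun x => u x - w x with hζd
  have hd := hχ.dual_test hζ.smth
  have hη : Adm μ (fun x => ((χ x ^ 2 : ℝ) : ℂ) * ζ x) := (hχ.sq_mul_test hζ.smth).adm hG
  have hsplit : ∑ j, ∫ x, pdC n u j x * pdC n (dual χ ζ) j x ∂μ
      = (∑ j, ∫ x, pdC n w j x * pdC n (dual χ ζ) j x ∂μ)
        + ∑ j, ∫ x, pdC n ζ j x * pdC n (dual χ ζ) j x ∂μ := by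
    rw [← Finset.sum_add_distrib]
    refine Finset.sum_congr rfl fun j _ => ?_
    rw [← integral_add (hG.integrable_mul (hw.adm.smth.pdC j).cont (hd.pdC j))
      (hG.integrable_mul (hζ.smth.pdC j).cont (hd.pdC j))]
    refine integral_congr_ae (Eventually.of_forall fun x => ?_)
    simp only [hζd, pdC_sub hu.smth hw.adm.smth]; ring
  have hconj : dual χ ζ = fun x => conj (((χ x ^ 2 : ℝ) : ℂ) * ζ x) := by
    funext x; simp only [dual, map_mul, Complex.conj_ofReal]
  have hw1 : (∑ j, ∫ x, pdC n w j x * pdC n (dual χ ζ) j x ∂μ).im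
      = dip μ w (fun x => Complex.I * (((χ x ^ 2 : ℝ) : ℂ) * ζ x)) := by
    rw [dip_I_mul hw.adm hη, hconj]
    simp only [pdC_conj]
  have h1 := hw.abs_le hG hχ hu.smth (hη.const_mul Complex.I)
  have h0 : wip μ χ ζ (fun x => Complex.I * (((χ x ^ 2 : ℝ) : ℂ) * ζ x)) = 0 := by
    rw [wip_eq hG hχ hζ.smth (hη.const_mul Complex.I).smth]
    refine integral_eq_zero_of_ae (Eventually.of_forall fun x => ?_)
    simp [Complex.mul_re, Complex.mul_im, -Complex.ofReal_pow]
    ring_nf; simp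
  rw [show (fun x => u x - w x) = ζ from rfl, h0, zero_sub, abs_neg, abs_mul, abs_of_pos hε] at h1
  rw [pair_LopC hG hu.smth hd, Complex.neg_im, abs_neg, hsplit, Complex.add_im]
  refine (abs_add_le _ _).trans (add_le_add ?_ (abs_im_form_cut_le hG hχ hc0 hc hζ.smth hζ.int))
  rw [hw1, inv_mul_eq_div, le_div_iff₀ hε, mul_comm]
  exact h1

lemma norm_pair_dual_le (hG : Gibbs U μ) (hχ : IsCut χ) {F v : Eu n → ℂ} (hF : Continuous F)
    (hv : Smth v) : ‖pair μ F (dual χ v)‖ ≤ √(wsq μ χ F) * √(wsq μ χ v) := by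
  have cχ := hχ.smooth.continuous
  have e1 : ∀ (w : Eu n → ℂ) x, ‖(χ x : ℂ) * w x‖ ^ 2 = χ x ^ 2 * ‖w x‖ ^ 2 := fun w x => by
    rw [norm_mul, mul_pow, Complex.norm_real, Real.norm_eq_abs, sq_abs]
  have e2 : ∀ x, ‖(χ x : ℂ) * conj (v x)‖ ^ 2 = χ x ^ 2 * ‖v x‖ ^ 2 := fun x => by
    rw [e1 (fun x => conj (v x)), RCLike.norm_conj]
  have h := norm_integral_mul_le_sqrt (μ := μ) (f := fun x => (χ x : ℂ) * F x)
    (g := fun x => (χ x : ℂ) * conj (v x))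
    ((Complex.continuous_ofReal.comp cχ).mul hF).aestronglyMeasurable
    ((Complex.continuous_ofReal.comp cχ).mul hv.conj.cont).aestronglyMeasurable
    (by simp only [e1]; exact hG.integrable_cut_sq hχ (hF.norm.pow 2))
    (by simp only [e2]; exact hv.wsq_integrable hG hχ)
  simp only [e1, e2] at h
  refine le_of_eq_of_le ?_ h
  congr 1
  refine integral_congr_ae (Eventually.of_forall fun x => ?_)
  simp only [dual]; push_cast; ring

lemma pair_add_left (hG : Gibbs U μ) {F G η : Eu n → ℂ} (hF : Continuous F) (hG' : Continuous G)
    (hη : IsTest η) : pair μ (fun x => F x + G x) η = pair μ F η + pair μ G η := by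
  unfold pair
  rw [← integral_add (hG.integrable_mul hF hη) (hG.integrable_mul hG' hη)]
  simp only [add_mul]

lemma NearMin.abs_im_pair_nl_le (hG : Gibbs U μ) (hχ : IsCut χ) {ε κ : ℝ} (hε : 0 < ε)
    {u w : Eu n → ℂ} (hu : Adm μ u) (hw : NearMin μ χ ε u κ w) {ψ : ℂ → ℝ} {M : ℝ}
    (hψ : Mult ψ M) {F : Eu n → ℂ} (hF : Continuous F) :
    |(pair μ F (dual χ fun x => u x - w x)).im|
      ≤ √(wsq μ χ fun x => F x - u x * ψ (u x)) * √(wsq μ χ fun x => u x - w x)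
        + fnl μ χ ε u w + √κ * √(qf μ χ ε (fun x => Complex.I * (w x * ψ (w x)))) := by
  have hζ := hu.sub hw.adm
  have hN := hψ.adm hw.adm
  have sN := hψ.smth hu.smth
  set ζ := fun x => u x - w x with hζd
  have hd := hχ.dual_test hζ.smth
  have c1 : Continuous fun x => F x - u x * ψ (u x) := hF.sub sN.cont
  have c2 : Continuous fun x => u x * (ψ (u x) : ℂ) - w x * ψ (w x) := sN.cont.sub hN.smth.cont
  have e : pair μ F (dual χ ζ) = pair μ (fun x => F x - u x * ψ (u x)) (dual χ ζ)
      + (pair μ (fun x => u x * (ψ (u x) : ℂ) - w x * ψ (w x)) (dual χ ζ)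
        + pair μ (fun x => w x * (ψ (w x) : ℂ)) (dual χ ζ)) := by
    have c3 : Continuous fun x => u x * (ψ (u x) : ℂ) - w x * ψ (w x) + w x * ψ (w x) :=
      c2.add hN.smth.cont
    rw [← pair_add_left hG c2 hN.smth.cont hd, ← pair_add_left hG c1 c3 hd]
    congr 1; funext x; ring
  have b1 := (Complex.abs_im_le_norm _).trans (norm_pair_dual_le hG hχ c1 hζ.smth)
  have b2 : |(pair μ (fun x => u x * (ψ (u x) : ℂ) - w x * ψ (w x)) (dual χ ζ)).im| ≤ wsq μ χ ζ := by
    rw [pair_dual_im hG hχ c2 hζ.smth, ← Real.norm_eq_abs]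
    refine norm_integral_le_of_norm_le (hζ.smth.wsq_integrable hG hχ) (Eventually.of_forall fun x => ?_)
    rw [Real.norm_eq_abs, abs_mul, abs_of_nonneg (sq_nonneg (χ x))]
    exact mul_le_mul_of_nonneg_left (hψ.abs_im_sub_le _ _) (sq_nonneg _)
  have b3 : |(pair μ (fun x => w x * (ψ (w x) : ℂ)) (dual χ ζ)).im|
      ≤ ε * dir μ w + √κ * √(qf μ χ ε (fun x => Complex.I * (w x * ψ (w x)))) := by
    have h1 := hw.abs_le hG hχ hu.smth (hN.const_mul Complex.I)
    rw [wip_I_mul hG hχ hζ.smth hN.smth] at h1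
    have h2 := mul_le_mul_of_nonneg_left (hψ.abs_dip_le hw.adm) hε.le
    rw [← abs_of_pos hε, ← abs_mul, abs_of_pos hε] at h2
    rw [_root_.abs_le] at h1 h2 ⊢
    constructor <;> linarith [h1.1, h1.2, h2.1, h2.2]
  rw [e, Complex.add_im, Complex.add_im, fnl]
  refine (abs_add_le _ _).trans ?_
  have := abs_add_le (pair μ (fun x => u x * (ψ (u x) : ℂ) - w x * ψ (w x)) (dual χ ζ)).im
    (pair μ (fun x => w x * (ψ (w x) : ℂ)) (dual χ ζ)).im
  linarith

end

section
variable {n : ℕ} {U : Eu n → ℝ} {μ : Measure (Eu n)} {lam : ℝ} {φ : ℝ → Eu n → ℂ} {χ : Eu n → ℝ}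

lemma fnl_self (ε : ℝ) (u : Eu n → ℂ) : fnl μ χ ε u u = ε * dir μ u := by
  simp [fnl, wsq]

lemma qf_I_mul {v : Eu n → ℂ} (hv : Smth v) (ε : ℝ) :
    qf μ χ ε (fun x => Complex.I * v x) = qf μ χ ε v := by
  rw [qf, qf, wsq_const_mul, dir_const_mul hv]; simp

lemma sqrt_mul_sqrt_le {a b : ℝ} (ha : 0 ≤ a) (hb : 0 ≤ b) : √a * √b ≤ a + b := by
  nlinarith [Real.sq_sqrt ha, Real.sq_sqrt hb, Real.sqrt_nonneg a, Real.sqrt_nonneg b,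
    sq_nonneg (√a - √b)]

/-- A priori bounds for near minimisers. -/
lemma NearMin.bounds (hG : Gibbs U μ) (hχ : IsCut χ) {ε κ C : ℝ} (hε : 0 < ε) (hκ : κ ≤ 1)
    {u w : Eu n → ℂ} (hu : Adm μ u) (hn : wsq μ χ u ≤ C) (hd : dir μ u ≤ C)
    (hw : NearMin μ χ ε u κ w) :
    wsq μ χ (fun x => u x - w x) ≤ ε * C + 1 ∧ ε * dir μ w ≤ ε * C + 1 ∧
      dir μ w ≤ C + ε⁻¹ ∧ dir μ (fun x => u x - w x) ≤ 4 * C + 2 * ε⁻¹ ∧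
      wsq μ χ w ≤ 2 * C + 2 * (ε * C + 1) := by
  have h1 := hw.le u hu
  rw [fnl_self, fnl] at h1
  have h2 := wsq_nonneg (μ := μ) (χ := χ) (fun x => u x - w x)
  have h3 := mul_nonneg hε.le (dir_nonneg (μ := μ) w)
  have h4 := mul_le_mul_of_nonneg_left hd hε.le
  have h5 : dir μ w ≤ C + ε⁻¹ := by
    have : dir μ w ≤ (ε * C + 1) / ε := by rw [le_div_iff₀ hε]; linarith
    refine this.trans_eq ?_
    field_simp
  refine ⟨by linarith, by linarith, h5, ?_, ?_⟩
  · have := dir_sub_le hu hw.adm; linarith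
  · have := wsq_sub_le hG hχ hu.smth (hu.sub hw.adm).smth
    rw [show (fun x => u x - (u x - w x)) = w by funext x; ring] at this
    linarith

lemma LSE.abs_re_pair_dt_self_le (hG : Gibbs U μ) (h : LSE U μ lam φ) (hχ : IsCut χ) {c : ℝ}
    (hc0 : 0 ≤ c) (hc : ∀ x, ∑ j, pdR n χ j x ^ 2 ≤ c ^ 2) (s : ℝ) :
    |(pair μ (dt φ s) (dual χ (φ s))).re| ≤ 2 * c * (√(wsq μ χ (φ s)) * √(dir μ (φ s))) := by
  have hη := hχ.dual_test (h.smth s)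
  have e : (pair μ (dt φ s) (dual χ (φ s))).re = -(pair μ (φ s) (LopC n U (dual χ (φ s)))).im := by
    have h1 := pair_nl_dual_im hG hχ (h.smth s)
    have h2 : (pair μ (φ s) (dual χ (φ s))).im = 0 := by rw [pair_dual_self, Complex.ofReal_im]
    rw [h.pair_dt hG s hη]
    simp [Complex.mul_re, Complex.mul_im, h1, h2]
  rw [e, pair_LopC hG (h.smth s) hη, Complex.neg_im, neg_neg]
  exact abs_im_form_cut_le hG hχ hc0 hc (h.smth s) (h.grad s)

lemma LSE.re_pair_dt_dual (hG : Gibbs U μ) (h : LSE U μ lam φ) (hχ : IsCut χ) (s : ℝ)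
    {v : Eu n → ℂ} (hv : Smth v) :
    (pair μ (dt φ s) (dual χ v)).re = -(pair μ (φ s) (LopC n U (dual χ v))).im
      + lam * (pair μ (fun x => nl (φ s x) - kap μ φ s * φ s x) (dual χ v)).im := by
  have hη := hχ.dual_test hv
  have e : pair μ (fun x => nl (φ s x) - kap μ φ s * φ s x) (dual χ v)
      = pair μ (fun x => nl (φ s x)) (dual χ v) - kap μ φ s * pair μ (φ s) (dual χ v) := by
    unfold pair
    rw [← integral_const_mul, ← integral_sub (hG.integrable_mul (continuous_nl_comp (h.smth s)) hη)
      ((hG.integrable_mul (h.smth s).cont hη).const_mul _)]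
    refine integral_congr_ae (Eventually.of_forall fun x => ?_)
    ring
  rw [h.pair_dt hG s hη, e]
  simp [Complex.mul_re, Complex.mul_im]
  ring

lemma dual_sub (χ : Eu n → ℝ) (u w : Eu n → ℂ) :
    dual χ w = fun x => dual χ u x - dual χ (fun y => u y - w y) x := by
  funext x; simp only [dual, map_sub]; ring

/-- The rate of change of the pairing with a near minimiser. -/
lemma LSE.exists_rate (hG : Gibbs U μ) (h : LSE U μ lam φ) (hχ : IsCut χ) {c : ℝ} (hc0 : 0 ≤ c)
    (hc : ∀ x, ∑ j, pdR n χ j x ^ 2 ≤ c ^ 2) {ε C s : ℝ} (hε : 0 < ε) (hn : nsq μ (φ s) ≤ C)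
    (hd : dir μ (φ s) ≤ C) {ρ : ℝ} (hρ : 0 < ρ) :
    ∃ κ0 > 0, κ0 ≤ 1 ∧ ∀ κ ≤ κ0, ∀ w, NearMin μ χ ε (φ s) κ w →
      |(pair μ (dt φ s) (dual χ w)).re| ≤ |lam| * fnl μ χ ε (φ s) w
        + c * (2 * C + 2 * (ε * C + 1 + (4 * C + 2 * ε⁻¹))) + ρ := by
  have hn' := (wsq_le_nsq hG hχ (h.smth s) (h.mass s)).trans hn
  have hC0 : 0 ≤ C := (nsq_nonneg _).trans hn
  set F := ε * C + 1 with hFd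
  have hF0 : 0 < F := by positivity
  set Z := 4 * C + 2 * ε⁻¹ with hZd
  have hZ0 : 0 ≤ Z := by positivity
  obtain ⟨δ, hδ0, hδ1, hδ⟩ : ∃ δ : ℝ, 0 < δ ∧ δ ≤ 1 ∧ |lam| * (√(wsq μ χ (fun x => nl (φ s x)
      - kap μ φ s * φ s x - φ s x * ((regLog δ (‖φ s x‖ ^ 2) - kap μ φ s : ℝ) : ℂ))) * √F)
      < ρ / 2 := by
    have l := tendsto_wsq_regLog hG hχ (h.smth s) (kap μ φ s)
    have l2 := ((l.sqrt.mul_const √F).const_mul |lam|)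
    rw [Real.sqrt_zero, zero_mul, mul_zero] at l2
    have e1 := l2.eventually_lt_const (show (0 : ℝ) < ρ / 2 by linarith)
    obtain ⟨δ, h1, h2⟩ := (e1.and (Ioc_mem_nhdsGT (one_pos (α := ℝ)))).exists
    exact ⟨δ, h2.1, h2.2, h1⟩
  have hψ := mult_regLog hδ0 hδ1 (kap μ φ s)
  set ψ : ℂ → ℝ := fun z => regLog δ (‖z‖ ^ 2) - kap μ φ s with hψd
  set M := -Real.log δ + |kap μ φ s|
  set q1 := F + ε * (2 * Z + 8 * c ^ 2 * F) with hq1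
  set q2 := (2 + M) ^ 2 * (2 * C + 2 * F + F) with hq2
  set Y := ε⁻¹ * √q1 + |lam| * √q2 with hY
  have hY0 : 0 ≤ Y := by positivity
  obtain ⟨κ0, hκ0, hκ1, hκY⟩ : ∃ κ0 > 0, κ0 ≤ 1 ∧ √κ0 * Y < ρ / 2 := by
    have l : Tendsto (fun κ => √κ * Y) (𝓝[>] 0) (𝓝 (√0 * Y)) :=
      ((Real.continuous_sqrt.tendsto 0).mono_left nhdsWithin_le_nhds).mul_const Y
    rw [Real.sqrt_zero, zero_mul] at l
    have e1 := l.eventually_lt_const (show (0 : ℝ) < ρ / 2 by linarith)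
    obtain ⟨δ, h1, h2⟩ := (e1.and (Ioc_mem_nhdsGT (one_pos (α := ℝ)))).exists
    exact ⟨δ, h2.1, h2.2, h1⟩
  refine ⟨κ0, hκ0, hκ1, fun κ hκ w hw => ?_⟩
  have hu := h.adm s
  have hζ := hu.sub hw.adm
  obtain ⟨b1, b2, b3, b4, b5⟩ := hw.bounds hG hχ hε (hκ.trans hκ1) hu hn' hd
  have n1 := wsq_nonneg (μ := μ) (χ := χ) (fun x => φ s x - w x)
  have n2 := dir_nonneg (μ := μ) (fun x => φ s x - w x)
  have hN := hψ.adm hw.adm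
  have hη : IsTest (fun x => ((χ x ^ 2 : ℝ) : ℂ) * (φ s x - w x)) := hχ.sq_mul_test hζ.smth
  have k1 := hw.abs_im_pair_LopC_le hG hχ hc0 hc hε hu
  have cF : Continuous fun x => nl (φ s x) - kap μ φ s * φ s x :=
    (continuous_nl_comp (h.smth s)).sub (continuous_const.mul (h.smth s).cont)
  have k2 := hw.abs_im_pair_nl_le hG hχ hε hu hψ cF
  rw [qf_I_mul hη.smth] at k1
  rw [qf_I_mul hN.smth] at k2
  have Q1 : qf μ χ ε (fun x => ((χ x ^ 2 : ℝ) : ℂ) * (φ s x - w x)) ≤ q1 := by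
    unfold qf
    have z1 := (wsq_le_nsq hG hχ hη.smth (hη.nsq_integrable hG)).trans (nsq_sq_mul_le hG hχ hζ.smth)
    have z2 := dir_sq_mul_le hG hχ hc hζ.smth hζ.int
    rw [hq1]; gcongr
    · exact z1.trans b1
    · refine z2.trans ?_; gcongr
  have Q2 : qf μ χ ε (fun x => w x * ψ (w x)) ≤ q2 := by
    unfold qf
    have z1 := hψ.wsq_le hG hχ hw.adm.smth
    have z2 := mul_le_mul_of_nonneg_left (hψ.dir_le hw.adm) hε.le
    have z3 := mul_le_mul_of_nonneg_left b5 (sq_nonneg (2 + M))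
    have z4 := mul_le_mul_of_nonneg_left b2 (sq_nonneg (2 + M))
    rw [hq2]; linarith
  have s1 := Real.sqrt_le_sqrt Q1
  have s2 := Real.sqrt_le_sqrt Q2
  have sκ := Real.sqrt_le_sqrt hκ
  have sF := Real.sqrt_le_sqrt b1
  have g1 : √(wsq μ χ fun x => φ s x - w x) * √(dir μ fun x => φ s x - w x) ≤ F + Z :=
    (sqrt_mul_sqrt_le n1 n2).trans (add_le_add b1 b4)
  have g0 : √(wsq μ χ (φ s)) * √(dir μ (φ s)) ≤ C := by
    calc √(wsq μ χ (φ s)) * √(dir μ (φ s)) ≤ √C * √C := by gcongr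
      _ = C := Real.mul_self_sqrt hC0
  have k0 := h.abs_re_pair_dt_self_le hG hχ hc0 hc s
  have esplit : (pair μ (dt φ s) (dual χ w)).re = (pair μ (dt φ s) (dual χ (φ s))).re
      - (pair μ (dt φ s) (dual χ fun x => φ s x - w x)).re := by
    rw [← Complex.sub_re]; congr 1
    rw [dual_sub χ (φ s) w]
    unfold pair
    rw [← integral_sub (hG.integrable_mul (h.continuous_dt hG s) (hχ.dual_test (h.smth s)))
      (hG.integrable_mul (h.continuous_dt hG s) (hχ.dual_test hζ.smth))]
    simp only [mul_sub]
  rw [esplit, h.re_pair_dt_dual hG hχ s hζ.smth]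
  set X1 := (pair μ (φ s) (LopC n U (dual χ fun x => φ s x - w x))).im
  set X2 := (pair μ (fun x => nl (φ s x) - kap μ φ s * φ s x) (dual χ fun x => φ s x - w x)).im
  set X0 := (pair μ (dt φ s) (dual χ (φ s))).re
  have t1 : |X1| ≤ √κ0 * (ε⁻¹ * √q1) + 2 * c * (F + Z) := by
    refine k1.trans (add_le_add ?_ (by gcongr))
    calc _ ≤ ε⁻¹ * (√κ0 * √q1) := by gcongr
      _ = _ := by ring
  have t2 : |lam| * |X2| ≤ ρ / 2 + |lam| * fnl μ χ ε (φ s) w + √κ0 * (|lam| * √q2) := by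
    have := mul_le_mul_of_nonneg_left k2 (abs_nonneg lam)
    refine this.trans ?_
    rw [mul_add, mul_add]
    refine add_le_add (add_le_add (le_trans ?_ hδ.le) le_rfl) ?_
    · gcongr
    · calc _ ≤ |lam| * (√κ0 * √q2) := by gcongr
        _ = _ := by ring
  have t0 : |X0| ≤ 2 * c * C := k0.trans (by gcongr)
  have tt : |X0 - (-X1 + lam * X2)| ≤ |X0| + (|X1| + |lam| * |X2|) := by
    refine (abs_sub _ _).trans (add_le_add le_rfl ((abs_add_le _ _).trans ?_))
    rw [abs_neg, abs_mul]
  rw [hY, mul_add] at hκY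
  linarith

end

section
variable {n : ℕ} {U : Eu n → ℝ} {μ : Measure (Eu n)} {lam : ℝ} {φ : ℝ → Eu n → ℂ} {χ : Eu n → ℝ}

/-- The regularised Dirichlet energy. -/
def env (μ : Measure (Eu n)) (χ : Eu n → ℝ) (ε : ℝ) (u : Eu n → ℂ) : ℝ :=
  ⨅ w : {w : Eu n → ℂ // Adm μ w}, fnl μ χ ε u w

lemma fnl_nonneg {ε : ℝ} (hε : 0 ≤ ε) (u w : Eu n → ℂ) : 0 ≤ fnl μ χ ε u w :=
  add_nonneg (wsq_nonneg _) (mul_nonneg hε (dir_nonneg _))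

lemma env_le {ε : ℝ} (hε : 0 ≤ ε) (u : Eu n → ℂ) {w : Eu n → ℂ} (hw : Adm μ w) :
    env μ χ ε u ≤ fnl μ χ ε u w :=
  ciInf_le (f := fun w : {w : Eu n → ℂ // Adm μ w} => fnl μ χ ε u w)
    ⟨0, by rintro _ ⟨w, rfl⟩; exact fnl_nonneg hε _ _⟩ ⟨w, hw⟩

lemma exists_nearMin {ε κ : ℝ} (hε : 0 ≤ ε) (hκ : 0 < κ) {u : Eu n → ℂ} (hu : Adm μ u) :
    ∃ w, NearMin μ χ ε u κ w ∧ fnl μ χ ε u w ≤ env μ χ ε u + κ := by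
  have : Nonempty {w : Eu n → ℂ // Adm μ w} := ⟨⟨u, hu⟩⟩
  obtain ⟨w, hw⟩ := exists_lt_of_ciInf_lt (show env μ χ ε u < env μ χ ε u + κ by linarith)
  exact ⟨w, ⟨w.2, fun v hv => hw.le.trans (by linarith [env_le (χ := χ) hε u hv])⟩, hw.le⟩

lemma fnl_sub (hG : Gibbs U μ) (hχ : IsCut χ) (ε : ℝ) {u v w : Eu n → ℂ} (hu : Smth u) (hv : Smth v)
    (hw : Smth w) : fnl μ χ ε u w = fnl μ χ ε v w + (wsq μ χ u - wsq μ χ v)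
      - 2 * (wip μ χ u w - wip μ χ v w) := by
  unfold fnl
  rw [wsq_sub hG hχ hu hw, wsq_sub hG hχ hv hw]; ring

lemma LSE.continuousOn_env (hG : Gibbs U μ) (h : LSE U μ lam φ) (hχ : IsCut χ) {c : ℝ} (hc0 : 0 ≤ c)
    (hc : ∀ x, ∑ j, pdR n χ j x ^ 2 ≤ c ^ 2) {a b C : ℝ} (hB : Bd μ φ a b C) {ε : ℝ} (hε : 0 < ε) :
    ContinuousOn (fun t => env μ χ ε (φ t)) (Icc a b) := by
  obtain ⟨A, hA0, hA⟩ := h.exists_wip_lip hG hχ hc0 hc hB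
  set Y := 4 * c * C + 2 * (A * (√(2 * C + 2 * (ε * C + 1)) + √(C + ε⁻¹)))
  have key : ∀ s ∈ Icc a b, ∀ t ∈ Icc a b, env μ χ ε (φ t) ≤ env μ χ ε (φ s) + Y * |t - s| := by
    intro s hs t ht
    refine le_of_forall_pos_le_add fun κ' hκ' => ?_
    set κ := min κ' 1
    have hκ : 0 < κ := lt_min hκ' one_pos
    obtain ⟨w, hw, hwe⟩ := exists_nearMin (χ := χ) hε.le hκ (h.adm s)
    obtain ⟨-, -, b3, -, b5⟩ := hw.bounds hG hχ hε (min_le_right _ _) (h.adm s)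
      ((wsq_le_nsq hG hχ (h.smth s) (h.mass s)).trans (hB s hs).1) (hB s hs).2.1
    have h1 := env_le (χ := χ) hε.le (φ t) hw.adm
    rw [fnl_sub hG hχ ε (h.smth t) (h.smth s) hw.adm.smth] at h1
    have h2 := h.wsq_le hG hχ hc0 hc hB ht hs
    have h3 := (_root_.abs_le.1 (hA s hs t ht w hw.adm.smth hw.adm.int)).1
    have h4 : A * (√(wsq μ χ w) + √(dir μ w)) * |t - s|
        ≤ A * (√(2 * C + 2 * (ε * C + 1)) + √(C + ε⁻¹)) * |t - s| := by gcongr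
    have h5 : κ ≤ κ' := min_le_left _ _
    rw [abs_sub_comm] at h2
    simp only [Y]
    linarith
  refine continuousOn_of_lip (A := Y) fun s hs t ht => ?_
  have h1 := key s hs t ht
  have h2 := key t ht s hs
  rw [abs_sub_comm s t] at h2
  rw [_root_.abs_le]; constructor <;> linarith

lemma LSE.eventually_pair_dt_le (hG : Gibbs U μ) (h : LSE U μ lam φ) {a b C : ℝ} (hB : Bd μ φ a b C)
    {η : Eu n → ℂ} (hη : IsTest η) {s : ℝ} (hs : s ∈ Icc a b) {ρ : ℝ} (hρ : 0 < ρ) :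
    ∀ᶠ r in 𝓝[Icc a b] s, |(pair μ (dt φ r) η).re| ≤ |(pair μ (dt φ s) η).re| + ρ := by
  have c1 := h.continuousOn_pair hG (fun r hr => (hB r hr).1) (hη.LopC hG.smooth) s hs
  have c2 := h.continuousOn_pair_nl hG hB hη s hs
  have c3 := h.continuousOn_pair hG (fun r hr => (hB r hr).1) hη s hs
  have l : Tendsto (fun r => Complex.I * pair μ (φ r) (LopC n U η)
      - Complex.I * lam * pair μ (fun x => nl (φ r x)) η
      + Complex.I * lam * kap μ φ s * pair μ (φ r) η) (𝓝[Icc a b] s) (𝓝 (pair μ (dt φ s) η)) := by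
    rw [h.pair_dt hG s hη]
    exact ((c1.tendsto.const_mul _).sub (c2.tendsto.const_mul _)).add (c3.tendsto.const_mul _)
  have l2 := ((Complex.continuous_re.tendsto _).comp l).abs
  filter_upwards [l2.eventually_lt_const (show _ < |(pair μ (dt φ s) η).re| + ρ by linarith),
    self_mem_nhdsWithin] with r hr hrI
  refine le_trans (le_of_eq ?_) hr.le
  have hk : kap μ φ r = kap μ φ s := by unfold kap; rw [h.nsq_const hG hB hs hrI]
  rw [h.pair_dt hG r hη, hk]; rfl

/-- Differential inequality for the regularised Dirichlet energy. -/
lemma LSE.env_dini (hG : Gibbs U μ) (h : LSE U μ lam φ) (hχ : IsCut χ) {c : ℝ} (hc0 : 0 ≤ c)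
    (hc : ∀ x, ∑ j, pdR n χ j x ^ 2 ≤ c ^ 2) {a b C : ℝ} (hB : Bd μ φ a b C) {ε : ℝ} (hε : 0 < ε)
    {s : ℝ} (hs : s ∈ Icc a b) {ρ : ℝ} (hρ : 0 < ρ) :
    ∀ᶠ t in 𝓝[Icc a b] s, env μ χ ε (φ t) ≤ env μ χ ε (φ s) + (2 * |lam| * env μ χ ε (φ s)
      + c * (8 * C + 4 * (ε * C + 1 + (4 * C + 2 * ε⁻¹))) + ρ) * |t - s| := by
  obtain ⟨A, hA0, hA⟩ := h.exists_wip_lip hG hχ hc0 hc hB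
  obtain ⟨κ0, hκ0, hκ01, hrate⟩ := h.exists_rate hG hχ hc0 hc hε (hB s hs).1 (hB s hs).2.1
    (show 0 < ρ / 16 by linarith)
  set Y := A * (1 + (√ε)⁻¹) with hY
  have hY0 : 0 ≤ Y := by positivity
  obtain ⟨κ, hκ, hκκ, hκY⟩ : ∃ κ > 0, κ ≤ κ0 ∧ 2 * |lam| * κ + 4 * (Y * √κ) < ρ / 4 := by
    have l : Tendsto (fun κ => 2 * |lam| * κ + 4 * (Y * √κ)) (𝓝[>] 0)
        (𝓝 (2 * |lam| * 0 + 4 * (Y * √0))) := by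
      refine Tendsto.mono_left ?_ nhdsWithin_le_nhds
      exact Continuous.tendsto (f := fun κ => 2 * |lam| * κ + 4 * (Y * √κ)) (by fun_prop) 0
    rw [Real.sqrt_zero, mul_zero, mul_zero, mul_zero, add_zero] at l
    have e1 := l.eventually_lt_const (show (0 : ℝ) < ρ / 4 by linarith)
    obtain ⟨δ, h1, h2⟩ := (e1.and (Ioc_mem_nhdsGT hκ0)).exists
    exact ⟨δ, h2.1, h2.2, h1⟩
  obtain ⟨w, hw, hwe⟩ := exists_nearMin (χ := χ) hε.le hκ (h.adm s)
  have hη := hχ.dual_test hw.adm.smth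
  have hr := hrate κ hκκ w hw
  have hev := h.eventually_pair_dt_le hG hB hη hs (show 0 < ρ / 16 by linarith)
  filter_upwards [h.re_increment hG hB hη hs hev, self_mem_nhdsWithin] with t ht htI
  set B := |(pair μ (dt φ s) (dual χ w)).re| + ρ / 16
  have hinc : |wip μ χ (φ t) w - wip μ χ (φ s) w| ≤ B * |t - s| := by
    rw [wip, wip, ← Complex.sub_re]; exact ht
  refine le_of_forall_pos_le_add fun κ' hκ' => ?_
  set κ1 := min κ' κ
  have hκ1 : 0 < κ1 := lt_min hκ' hκ
  obtain ⟨v, hv, hve⟩ := exists_nearMin (χ := χ) hε.le hκ1 (h.adm s)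
  have h1 := env_le (χ := χ) hε.le (φ t) hv.adm
  rw [fnl_sub hG hχ ε (h.smth t) (h.smth s) hv.adm.smth] at h1
  have h2 := h.wsq_le hG hχ hc0 hc hB htI hs
  rw [abs_sub_comm] at h2
  have hvw := hv.adm.sub hw.adm
  have h3 := hA s hs t htI _ hvw.smth hvw.int
  rw [wip_sub_right hG hχ hv.adm.smth hw.adm.smth (h.smth t),
    wip_sub_right hG hχ hv.adm.smth hw.adm.smth (h.smth s)] at h3
  have hq := hw.qf_sub_le hG hχ hε.le (h.smth s) hv
  set Q := qf μ χ ε (fun x => v x - w x)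
  have hq2 : √Q ≤ 2 * √κ := by
    have := Real.sqrt_le_sqrt (show κ1 ≤ κ from min_le_right _ _)
    linarith
  have n1 := wsq_nonneg (μ := μ) (χ := χ) (fun x => v x - w x)
  have n2 := dir_nonneg (μ := μ) (fun x => v x - w x)
  have q1 : √(wsq μ χ fun x => v x - w x) ≤ √Q :=
    Real.sqrt_le_sqrt (le_add_of_nonneg_right (mul_nonneg hε.le n2))
  have q2 : √(dir μ fun x => v x - w x) ≤ (√ε)⁻¹ * √Q := by
    rw [inv_mul_eq_div, le_div_iff₀ (Real.sqrt_pos.2 hε), ← Real.sqrt_mul n2]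
    refine Real.sqrt_le_sqrt ?_
    rw [mul_comm]; exact le_add_of_nonneg_left n1
  have h4 : A * (√(wsq μ χ fun x => v x - w x) + √(dir μ fun x => v x - w x)) * |t - s|
      ≤ 2 * (Y * √κ) * |t - s| := by
    refine mul_le_mul_of_nonneg_right ?_ (abs_nonneg _)
    calc A * (√(wsq μ χ fun x => v x - w x) + √(dir μ fun x => v x - w x))
        ≤ A * (√Q + (√ε)⁻¹ * √Q) := by gcongr
      _ = Y * √Q := by rw [hY]; ring
      _ ≤ Y * (2 * √κ) := by gcongr
      _ = _ := by ring
  have h5 := (_root_.abs_le.1 (h3.trans h4)).1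
  have h6 := (_root_.abs_le.1 hinc).1
  have h7 : κ1 ≤ κ' := min_le_left _ _
  have hBB : 2 * B ≤ 2 * |lam| * env μ χ ε (φ s) + 2 * |lam| * κ
      + c * (4 * C + 4 * (ε * C + 1 + (4 * C + 2 * ε⁻¹))) + ρ / 4 := by
    have := mul_le_mul_of_nonneg_left hwe (abs_nonneg lam)
    simp only [B]; linarith
  have h8 : (4 * c * C + 2 * B + 4 * (Y * √κ)) * |t - s| ≤ (2 * |lam| * env μ χ ε (φ s)
      + c * (8 * C + 4 * (ε * C + 1 + (4 * C + 2 * ε⁻¹))) + ρ) * |t - s| := by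
    refine mul_le_mul_of_nonneg_right ?_ (abs_nonneg _)
    linarith
  linarith

lemma gronwallBound_le {δ K ε x : ℝ} (hK : 0 ≤ K) (hε : 0 ≤ ε) :
    gronwallBound δ K ε x ≤ (δ + ε * x) * Real.exp (K * x) := by
  rcases hK.eq_or_lt with rfl | hK
  · simp [gronwallBound_K0]
  · rw [gronwallBound_of_K_ne_0 hK.ne']
    have h1 : Real.exp (K * x) - 1 ≤ K * x * Real.exp (K * x) := by
      have h2 := Real.one_sub_le_exp_neg (K * x)
      have h3 := mul_le_mul_of_nonneg_right h2 (Real.exp_pos (K * x)).le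
      rw [← Real.exp_add, neg_add_cancel, Real.exp_zero] at h3
      linarith
    have h4 : ε / K * (Real.exp (K * x) - 1) ≤ ε / K * (K * x * Real.exp (K * x)) := by gcongr
    have h5 : ε / K * (K * x * Real.exp (K * x)) = ε * x * Real.exp (K * x) := by field_simp
    linarith

lemma LSE.env_le_exp (hG : Gibbs U μ) (h : LSE U μ lam φ) (hχ : IsCut χ) {c : ℝ} (hc0 : 0 ≤ c)
    (hc : ∀ x, ∑ j, pdR n χ j x ^ 2 ≤ c ^ 2) {a b C : ℝ} (hB : Bd μ φ a b C) {ε : ℝ} (hε : 0 < ε)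
    {s t : ℝ} (hs : s ∈ Icc a b) (ht : t ∈ Icc a b) :
    env μ χ ε (φ t) ≤ (ε * dir μ (φ s) + c * (8 * C + 4 * (ε * C + 1 + (4 * C + 2 * ε⁻¹))) * |t - s|)
      * Real.exp (2 * |lam| * |t - s|) := by
  have hC0 : 0 ≤ C := (nsq_nonneg _).trans (hB s hs).1
  refine (gronwall_two_sided (h.continuousOn_env hG hχ hc0 hc hB hε)
    (fun s hs ρ hρ => h.env_dini hG hχ hc0 hc hB hε hs hρ) hs ht).trans
    ((gronwallBound_le (by positivity) (by positivity)).trans ?_)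
  have := env_le (χ := χ) hε.le (φ s) (h.adm s)
  rw [fnl_self] at this
  gcongr

/-- The Dirichlet energy grows at most exponentially on intervals of boundedness. -/
lemma LSE.dir_le_exp (hG : Gibbs U μ) (h : LSE U μ lam φ) {a b C : ℝ} (hB : Bd μ φ a b C) {s t : ℝ}
    (hs : s ∈ Icc a b) (ht : t ∈ Icc a b) :
    dir μ (φ t) ≤ Real.exp (2 * |lam| * |t - s|) * dir μ (φ s) := by
  obtain ⟨C0, hC0, χ, h1, h2, h3⟩ := exists_cut_seq n
  set E := Real.exp (2 * |lam| * |t - s|)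
  have hE : 0 < E := Real.exp_pos _
  have step : ∀ ε : ℝ, 0 < ε → ∀ m : ℕ, ∃ k : ℕ, m ≤ k ∧ ∃ w, Adm μ w ∧
      fnl μ (χ k) ε (φ t) w ≤ ε * (E * dir μ (φ s) + ε) := by
    intro ε hε m
    set D := (8 * C + 4 * (ε * C + 1 + (4 * C + 2 * ε⁻¹))) * |t - s| * E
    have l : Tendsto (fun k : ℕ => C0 / ((k : ℝ) + 1) * D) atTop (𝓝 0) := by
      have := ((tendsto_one_div_add_atTop_nhds_zero_nat (𝕜 := ℝ)).const_mul (C0 * D))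
      rw [mul_zero] at this
      refine this.congr fun k => ?_
      ring
    obtain ⟨k, hk, hmk⟩ := ((l.eventually_lt_const (show (0 : ℝ) < ε ^ 2 / 2 by positivity)).and
      (eventually_ge_atTop m)).exists
    obtain ⟨w, hw, hwe⟩ := exists_nearMin (χ := χ k) hε.le (show 0 < ε ^ 2 / 2 by positivity) (h.adm t)
    refine ⟨k, hmk, w, hw.adm, hwe.trans ?_⟩
    have := h.env_le_exp hG (h1 k) (show 0 ≤ C0 / ((k : ℝ) + 1) by positivity) (h3 k) hB hε hs ht
    have e : (ε * dir μ (φ s) + C0 / ((k : ℝ) + 1) * (8 * C + 4 * (ε * C + 1 + (4 * C + 2 * ε⁻¹)))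
        * |t - s|) * E = ε * (E * dir μ (φ s)) + C0 / ((k : ℝ) + 1) * D := by simp only [D]; ring
    rw [e] at this
    linarith
  refine le_of_forall_pos_le_add fun θ hθ => ?_
  set e : ℕ → ℝ := fun m => θ / ((m : ℝ) + 1) with he
  have he0 : ∀ m, 0 < e m := fun m => by positivity
  have heθ : ∀ m, e m ≤ θ := fun m => div_le_self hθ.le (by
    have : (0 : ℝ) ≤ m := m.cast_nonneg
    linarith)
  have hel : Tendsto e atTop (𝓝 0) := by
    have := (tendsto_one_div_add_atTop_nhds_zero_nat (𝕜 := ℝ)).const_mul θ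
    rw [mul_zero] at this
    refine this.congr fun m => ?_
    simp only [he]; ring
  choose k hmk w hw hf using fun m : ℕ => step (e m) (he0 m) m
  refine dir_le_of_tendsto hG (h.smth t) (h.grad t) (fun m => (hw m).smth) (fun m => (hw m).int)
    (fun m => ?_) fun η hη => ?_
  · have h4 := hf m
    have h5 := wsq_nonneg (μ := μ) (χ := χ (k m)) (fun x => φ t x - w m x)
    unfold fnl at h4
    have h6 : e m * dir μ (w m) ≤ e m * (E * dir μ (φ s) + e m) := by linarith
    have := le_of_mul_le_mul_left h6 (he0 m)
    linarith [heθ m]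
  · have hw0 : Tendsto (fun m => √(wsq μ (χ (k m)) fun x => φ t x - w m x)) atTop (𝓝 0) := by
      have l : Tendsto (fun m => e m * (E * dir μ (φ s) + e m)) atTop (𝓝 0) := by
        have := hel.mul (hel.const_add (E * dir μ (φ s)))
        rwa [zero_mul] at this
      have l2 := (Real.continuous_sqrt.tendsto 0).comp l
      rw [Real.sqrt_zero] at l2
      refine squeeze_zero (fun _ => Real.sqrt_nonneg _) (fun m => Real.sqrt_le_sqrt ?_) l2
      refine le_trans ?_ (hf m)
      exact le_add_of_nonneg_right (mul_nonneg (he0 m).le (dir_nonneg _))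
    obtain ⟨R, hR⟩ := hη.2.isCompact.isBounded.subset_closedBall 0
    obtain ⟨m0, hm0⟩ := exists_nat_ge R
    rw [tendsto_iff_norm_sub_tendsto_zero]
    have l3 := hw0.mul_const √(nsq μ η)
    rw [zero_mul] at l3
    refine squeeze_zero' (Eventually.of_forall fun _ => norm_nonneg _) ?_ l3
    filter_upwards [eventually_ge_atTop m0] with m hm
    have hχ1 : ∀ x, η x ≠ 0 → χ (k m) x = 1 := by
      intro x hx
      refine h2 _ _ ?_
      have h7 := hR (subset_tsupport η hx)
      rw [mem_closedBall_zero_iff] at h7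
      have h8 : (m0 : ℝ) ≤ k m := by exact_mod_cast hm.trans (hmk m)
      linarith
    have hz := (h.adm t).sub (hw m)
    have e1 : pair μ (w m) η - pair μ (φ t) η = -∫ x, ((χ (k m) x : ℂ) * (φ t x - w m x)) * η x ∂μ := by
      unfold pair
      rw [← integral_sub (hG.integrable_mul (hw m).smth.cont hη)
        (hG.integrable_mul (h.smth t).cont hη), ← integral_neg]
      refine integral_congr_ae (Eventually.of_forall fun x => ?_)
      rcases eq_or_ne (η x) 0 with hx | hx
      · simp [hx]
      · simp only [hχ1 x hx, Complex.ofReal_one]; ring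
    rw [e1, norm_neg]
    have e2 : ∀ x, ‖(χ (k m) x : ℂ) * (φ t x - w m x)‖ ^ 2 = χ (k m) x ^ 2 * ‖φ t x - w m x‖ ^ 2 :=
      fun x => by rw [norm_mul, mul_pow, Complex.norm_real, Real.norm_eq_abs, sq_abs]
    have := norm_integral_mul_le_sqrt (μ := μ) (f := fun x => (χ (k m) x : ℂ) * (φ t x - w m x))
      (g := η) ((Complex.continuous_ofReal.comp (h1 (k m)).smooth.continuous).mul
        hz.smth.cont).aestronglyMeasurable hη.cont.aestronglyMeasurable
      (by simp only [e2]; exact hz.smth.wsq_integrable hG (h1 (k m))) (hη.nsq_integrable hG)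
    simp only [e2] at this
    exact this

end

section
variable {n : ℕ} {U : Eu n → ℝ} {μ : Measure (Eu n)} {lam : ℝ} {φ : ℝ → Eu n → ℂ}

/-- Mass, energy and logarithmic mass are bounded near time `t`. -/
def LocBd (μ : Measure (Eu n)) (φ : ℝ → Eu n → ℂ) (t : ℝ) : Prop :=
  ∃ δ > 0, ∃ C, Bd μ φ (t - δ) (t + δ) C

lemma isOpen_locBd : IsOpen {t | LocBd μ φ t} := by
  rw [Metric.isOpen_iff]
  rintro t ⟨δ, hδ, C, hB⟩
  refine ⟨δ / 2, by positivity, fun s hs => ⟨δ / 2, by positivity, C, hB.mono ?_⟩⟩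
  rw [Metric.mem_ball, Real.dist_eq, abs_lt] at hs
  exact Icc_subset_Icc (by linarith) (by linarith)

lemma exists_Bd_of_locBd {c d : ℝ} (hL : ∀ r ∈ Icc c d, LocBd μ φ r) : ∃ C, Bd μ φ c d C := by
  suffices ∃ C, ∀ r ∈ Icc c d, nsq μ (φ r) ≤ C ∧ dir μ (φ r) ≤ C ∧ |kap μ φ r| ≤ C from this
  refine isCompact_Icc.induction_on
    (p := fun s => ∃ C, ∀ r ∈ s, nsq μ (φ r) ≤ C ∧ dir μ (φ r) ≤ C ∧ |kap μ φ r| ≤ C)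
    ⟨0, by simp⟩ ?_ ?_ ?_
  · rintro s t hst ⟨C, hC⟩
    exact ⟨C, fun r hr => hC r (hst hr)⟩
  · rintro s t ⟨C, hC⟩ ⟨D, hD⟩
    refine ⟨max C D, ?_⟩
    rintro r (hr | hr)
    · obtain ⟨h1, h2, h3⟩ := hC r hr
      exact ⟨le_max_of_le_left h1, le_max_of_le_left h2, le_max_of_le_left h3⟩
    · obtain ⟨h1, h2, h3⟩ := hD r hr
      exact ⟨le_max_of_le_right h1, le_max_of_le_right h2, le_max_of_le_right h3⟩
  · intro r hr
    obtain ⟨δ, hδ, C, hB⟩ := hL r hr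
    exact ⟨Icc (r - δ) (r + δ),
      mem_nhdsWithin_of_mem_nhds (Icc_mem_nhds (by linarith) (by linarith)), C, hB⟩

lemma LSE.bounds_across_gap (hG : Gibbs U μ) (h : LSE U μ lam φ) {c t : ℝ}
    (hL : ∀ r ∈ uIcc c t, r ≠ c → LocBd μ φ r) :
    nsq μ (φ t) = nsq μ (φ c) ∧ dir μ (φ t) ≤ Real.exp (2 * |lam| * |t - c|) * dir μ (φ c) := by
  have hgap : ∀ r ∈ uIcc c t, r ≠ c → nsq μ (φ r) = nsq μ (φ t) ∧
      dir μ (φ r) ≤ Real.exp (2 * |lam| * |t - c|) * dir μ (φ t) := by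
    intro r hr hrc
    obtain ⟨C, hC⟩ : ∃ C, Bd μ φ (min r t) (max r t) C := by
      refine exists_Bd_of_locBd fun s hs => ?_
      have hs' : s ∈ uIcc r t := hs
      rw [mem_uIcc] at hr hs'
      refine hL s ?_ ?_
      · rw [mem_uIcc]; grind
      · grind
    refine ⟨h.nsq_const hG hC right_mem_uIcc left_mem_uIcc,
      (h.dir_le_exp hG hC right_mem_uIcc left_mem_uIcc).trans ?_⟩
    have h1 : |r - t| ≤ |t - c| := by
      rw [abs_sub_comm]; exact abs_sub_right_of_mem_uIcc hr
    have := dir_nonneg (μ := μ) (φ t)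
    gcongr
  obtain ⟨C, hC⟩ : ∃ C, Bd μ φ (min c t) (max c t) C := by
    refine ⟨max (max (nsq μ (φ t)) (max (Real.exp (2 * |lam| * |t - c|) * dir μ (φ t))
      |kap μ φ t|)) (max (nsq μ (φ c)) (max (dir μ (φ c)) |kap μ φ c|)), fun r hr => ?_⟩
    by_cases hrc : r = c
    · subst hrc
      simp
    · obtain ⟨h1, h2⟩ := hgap r hr hrc
      have h3 : kap μ φ r = kap μ φ t := by unfold kap; rw [h1]
      rw [h1, h3]
      simp [h2]
  exact ⟨h.nsq_const hG hC left_mem_uIcc right_mem_uIcc,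
    h.dir_le_exp hG hC left_mem_uIcc right_mem_uIcc⟩

lemma LSE.isClosed_sublevel (hG : Gibbs U μ) (h : LSE U μ lam φ) (N : ℝ) :
    IsClosed {t | nsq μ (φ t) ≤ N ∧ dir μ (φ t) ≤ N} := by
  refine isClosed_of_closure_subset fun t ht => ?_
  obtain ⟨r, hr, hrt⟩ := mem_closure_iff_seq_limit.1 ht
  refine ⟨h.nsq_le_of_tendsto hrt fun k => (hr k).1,
    dir_le_of_tendsto hG (h.smth t) (h.grad t) (fun k => h.smth (r k)) (fun k => h.grad (r k))
      (fun k => (hr k).2) fun η hη => ?_⟩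
  exact (h.tendsto_pair hG (fun s (hs : s ∈ {t | nsq μ (φ t) ≤ N ∧ dir μ (φ t) ≤ N}) => hs.1)
    hη t).comp (tendsto_nhdsWithin_iff.2 ⟨hrt, Eventually.of_forall hr⟩)

lemma LSE.eventually_lt_nsq (h : LSE U μ lam φ) {t a : ℝ} (ha : a < nsq μ (φ t)) :
    ∀ᶠ s in 𝓝 t, a < nsq μ (φ s) := by
  by_contra hc
  obtain ⟨r, hr, hrt⟩ := exists_seq_forall_of_frequently (not_eventually.1 hc)
  exact absurd (h.nsq_le_of_tendsto hr fun k => not_lt.1 (hrt k)) (not_le.2 ha)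

/-- The last point of a closed set met when going from `t` towards one of its points. -/
lemma exists_mem_uIcc_gap {K : Set ℝ} (hK : IsClosed K) {a t : ℝ} (ha : a ∈ K) :
    ∃ c ∈ K, c ∈ uIcc a t ∧ ∀ r ∈ uIcc c t, r ≠ c → r ∉ K := by
  have hcl : IsCompact (K ∩ uIcc a t) := isCompact_uIcc.inter_left hK
  obtain ⟨c, ⟨hcK, hc⟩, hmin⟩ := hcl.exists_isMinOn ⟨a, ha, left_mem_uIcc⟩
    (f := fun x => |t - x|) (by fun_prop)
  refine ⟨c, hcK, hc, fun r hr hrc hrK => hrc ?_⟩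
  have h1 : |t - c| ≤ |t - r| := hmin ⟨hrK, uIcc_subset_uIcc hc right_mem_uIcc hr⟩
  rw [mem_uIcc] at hr
  rcases hr with ⟨h2, h3⟩ | ⟨h2, h3⟩
  · rw [abs_of_nonneg (by linarith), abs_of_nonneg (by linarith)] at h1
    linarith
  · rw [abs_of_nonpos (by linarith), abs_of_nonpos (by linarith)] at h1
    linarith

lemma LSE.locBd (hG : Gibbs U μ) (h : LSE U μ lam φ) (t : ℝ) : LocBd μ φ t := by
  by_contra hbad
  set K : Set ℝ := {t | LocBd μ φ t}ᶜ with hKd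
  have hK : IsClosed K := isOpen_locBd.isClosed_compl
  have := hK.completeSpace_coe
  have : Nonempty K := ⟨⟨t, hbad⟩⟩
  obtain ⟨N, x0, hx0⟩ := nonempty_interior_of_iUnion_of_closed (X := K)
    (f := fun N : ℕ => {x : K | nsq μ (φ x) ≤ N ∧ dir μ (φ x) ≤ N})
    (fun N => (h.isClosed_sublevel hG N).preimage continuous_subtype_val)
    (eq_univ_of_forall fun x => by
      obtain ⟨N, hN⟩ := exists_nat_ge (max (nsq μ (φ x)) (dir μ (φ x)))
      exact mem_iUnion.2 ⟨N, (le_max_left _ _).trans hN, (le_max_right _ _).trans hN⟩)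
  obtain ⟨δ, hδ, hb⟩ := Metric.isOpen_iff.1 isOpen_interior x0 hx0
  have hKN : ∀ x ∈ K, x ∈ Metric.ball (x0 : ℝ) δ → nsq μ (φ x) ≤ N ∧ dir μ (φ x) ≤ N :=
    fun x hx hd =>
      have hx' := interior_subset (hb (show (⟨x, hx⟩ : K) ∈ Metric.ball x0 δ from hd))
      hx'
  have hgap : ∀ s ∈ Metric.ball (x0 : ℝ) δ, ∃ c ∈ K, c ∈ Metric.ball (x0 : ℝ) δ ∧
      nsq μ (φ s) = nsq μ (φ c) ∧ dir μ (φ s) ≤ Real.exp (2 * |lam| * δ) * N := by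
    intro s hs
    obtain ⟨c, hcK, hc, hr⟩ := exists_mem_uIcc_gap hK (t := s) x0.2
    rw [Metric.mem_ball, Real.dist_eq] at hs
    have hcs : |s - c| ≤ |s - x0| := abs_sub_right_of_mem_uIcc hc
    have hcx : |c - x0| ≤ |s - x0| := abs_sub_left_of_mem_uIcc hc
    have hcb : c ∈ Metric.ball (x0 : ℝ) δ := by
      rw [Metric.mem_ball, Real.dist_eq]; linarith
    obtain ⟨h1, h2⟩ := h.bounds_across_gap hG fun r h3 h4 => not_not.1 (hr r h3 h4)
    refine ⟨c, hcK, hcb, h1, h2.trans ?_⟩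
    have := (hKN c hcK hcb).2
    have := dir_nonneg (μ := μ) (φ c)
    gcongr
    linarith
  have hloc : ∀ s ∈ Metric.ball (x0 : ℝ) δ,
      (∃ M, ∀ᶠ r in 𝓝 s, |kap μ φ r| ≤ M) → LocBd μ φ s := by
    rintro s hs ⟨M, hM⟩
    obtain ⟨ε, hε, he⟩ := Metric.nhds_basis_closedBall.eventually_iff.1
      (hM.and (Metric.isOpen_ball.mem_nhds hs))
    refine ⟨ε, hε, max N (max (Real.exp (2 * |lam| * δ) * N) M), fun r hr => ?_⟩
    rw [← Real.closedBall_eq_Icc] at hr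
    obtain ⟨h1, h2⟩ := he hr
    obtain ⟨c, hcK, hcb, h3, h4⟩ := hgap r h2
    have := (hKN c hcK hcb).1
    simp [h3, this, h4, h1]
  by_cases hpos : ∃ s ∈ K, s ∈ Metric.ball (x0 : ℝ) δ ∧ 0 < nsq μ (φ s)
  · obtain ⟨s, hsK, hsb, hs0⟩ := hpos
    refine hsK (hloc s hsb ⟨max |Real.log (nsq μ (φ s) / 2)| |Real.log N|, ?_⟩)
    filter_upwards [h.eventually_lt_nsq (half_lt_self hs0), Metric.isOpen_ball.mem_nhds hsb]
      with r hr hrb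
    obtain ⟨c, hcK, hcb, h3, -⟩ := hgap r hrb
    have h5 : nsq μ (φ r) ≤ N := h3.trans_le (hKN c hcK hcb).1
    exact abs_le_max_abs_abs (Real.log_le_log (by positivity) hr.le)
      (Real.log_le_log ((half_pos hs0).trans hr) h5)
  · push Not at hpos
    refine x0.2 (hloc x0 (Metric.mem_ball_self hδ) ⟨0, ?_⟩)
    filter_upwards [Metric.ball_mem_nhds (x0 : ℝ) hδ] with r hrb
    obtain ⟨c, hcK, hcb, h3, -⟩ := hgap r hrb
    have h0 : nsq μ (φ r) = 0 := h3.trans (le_antisymm (hpos c hcK hcb) (nsq_nonneg _))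
    simp [kap, h0]

end

end LogSchrodinger

/-- Gradient growth bound for the logarithmic Schrödinger equation:
`μ|∇φ(t)|² ≤ e^{2|λ|t}·μ|∇f|²`. -/
theorem lse_gradient_bound (n : ℕ) (U : EuclideanSpace ℝ (Fin n) → ℝ)
    (hU : ContDiff ℝ (⊤ : ℕ∞) U) (hIntU : Integrable (fun x => Real.exp (-U x)))
    (μ : Measure (EuclideanSpace ℝ (Fin n))) [IsProbabilityMeasure μ]
    (hμ : μ = (ENNReal.ofReal (∫ x, Real.exp (-U x)))⁻¹ •
      MeasureTheory.volume.withDensity (fun x => ENNReal.ofReal (Real.exp (-U x))))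
    (lam : ℝ) (φ : ℝ → EuclideanSpace ℝ (Fin n) → ℂ)
    (f : EuclideanSpace ℝ (Fin n) → ℂ) (hf0 : φ 0 = f)
    (hsmooth : ∀ t, ContDiff ℝ (⊤ : ℕ∞) (φ t))
    (htdiff : ∀ x t, DifferentiableAt ℝ (fun s => φ s x) t)
    (hmass : ∀ t, Integrable (fun x => ‖φ t x‖ ^ 2) μ)
    (hPDE : ∀ t x, Complex.I * deriv (fun s => φ s x) t
      = -(LopC n U (φ t) x) +
        (lam : ℂ) * φ t x * (Real.log (‖φ t x‖ ^ 2 / ∫ y, ‖φ t y‖ ^ 2 ∂μ) : ℂ))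
    (hgradInt : ∀ t, Integrable (fun x => gradSqC n (φ t) x) μ)
    (hentInt : ∀ t, Integrable
      (fun x => ‖φ t x‖ ^ 2 * Real.log (‖φ t x‖ ^ 2 / ∫ y, ‖φ t y‖ ^ 2 ∂μ)) μ)
 :
    ∀ t : ℝ, 0 ≤ t →
      ∫ x, gradSqC n (φ t) x ∂μ
        ≤ Real.exp (2 * |lam| * t) * ∫ x, gradSqC n f x ∂μ := by
  intro t ht
  have hpos : 0 < ∫ x, Real.exp (-U x) := integral_exp_pos hIntU
  have hG : Gibbs U μ := ⟨hU, inferInstance, _, ENNReal.inv_ne_zero.2 ENNReal.ofReal_ne_top,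
    ENNReal.inv_ne_top.2 (ENNReal.ofReal_pos.2 hpos).ne', hμ⟩
  have h : LSE U μ lam φ := ⟨hsmooth, htdiff, hmass, hgradInt, hPDE⟩
  obtain ⟨C, hC⟩ := exists_Bd_of_locBd (c := 0) (d := t) fun r _ => h.locBd hG r
  have := h.dir_le_exp hG hC (Set.left_mem_Icc.2 ht) (Set.right_mem_Icc.2 ht)
  rwa [sub_zero, abs_of_nonneg ht, hf0] at this
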